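/- arXiv:2105.01921 — 4 statements merged into one kernel-verified Lean document; each statement's English description precedes it below -/
import Mathlib

section
/- Let p be a prime with p ≡ 1 (mod 3) and p ≡ 5 (mod 8). Then G = SL₃(p) ⋊ ⟨t⟩, where t is the transpose–inverse automorphism of SL₃(p), has an unravelled rank 4 C-string with Schläfli symbol [4, p, 4]. -/
open Matrix

/-- A C-string of rank `n` for a group `G`: a family of involutions generating `G`,
with non-adjacent members commuting, satisfying the intersection property. -/
def IsCString {G : Type*} [Group G] {n : ℕ} (t : Fin n → G) : Prop :=
  (∀ i, orderOf (t i) = 2) ∧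
  Subgroup.closure (Set.range t) = ⊤ ∧
  (∀ i j : Fin n, 2 ≤ ((i : ℤ) - (j : ℤ)).natAbs → Commute (t i) (t j)) ∧
  ∀ J K : Set (Fin n),
    Subgroup.closure (t '' J) ⊓ Subgroup.closure (t '' K) = Subgroup.closure (t '' (J ∩ K))

/-- A C-string is unravelled if, modulo every nontrivial proper normal subgroup,
either its members do not stay distinct or they no longer form a C-string. -/
def IsUnravelled {G : Type*} [Group G] {n : ℕ} (t : Fin n → G) : Prop :=
  ∀ (N : Subgroup G) [N.Normal], N ≠ ⊥ → N ≠ ⊤ →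
    ¬ Function.Injective (fun i => (QuotientGroup.mk (t i) : G ⧸ N)) ∨
    ¬ IsCString (fun i => (QuotientGroup.mk (t i) : G ⧸ N))


section StringGroups

variable {G : Type*} [Group G]

/-- Adjoining an involution `a` that commutes with `S` enlarges the generated subgroup by at most
the coset of `a`. -/
lemma mem_closure_insert_of_commute {a : G} {S : Set G} (ha : a * a = 1)
    (hc : ∀ s ∈ S, Commute a s) {g : G} (hg : g ∈ Subgroup.closure (insert a S)) :
    g ∈ Subgroup.closure S ∨ a * g ∈ Subgroup.closure S := by
  have hcl : ∀ z ∈ Subgroup.closure S, a * z = z * a := fun z hz => by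
    have : Subgroup.closure S ≤ Subgroup.centralizer {a} := by
      rw [Subgroup.closure_le]
      intro s hs
      rw [SetLike.mem_coe, Subgroup.mem_centralizer_singleton_iff]
      exact (hc s hs).eq.symm
    exact (Subgroup.mem_centralizer_singleton_iff.1 (this hz)).symm
  have key : ∀ x ∈ insert a S, ∀ y, (y ∈ Subgroup.closure S ∨ a * y ∈ Subgroup.closure S) →
      x * y ∈ Subgroup.closure S ∨ a * (x * y) ∈ Subgroup.closure S := by
    rintro x (rfl | hx) y hy
    · rw [← mul_assoc, ha, one_mul]; exact hy.symm
    · have hx' := Subgroup.subset_closure hx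
      rw [← mul_assoc, hcl x hx', mul_assoc]
      exact hy.imp (mul_mem hx') (mul_mem hx')
  induction hg using Subgroup.closure_induction_left with
  | one => exact Or.inl (one_mem _)
  | mul_left x hx y _ ih => exact key x hx y ih
  | inv_mul_cancel x hx y _ ih =>
    rcases hx with rfl | hx
    · rw [inv_eq_of_mul_eq_one_left ha]; exact key x (Or.inl rfl) y ih
    · have hx' := inv_mem (Subgroup.subset_closure hx)
      rw [← mul_assoc, hcl _ hx', mul_assoc]
      exact ih.imp (mul_mem hx') (mul_mem hx')

/-- The elements of a dihedral group generated by involutions `a`, `b` with `(a * b) ^ 4 = 1`. -/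
lemma exists_coset_of_mem_closure_pair {a b : G} (ha : a * a = 1) (hb : b * b = 1)
    (hab : (a * b) ^ 4 = 1) {g : G} (hg : g ∈ Subgroup.closure {a, b}) :
    ∃ c, (c = 1 ∨ c = a ∨ c = b * a ∨ c = a * b * a) ∧ (g = c ∨ g = c * b) := by
  have ha' : a⁻¹ = a := inv_eq_of_mul_eq_one_left ha
  have hb' : b⁻¹ = b := inv_eq_of_mul_eq_one_left hb
  have hbr : b * (a * b * a) = a * b * a * b := by
    have : (a * b * a * b) * (a * b * a * b) = 1 := by
      rw [← hab]; simp only [pow_succ, pow_zero, one_mul, mul_assoc]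
    have h2 := eq_inv_of_mul_eq_one_left this
    rw [h2]; simp only [_root_.mul_inv_rev, ha', hb', mul_assoc]
  have haa : ∀ z, a * (a * z) = z := fun z => by rw [← mul_assoc, ha, one_mul]
  have hbb : ∀ z, b * (b * z) = z := fun z => by rw [← mul_assoc, hb, one_mul]
  have key : ∀ s ∈ ({a, b} : Set G), ∀ g,
      (∃ c, (c = 1 ∨ c = a ∨ c = b * a ∨ c = a * b * a) ∧ (g = c ∨ g = c * b)) →
      ∃ c, (c = 1 ∨ c = a ∨ c = b * a ∨ c = a * b * a) ∧ (s * g = c ∨ s * g = c * b) := by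
    rintro s hs g ⟨c, hc, hg⟩
    have left : ∀ d, (d = 1 ∨ d = a ∨ d = b * a ∨ d = a * b * a) → s * c = d →
        ∃ c, (c = 1 ∨ c = a ∨ c = b * a ∨ c = a * b * a) ∧ (s * g = c ∨ s * g = c * b) := by
      intro d hd hsd
      refine ⟨d, hd, ?_⟩
      rcases hg with rfl | rfl
      · exact Or.inl hsd
      · exact Or.inr (by rw [← mul_assoc, hsd])
    have right : ∀ d, (d = 1 ∨ d = a ∨ d = b * a ∨ d = a * b * a) → s * c = d * b →
        ∃ c, (c = 1 ∨ c = a ∨ c = b * a ∨ c = a * b * a) ∧ (s * g = c ∨ s * g = c * b) := by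
      intro d hd hsd
      refine ⟨d, hd, ?_⟩
      rcases hg with rfl | rfl
      · exact Or.inr hsd
      · exact Or.inl (by rw [← mul_assoc, hsd, mul_assoc, hb, mul_one])
    rcases hs with rfl | rfl
    · rcases hc with rfl | rfl | rfl | rfl
      · exact left s (by simp) (mul_one _)
      · exact left 1 (by simp) ha
      · exact left (s * b * s) (by simp) (mul_assoc _ _ _).symm
      · exact left (b * s) (by simp) (by rw [mul_assoc, haa])
    · rcases hc with h | h | h | h
      · exact right 1 (by simp) (by rw [h, mul_one, one_mul])
      · exact left (s * a) (by simp) (by rw [h])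
      · exact left a (by simp) (by rw [h, hbb])
      · exact right (a * s * a) (by simp) (by rw [h, hbr])
  induction hg using Subgroup.closure_induction_left with
  | one => exact ⟨1, by simp, by simp⟩
  | mul_left x hx y hy ih => exact key x hx y ih
  | inv_mul_cancel x hx y hy ih =>
    have : x⁻¹ = x := by rcases hx with rfl | rfl <;> assumption
    rw [this]; exact key x hx y ih

/-- The data from which the intersection property of a rank 4 string is deduced. -/
structure IsSeparatedString (t : Fin 4 → G) : Prop where
  mul_self : ∀ i, t i * t i = 1
  comm : ∀ i j : Fin 4, 2 ≤ ((i : ℤ) - (j : ℤ)).natAbs → Commute (t i) (t j)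
  facets : ∀ g, g ∈ Subgroup.closure (t '' {0, 1, 2}) → g ∈ Subgroup.closure (t '' {1, 2, 3}) →
    g ∈ Subgroup.closure (t '' {1, 2})
  left : ∀ g, g ∈ Subgroup.closure (t '' {0, 1}) → g ∈ Subgroup.closure (t '' {1, 2}) →
    g ∈ Subgroup.closure (t '' {1})
  right : ∀ g, g ∈ Subgroup.closure (t '' {2, 3}) → g ∈ Subgroup.closure (t '' {1, 2}) →
    g ∈ Subgroup.closure (t '' {2})
  first : t 0 ∉ Subgroup.closure (t '' {1, 2, 3})
  last : t 3 ∉ Subgroup.closure (t '' {0, 1, 2})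
  ne : t 1 ≠ t 2
  one_ne : t 1 ≠ 1
  two_ne : t 2 ≠ 1

namespace IsSeparatedString

variable {t : Fin 4 → G}

lemma closure_rev (t : Fin 4 → G) (J : Set (Fin 4)) :
    Subgroup.closure ((t ∘ Fin.rev) '' J) = Subgroup.closure (t '' (Fin.rev '' J)) := by
  rw [Set.image_comp]

lemma rev (h : IsSeparatedString t) : IsSeparatedString (t ∘ Fin.rev) := by
  have e0 : (Fin.rev 0 : Fin 4) = 3 := rfl
  have e1 : (Fin.rev 1 : Fin 4) = 2 := rfl
  have e2 : (Fin.rev 2 : Fin 4) = 1 := rfl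
  have e3 : (Fin.rev 3 : Fin 4) = 0 := rfl
  have s1 : ({3, 1, 2} : Set (Fin 4)) = {1, 2, 3} := by ext i; fin_cases i <;> simp
  have s2 : ({2, 0, 1} : Set (Fin 4)) = {0, 1, 2} := by ext i; fin_cases i <;> simp
  have s3 : ({2, 1} : Set (Fin 4)) = {1, 2} := Set.pair_comm _ _
  have s4 : ({3, 2} : Set (Fin 4)) = {2, 3} := Set.pair_comm _ _
  have s5 : ({1, 0} : Set (Fin 4)) = {0, 1} := Set.pair_comm _ _
  refine ⟨fun i => h.mul_self _, fun i j hij => h.comm _ _ ?_, ?_, ?_, ?_, ?_, ?_, h.ne.symm,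
    h.two_ne, h.one_ne⟩
  · revert i j; decide
  all_goals simp only [closure_rev]
  all_goals simp only [Set.image_insert_eq (f := Fin.rev), Set.image_singleton (f := Fin.rev),
    Function.comp_apply, e0, e1, e2, e3, s1, s2, s3, s4, s5]
  · exact fun g h1 h2 => h.facets g h2 h1
  · exact h.right
  · exact h.left
  · exact h.last
  · exact h.first

/-- Elements of a parabolic subgroup either lie in the smaller one omitting `i`, or do so after
multiplication by `t i`, provided `i` has no neighbours in `J`. -/
lemma mem_diff (h : IsSeparatedString t) {i : Fin 4} {J : Set (Fin 4)} (hi : i ∈ J)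
    (hJ : ∀ j ∈ J, j ≠ i → 2 ≤ ((i : ℤ) - (j : ℤ)).natAbs) {g : G}
    (hg : g ∈ Subgroup.closure (t '' J)) :
    g ∈ Subgroup.closure (t '' (J \ {i})) ∨ t i * g ∈ Subgroup.closure (t '' (J \ {i})) := by
  apply mem_closure_insert_of_commute (h.mul_self i)
  · rintro _ ⟨j, hj, rfl⟩
    exact h.comm _ _ (hJ j hj.1 hj.2)
  · rwa [← Set.image_insert_eq, Set.insert_sdiff_singleton, Set.insert_eq_of_mem hi]

lemma mono {J K : Set (Fin 4)} (hJK : J ⊆ K) {g : G} (hg : g ∈ Subgroup.closure (t '' J)) :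
    g ∈ Subgroup.closure (t '' K) :=
  Subgroup.closure_mono (Set.image_mono hJK) hg

lemma mem_gen {J : Set (Fin 4)} {i : Fin 4} (hi : i ∈ J) : t i ∈ Subgroup.closure (t '' J) :=
  Subgroup.subset_closure ⟨i, hi, rfl⟩

lemma mem_single (h : IsSeparatedString t) {i : Fin 4} {g : G}
    (hg : g ∈ Subgroup.closure (t '' {i})) : g = 1 ∨ g = t i := by
  rcases h.mem_diff (i := i) (J := {i}) rfl (fun j hj hne => absurd hj hne) hg with h1 | h1 <;>
    simp only [Set.sdiff_self, Set.image_empty, Subgroup.closure_empty, Subgroup.mem_bot] at h1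
  · exact Or.inl h1
  · right
    have := h.mul_self i
    exact (mul_left_cancel (h1.trans this.symm))

lemma cancel_left {H : Subgroup G} {a g : G} (h : a * g ∈ H) (hg : g ∈ H) : a ∈ H :=
  (Subgroup.mul_mem_cancel_right H hg).1 h

lemma mem_left (h : IsSeparatedString t) {g : G} (h1 : g ∈ Subgroup.closure (t '' {0, 1}))
    (h2 : g ∈ Subgroup.closure (t '' {1, 2, 3})) : g ∈ Subgroup.closure (t '' {1}) :=
  h.left g h1 (h.facets g (mono (by grind) h1) h2)

lemma mem_right (h : IsSeparatedString t) {g : G} (h1 : g ∈ Subgroup.closure (t '' {2, 3}))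
    (h2 : g ∈ Subgroup.closure (t '' {0, 1, 2})) : g ∈ Subgroup.closure (t '' {2}) :=
  h.right g h1 (h.facets g h2 (mono (by grind) h1))

lemma eq_one (h : IsSeparatedString t) {g : G} (h1 : g ∈ Subgroup.closure (t '' {0, 1}))
    (h2 : g ∈ Subgroup.closure (t '' {2, 3})) : g = 1 := by
  have h3 := h.mem_single (h.mem_left h1 (mono (by grind) h2))
  have h4 := h.mem_single (h.mem_right h2 (mono (by grind) h1))
  have := h.ne
  grind

lemma omit_zero (h : IsSeparatedString t) {J : Set (Fin 4)} {g : G}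
    (h1 : g ∈ Subgroup.closure (t '' J)) (h2 : g ∈ Subgroup.closure (t '' {1, 2, 3})) :
    g ∈ Subgroup.closure (t '' (J \ {0})) := by
  by_cases j0 : (0 : Fin 4) ∈ J
  swap
  · rwa [Set.sdiff_singleton_eq_self j0]
  by_cases j1 : (1 : Fin 4) ∈ J
  swap
  · rcases h.mem_diff j0 (fun j hj hne => by fin_cases j <;> simp_all) h1 with h3 | h3
    · exact h3
    · exact absurd (cancel_left (mono (fun j hj => by
        have := hj.1; have := hj.2; fin_cases j <;> simp_all) h3) h2) h.first
  by_cases j3 : (3 : Fin 4) ∈ J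
  · by_cases j2 : (2 : Fin 4) ∈ J
    · exact mono (fun j hj => by fin_cases j <;> simp_all) h2
    · have e : J \ {3} ⊆ {0, 1} := fun j hj => by fin_cases j <;> simp_all
      have e1 : ({1} : Set (Fin 4)) ⊆ J \ {0} := by simp [j1]
      rcases h.mem_diff j3 (fun j hj hne => by fin_cases j <;> simp_all) h1 with h3 | h3
      · exact mono e1 (h.mem_left (mono e h3) h2)
      · have h4 := mono e1 (h.mem_left (mono e h3)
          (mul_mem (mem_gen (by simp)) h2))
        exact (Subgroup.mul_mem_cancel_left _ (mem_gen (by simp [j3]))).1 h4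
  · by_cases j2 : (2 : Fin 4) ∈ J
    · exact mono (by grind) (h.facets g (mono (fun j hj => by fin_cases j <;> simp_all) h1) h2)
    · exact mono (by grind) (h.mem_left (mono (fun j hj => by fin_cases j <;> simp_all) h1) h2)

lemma omit_one (h : IsSeparatedString t) {J : Set (Fin 4)} {g : G}
    (h1 : g ∈ Subgroup.closure (t '' J)) (h2 : g ∈ Subgroup.closure (t '' {0, 2, 3})) :
    g ∈ Subgroup.closure (t '' (J \ {1})) := by
  have e0 : ({0, 2, 3} : Set (Fin 4)) \ {0} = {2, 3} := by ext j; fin_cases j <;> simp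
  by_cases j0 : (0 : Fin 4) ∈ J
  · -- multiply by `t 0` to land in the subgroup generated by `t 2` and `t 3`
    wlog hg : g ∈ Subgroup.closure (t '' {2, 3}) generalizing g
    · rcases h.mem_diff (i := 0) (by simp) (fun j hj hne => by fin_cases j <;> simp_all) h2
        with h3 | h3
      · exact absurd (e0 ▸ h3) hg
      · have m0 : t 0 ∈ Subgroup.closure (t '' (J \ {1})) := mem_gen (by simp [j0])
        exact (Subgroup.mul_mem_cancel_left _ m0).1 (this (mul_mem (mem_gen j0) h1)
          (mul_mem (mem_gen (by simp)) h2) (e0 ▸ h3))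
    by_cases j2 : (2 : Fin 4) ∈ J
    · by_cases j3 : (3 : Fin 4) ∈ J
      · exact mono (by grind) hg
      · exact mono (by grind) (h.mem_right hg
          (mono (fun j hj => by fin_cases j <;> simp_all) h1))
    · by_cases j3 : (3 : Fin 4) ∈ J
      · have e : J \ {3} ⊆ {0, 1} := fun j hj => by fin_cases j <;> simp_all
        rcases h.mem_diff j3 (fun j hj hne => by fin_cases j <;> simp_all) h1 with h3 | h3
        · rw [h.eq_one (mono e h3) hg]; exact one_mem _
        · have h4 := h.eq_one (mono e h3) (mul_mem (mem_gen (by simp)) hg)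
          refine (Subgroup.mul_mem_cancel_left _ (mem_gen (i := 3) (by simp [j3]))).1 ?_
          rw [h4]; exact one_mem _
      · rw [h.eq_one (mono (fun j hj => by fin_cases j <;> simp_all) h1) hg]
        exact one_mem _
  · have hL := mono (K := {1, 2, 3}) (fun j hj => by fin_cases j <;> simp_all) h1
    have hg := e0 ▸ h.omit_zero h2 hL
    by_cases j2 : (2 : Fin 4) ∈ J
    · by_cases j3 : (3 : Fin 4) ∈ J
      · exact mono (by grind) hg
      · exact mono (by grind) (h.right g hg
          (mono (fun j hj => by fin_cases j <;> simp_all) h1))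
    · by_cases j1 : (1 : Fin 4) ∈ J
      · rcases h.mem_diff j1 (fun j hj hne => by fin_cases j <;> simp_all) h1 with h3 | h3
        · exact h3
        · have h4 : t 1 ∈ Subgroup.closure (t '' {2, 3}) := cancel_left
            (mono (fun j hj => by fin_cases j <;> simp_all) h3) hg
          rcases h.mem_single (h.right _ h4 (mem_gen (by simp))) with h5 | h5
          · exact absurd h5 h.one_ne
          · exact absurd h5 h.ne
      · rwa [Set.sdiff_singleton_eq_self j1]

lemma omit_gen (h : IsSeparatedString t) {J : Set (Fin 4)} {g : G} (i : Fin 4)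
    (h1 : g ∈ Subgroup.closure (t '' J)) (h2 : g ∈ Subgroup.closure (t '' {i}ᶜ)) :
    g ∈ Subgroup.closure (t '' (J \ {i})) := by
  have hrev : ∀ K : Set (Fin 4), Subgroup.closure (t '' K) =
      Subgroup.closure ((t ∘ Fin.rev) '' (Fin.rev '' K)) := fun K => by
    rw [closure_rev, ← Set.image_comp Fin.rev Fin.rev, Fin.rev_involutive.comp_self,
      Set.image_id]
  have hJ : ∀ k : Fin 4, Fin.rev '' (J \ {k}) = (Fin.rev '' J) \ {k.rev} := fun k => by
    rw [Set.image_sdiff Fin.rev_injective, Set.image_singleton]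
  fin_cases i
  · exact h.omit_zero h1 (mono (fun j hj => by fin_cases j <;> simp_all) h2)
  · exact h.omit_one h1 (mono (fun j hj => by fin_cases j <;> simp_all) h2)
  · rw [hrev] at h1 h2 ⊢
    rw [hJ]
    exact h.rev.omit_one h1 (mono (by
      rintro _ ⟨j, hj, rfl⟩; revert hj; fin_cases j <;> simp +decide) h2)
  · rw [hrev] at h1 h2 ⊢
    rw [hJ]
    exact h.rev.omit_zero h1 (mono (by
      rintro _ ⟨j, hj, rfl⟩; revert hj; fin_cases j <;> simp +decide) h2)

/-- A separated string has the intersection property. -/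
lemma inf_eq (h : IsSeparatedString t) (J K : Set (Fin 4)) :
    Subgroup.closure (t '' J) ⊓ Subgroup.closure (t '' K) =
      Subgroup.closure (t '' (J ∩ K)) := by
  refine le_antisymm (fun g hg => ?_) (le_inf (Subgroup.closure_mono (Set.image_mono (by simp)))
    (Subgroup.closure_mono (Set.image_mono (by simp))))
  obtain ⟨hJ, hK⟩ := hg
  have step : ∀ (i : Fin 4) (A : Set (Fin 4)), g ∈ Subgroup.closure (t '' A) →
      g ∈ Subgroup.closure (t '' (A \ ({i} \ K))) := by
    intro i A hA
    by_cases hi : i ∈ K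
    · exact mono (by grind) hA
    · exact mono (by grind) (h.omit_gen i hA (mono (by grind) hK))
  refine mono ?_ (step 0 _ (step 1 _ (step 2 _ (step 3 _ hJ))))
  intro j hj
  fin_cases j <;> simp_all

end IsSeparatedString

end StringGroups

section SpecialLinear

open scoped MatrixGroups

variable {F : Type*} [Field F]

/-- The upper unitriangular matrix with the given entries in positions `12`, `23` and `13`. -/
def upper (a b c : F) : SL(3, F) :=
  ⟨!![1, a, c; 0, 1, b; 0, 0, 1], by simp [det_fin_three]⟩

/-- The lower unitriangular matrix with the given entries in positions `21`, `32` and `31`. -/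
def lower (a b c : F) : SL(3, F) :=
  ⟨!![1, 0, 0; a, 1, 0; c, b, 1], by simp [det_fin_three]⟩

@[simp] lemma coe_upper (a b c : F) :
    (upper a b c : Matrix (Fin 3) (Fin 3) F) = !![1, a, c; 0, 1, b; 0, 0, 1] := rfl

@[simp] lemma coe_lower (a b c : F) :
    (lower a b c : Matrix (Fin 3) (Fin 3) F) = !![1, 0, 0; a, 1, 0; c, b, 1] := rfl

lemma sl_ext {A B : SL(3, F)}
    (h : (A : Matrix (Fin 3) (Fin 3) F) = (B : Matrix (Fin 3) (Fin 3) F)) : A = B :=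
  Subtype.ext h

lemma upper_mul (a b c a' b' c' : F) :
    upper a b c * upper a' b' c' = upper (a + a') (b + b') (c + c' + a * b') := by
  apply sl_ext
  simp
  grind

lemma lower_mul (a b c a' b' c' : F) :
    lower a b c * lower a' b' c' = lower (a + a') (b + b') (c + c' + b * a') := by
  apply sl_ext
  simp
  grind

lemma upper_inv (a b c : F) : (upper a b c)⁻¹ = upper (-a) (-b) (a * b - c) := by
  rw [inv_eq_iff_mul_eq_one, upper_mul]
  apply sl_ext
  simp [one_fin_three]

lemma lower_inv (a b c : F) : (lower a b c)⁻¹ = lower (-a) (-b) (a * b - c) := by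
  rw [inv_eq_iff_mul_eq_one, lower_mul]
  apply sl_ext
  simp [one_fin_three]
  grind

/-- A subgroup containing all upper and lower unitriangular matrices is everything. -/
theorem eq_top_of_unitriangular {P : Subgroup SL(3, F)} (hU : ∀ a b c, upper a b c ∈ P)
    (hL : ∀ a b c, lower a b c ∈ P) : P = ⊤ := by
  have htv : ∀ t : TransvectionStruct (Fin 3) F, ∃ g ∈ P, (g : Matrix _ _ F) = t.toMatrix := by
    rintro ⟨i, j, hij, c⟩
    fin_cases i <;> fin_cases j <;>
      first
      | exact absurd rfl hij
      | (refine ⟨_, hU c 0 0, ?_⟩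
         ext i j; fin_cases i <;> fin_cases j <;> simp [Matrix.transvection, one_apply]; done)
      | (refine ⟨_, hU 0 c 0, ?_⟩
         ext i j; fin_cases i <;> fin_cases j <;> simp [Matrix.transvection, one_apply]; done)
      | (refine ⟨_, hU 0 0 c, ?_⟩
         ext i j; fin_cases i <;> fin_cases j <;> simp [Matrix.transvection, one_apply]; done)
      | (refine ⟨_, hL c 0 0, ?_⟩
         ext i j; fin_cases i <;> fin_cases j <;> simp [Matrix.transvection, one_apply]; done)
      | (refine ⟨_, hL 0 c 0, ?_⟩
         ext i j; fin_cases i <;> fin_cases j <;> simp [Matrix.transvection, one_apply]; done)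
      | (refine ⟨_, hL 0 0 c, ?_⟩
         ext i j; fin_cases i <;> fin_cases j <;> simp [Matrix.transvection, one_apply])
  have hlist : ∀ l : List (TransvectionStruct (Fin 3) F),
      ∃ g ∈ P, (g : Matrix _ _ F) = (l.map TransvectionStruct.toMatrix).prod := by
    intro l
    induction l with
    | nil => exact ⟨1, one_mem _, by simp⟩
    | cons t l ih =>
      obtain ⟨g, hg, hgt⟩ := htv t
      obtain ⟨k, hk, hkt⟩ := ih
      exact ⟨g * k, mul_mem hg hk, by simp [hgt, hkt]⟩
  rw [Subgroup.eq_top_iff']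
  intro A
  obtain ⟨L, L', D, hD⟩ := Pivot.exists_list_transvec_mul_diagonal_mul_list_transvec
    (A : Matrix (Fin 3) (Fin 3) F)
  obtain ⟨g, hg, hgL⟩ := hlist L
  obtain ⟨k, hk, hkL⟩ := hlist L'
  have hdet : D 0 * D 1 * D 2 = 1 := by
    have := congrArg det hD
    simpa [← hgL, ← hkL, Fin.prod_univ_three] using this.symm
  have h0 : D 0 ≠ 0 := by rintro h; simp [h] at hdet
  have h1 : D 1 ≠ 0 := by rintro h; simp [h] at hdet
  have h2 : D 2 = (D 0 * D 1)⁻¹ := eq_inv_of_mul_eq_one_right hdet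
  have hdiag : ∃ d ∈ P, (d : Matrix (Fin 3) (Fin 3) F) = diagonal D := by
    set x := D 0
    set y := D 0 * D 1 with hy
    have hy0 : y ≠ 0 := mul_ne_zero h0 h1
    refine ⟨(upper x 0 0 * lower (-x⁻¹) 0 0 * upper x 0 0 * upper (-1) 0 0 * lower 1 0 0 *
      upper (-1) 0 0) * (upper 0 y 0 * lower 0 (-y⁻¹) 0 * upper 0 y 0 * upper 0 (-1) 0 *
      lower 0 1 0 * upper 0 (-1) 0), ?_, ?_⟩
    · repeat' apply mul_mem
      all_goals first | apply hU | apply hL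
    · have hD1 : D 1 = x⁻¹ * y := by rw [hy]; field_simp; rfl
      ext i j
      fin_cases i <;> fin_cases j <;> simp [h2, hD1, h0, hy0]
      all_goals grind
  obtain ⟨d, hd, hdD⟩ := hdiag
  have : A = g * d * k := by
    apply sl_ext
    rw [hD, Matrix.SpecialLinearGroup.coe_mul, Matrix.SpecialLinearGroup.coe_mul, hgL, hkL, hdD]
  rw [this]
  exact mul_mem (mul_mem hg hd) hk

lemma exists_scalar_of_cross_eq_zero {A : Matrix (Fin 3) (Fin 3) F}
    (h : ∀ v, v ⨯₃ (A *ᵥ v) = 0) : ∃ z, A = scalar (Fin 3) z := by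
  refine ⟨A 0 0, ?_⟩
  have h1 := h ![1, 0, 0]
  have h2 := h ![0, 1, 0]
  have h3 := h ![0, 0, 1]
  have h4 := h ![1, 1, 0]
  have h5 := h ![1, 0, 1]
  simp [cross_apply, mulVec, dotProduct, Fin.sum_univ_three] at h1 h2 h3 h4 h5
  ext i j
  fin_cases i <;> fin_cases j <;> simp <;> grind

/-- A non-scalar matrix is conjugate to one sending the first basis vector to the second. -/
lemma exists_conj_first_column {A : SL(3, F)}
    (hA : ∀ z, (A : Matrix (Fin 3) (Fin 3) F) ≠ scalar (Fin 3) z) :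
    ∃ g B : SL(3, F), A * g = g * B ∧ B 0 0 = 0 ∧ B 1 0 = 1 ∧ B 2 0 = 0 := by
  obtain ⟨v, hv⟩ : ∃ v, v ⨯₃ ((A : Matrix (Fin 3) (Fin 3) F) *ᵥ v) ≠ 0 := by
    by_contra! h
    obtain ⟨z, hz⟩ := exists_scalar_of_cross_eq_zero h
    exact hA z hz
  set w := (A : Matrix (Fin 3) (Fin 3) F) *ᵥ v with hw
  obtain ⟨i, hi⟩ : ∃ i, (v ⨯₃ w) i ≠ 0 := by
    by_contra! h
    exact hv (funext h)
  set x : Fin 3 → F := Pi.single i ((v ⨯₃ w) i)⁻¹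
  have hdet : (!![v 0, w 0, x 0; v 1, w 1, x 1; v 2, w 2, x 2]).det = 1 := by
    have h1 : x ⬝ᵥ (v ⨯₃ w) = 1 := by simp [x, hi]
    rw [← h1]
    simp [cross_apply, det_fin_three, dotProduct, Fin.sum_univ_three]
    ring
  obtain ⟨g, hg⟩ : ∃ g : SL(3, F), (g : Matrix (Fin 3) (Fin 3) F) =
      !![v 0, w 0, x 0; v 1, w 1, x 1; v 2, w 2, x 2] := ⟨⟨_, hdet⟩, rfl⟩
  have hcol : ∀ i, ((A * g : SL(3, F)) : Matrix (Fin 3) (Fin 3) F) i 0 =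
      (g : Matrix (Fin 3) (Fin 3) F) i 1 := by
    intro i
    have : w i = (A : Matrix (Fin 3) (Fin 3) F) i ⬝ᵥ v := rfl
    simp only [dotProduct, Fin.sum_univ_three] at this
    rw [Matrix.SpecialLinearGroup.coe_mul, mul_apply, Fin.sum_univ_three, hg]
    fin_cases i <;> simp <;> exact this.symm
  have hB : ∀ i, ((g⁻¹ * (A * g) : SL(3, F)) : Matrix (Fin 3) (Fin 3) F) i 0 =
      ((g⁻¹ * g : SL(3, F)) : Matrix (Fin 3) (Fin 3) F) i 1 := by
    intro i
    rw [Matrix.SpecialLinearGroup.coe_mul g⁻¹, mul_apply, Matrix.SpecialLinearGroup.coe_mul g⁻¹, mul_apply]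
    simp_rw [hcol]
  refine ⟨g, g⁻¹ * (A * g), by group, ?_, ?_, ?_⟩ <;> rw [hB, inv_mul_cancel] <;> simp

/-- A normal subgroup of `SL₃` with a non-scalar element contains all upper unitriangular
matrices. -/
theorem upper_mem_of_normal {N : Subgroup SL(3, F)} [hN : N.Normal] {A : SL(3, F)} (hAN : A ∈ N)
    (hA : ∀ z, (A : Matrix (Fin 3) (Fin 3) F) ≠ scalar (Fin 3) z) (a b c : F) :
    upper a b c ∈ N := by
  -- once some `upper 0 β α` with `β ≠ 0` is available, commutators produce everything
  have main : ∀ α β : F, β ≠ 0 → upper 0 β α ∈ N → upper a b c ∈ N := by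
    intro α β hβ h
    have h13 : ∀ s, upper 0 0 s ∈ N := by
      intro s
      have := mul_mem (hN.conj_mem _ h (upper (s / β) 0 0)) (inv_mem h)
      rw [upper_inv, upper_inv, upper_mul, upper_mul, upper_mul] at this
      convert this using 2 <;> grind
    have h12 : ∀ s, upper s 0 0 ∈ N := by
      intro s
      have := mul_mem (hN.conj_mem _ (h13 (-s)) (lower 0 1 0)) (h13 s)
      convert this using 1
      rw [lower_inv]
      apply sl_ext
      simp
    have h23 : ∀ s, upper 0 s 0 ∈ N := by
      intro s
      have := mul_mem (hN.conj_mem _ (h13 s) (lower 1 0 0)) (h13 (-s))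
      convert this using 1
      rw [lower_inv]
      apply sl_ext
      simp
    have := mul_mem (mul_mem (h23 b) (h12 a)) (h13 c)
    rw [upper_mul, upper_mul] at this
    simpa using this
  have main' : ∀ α β : F, (α ≠ 0 ∨ β ≠ 0) → upper 0 β α ∈ N → upper a b c ∈ N := by
    intro α β h hm
    by_cases hβ : β = 0
    · subst hβ
      have hα : α ≠ 0 := by simpa using h
      refine main α α hα ?_
      have := hN.conj_mem _ hm (lower 1 0 0)
      convert this using 1
      rw [lower_inv]
      apply sl_ext
      simp
    · exact main α β hβ hm
  obtain ⟨g, B, hgB, h0, h1, h2⟩ := exists_conj_first_column hA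
  have hB : B ∈ N := by
    have := hN.conj_mem _ hAN g⁻¹
    rwa [inv_inv, mul_assoc, hgB, inv_mul_cancel_left] at this
  have hdet := B.det_coe
  rw [det_fin_three, h0, h1, h2] at hdet
  obtain ⟨C, hCe⟩ : ∃ C : SL(3, F), (C : Matrix (Fin 3) (Fin 3) F) =
      !![1, 0, -1; B 2 1, 1, -B 0 1 - B 2 1; 0, 0, 1] := ⟨⟨_, by simp [det_fin_three]⟩, rfl⟩
  have hC : C ∈ N := by
    have h : C = B * (upper 0 0 1 * B⁻¹ * (upper 0 0 1)⁻¹) := by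
      have : C * upper 0 0 1 * B = B * upper 0 0 1 := by
        apply sl_ext
        ext i j
        fin_cases i <;> fin_cases j <;>
          simp [hCe, mul_apply, Fin.sum_univ_three, h0, h1, h2] <;> grind
      rw [← mul_assoc, ← mul_assoc, eq_mul_inv_iff_mul_eq, eq_mul_inv_iff_mul_eq, this]
    rw [h]
    exact mul_mem hB (hN.conj_mem _ (inv_mem hB) _)
  by_cases he : B 2 1 = 0
  · refine main' (-1) (-B 0 1 - B 2 1) (by simp) ?_
    convert hC using 1
    apply sl_ext
    simp [hCe, he]
  · refine main' 0 (B 2 1) (Or.inr he) ?_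
    have h : upper 0 (B 2 1) 0 = C * (upper 0 0 1 * C⁻¹ * (upper 0 0 1)⁻¹) := by
      rw [← mul_assoc, ← mul_assoc, eq_mul_inv_iff_mul_eq, eq_mul_inv_iff_mul_eq]
      apply sl_ext
      simp [hCe]
    rw [h]
    exact mul_mem hC (hN.conj_mem _ (inv_mem hC) _)

end SpecialLinear

section GraphExtension

open scoped MatrixGroups

variable {F : Type*} [Field F]

/-- The transpose-inverse automorphism of `SL₃`. -/
def contra (A : SL(3, F)) : SL(3, F) := (A⁻¹).transpose

lemma coe_contra (A : SL(3, F)) :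
    (contra A : Matrix (Fin 3) (Fin 3) F) = (adjugate (A : Matrix (Fin 3) (Fin 3) F))ᵀ := rfl

omit [Field F] in
lemma transpose_fin_three (a b c d e f g k l : F) :
    (!![a, b, c; d, e, f; g, k, l])ᵀ = !![a, d, g; b, e, k; c, f, l] := by
  ext i j
  fin_cases i <;> fin_cases j <;> rfl

lemma contra_mul (A B : SL(3, F)) : contra (A * B) = contra A * contra B := by
  apply sl_ext
  rw [coe_contra, Matrix.SpecialLinearGroup.coe_mul, adjugate_mul_distrib, transpose_mul,
    Matrix.SpecialLinearGroup.coe_mul, coe_contra, coe_contra]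

lemma contra_eq_of_mul {A B : SL(3, F)}
    (h : (A : Matrix (Fin 3) (Fin 3) F)ᵀ * (B : Matrix (Fin 3) (Fin 3) F) = 1) :
    contra A = B := by
  have h' : A.transpose * B = 1 := sl_ext h
  have h2 : contra A = A.transpose⁻¹ := by
    apply sl_ext
    simp [coe_contra, adjugate_transpose]
  rw [h2, inv_eq_of_mul_eq_one_right h']

@[simp] lemma contra_one : contra (1 : SL(3, F)) = 1 := contra_eq_of_mul (by simp)

lemma contra_contra (A : SL(3, F)) : contra (contra A) = A := by
  apply contra_eq_of_mul
  rw [coe_contra, transpose_transpose, adjugate_mul, Matrix.SpecialLinearGroup.det_coe, one_smul]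

lemma contra_upper (a b c : F) : contra (upper a b c) = lower (-a) (-b) (a * b - c) := by
  apply contra_eq_of_mul
  simp [transpose_fin_three, one_fin_three]
  grind

lemma contra_lower (a b c : F) : contra (lower a b c) = upper (-a) (-b) (a * b - c) := by
  apply contra_eq_of_mul
  simp [transpose_fin_three, one_fin_three]

/-- `G` is the extension of `ι SL₃` by an involution `τ` acting as the transpose-inverse map. -/
structure IsGraphExtension {G : Type*} [Group G] (ι : SL(3, F) →* G) (τ : G) : Prop where
  injective : Function.Injective ι
  mul_self : τ * τ = 1
  mul_map : ∀ A, τ * ι A = ι (contra A) * τ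
  map_ne : ∀ A, ι A ≠ τ
  exists_eq : ∀ g, ∃ A, g = ι A ∨ g = ι A * τ

namespace IsGraphExtension

variable {G : Type*} [Group G] {ι : SL(3, F) →* G} {τ : G} (h : IsGraphExtension ι τ)
include h

lemma map_ne_outer (A B : SL(3, F)) : ι A ≠ ι B * τ := by
  intro hAB
  apply h.map_ne (B⁻¹ * A)
  rw [map_mul, hAB, map_inv, inv_mul_cancel_left]

lemma outer_mul_map (A B : SL(3, F)) : ι A * τ * ι B = ι (A * contra B) * τ := by
  rw [mul_assoc, h.mul_map, map_mul, mul_assoc]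

lemma outer_mul_outer (A B : SL(3, F)) : ι A * τ * (ι B * τ) = ι (A * contra B) := by
  rw [← mul_assoc, h.outer_mul_map, mul_assoc, h.mul_self, mul_one]

omit h in
lemma map_mul_outer (A B : SL(3, F)) : ι A * (ι B * τ) = ι (A * B) * τ := by
  rw [map_mul, mul_assoc]

lemma outer_injective {A B : SL(3, F)} (hAB : ι A * τ = ι B * τ) : A = B :=
  h.injective (mul_right_cancel hAB)

lemma inv_tau : τ⁻¹ = τ := inv_eq_of_mul_eq_one_left h.mul_self

lemma tau_mul_map_mul_tau (A : SL(3, F)) : τ * ι A * τ = ι (contra A) := by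
  rw [h.mul_map, mul_assoc, h.mul_self, mul_one]

/-- A normal subgroup containing an element outside `ι SL₃` contains a non-scalar element
of `ι SL₃`. -/
lemma exists_nonscalar {N : Subgroup G} [hN : N.Normal] {X : SL(3, F)} (hX : ι X * τ ∈ N) :
    ∃ A, ι A ∈ N ∧ ∀ z, (A : Matrix (Fin 3) (Fin 3) F) ≠ scalar (Fin 3) z := by
  by_contra! hs
  have key : ∀ A : SL(3, F), ∃ z, ∀ i j,
      ((X * contra A : SL(3, F)) : Matrix (Fin 3) (Fin 3) F) i j =
        z * ((A * X : SL(3, F)) : Matrix (Fin 3) (Fin 3) F) i j := by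
    intro A
    have hm : ι (X * contra A * X⁻¹ * A⁻¹) ∈ N := by
      have := mul_mem hX (hN.conj_mem _ (inv_mem hX) (ι A))
      convert this using 1
      rw [_root_.mul_inv_rev, h.inv_tau, ← mul_assoc, ← mul_assoc, h.outer_mul_map, ← mul_assoc,
        mul_assoc _ τ τ, h.mul_self, mul_one]
      simp only [map_mul, map_inv]
    obtain ⟨z, hz⟩ := hs _ hm
    refine ⟨z, fun i j => ?_⟩
    have : X * contra A = X * contra A * X⁻¹ * A⁻¹ * (A * X) := by group
    rw [this, Matrix.SpecialLinearGroup.coe_mul (X * contra A * X⁻¹ * A⁻¹), hz]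
    simp
  obtain ⟨z1, k1⟩ := key (upper 1 0 0)
  obtain ⟨z2, k2⟩ := key (upper 0 1 0)
  obtain ⟨z3, k3⟩ := key (lower 1 0 0)
  rw [contra_upper] at k1 k2
  rw [contra_lower] at k3
  simp only [Matrix.SpecialLinearGroup.coe_mul, coe_upper, coe_lower, mul_apply,
    Fin.sum_univ_three] at k1 k2 k3
  have h10 := k1 0 2
  have h11 := k1 1 2
  have h21 := k2 1 2
  have h22 := k2 2 2
  have h30 := k3 0 2
  have h31 := k3 1 2
  have hdet := X.det_coe
  rw [det_fin_three] at hdet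
  simp at h10 h11 h21 h22 h30 h31
  have e1 : (X : Matrix (Fin 3) (Fin 3) F) 1 2 = 0 := by grind
  have e2 : (X : Matrix (Fin 3) (Fin 3) F) 2 2 = 0 := by grind
  have e0 : (X : Matrix (Fin 3) (Fin 3) F) 0 2 = 0 := by grind
  simp [e0, e1, e2] at hdet

end IsGraphExtension

end GraphExtension

section Parameters

open scoped MatrixGroups

/-- The scalars entering the construction of the string: a half `h`, a primitive cube root of
unity `w` and a square root `i` of `-1`. -/
structure Params (F : Type*) [Field F] where
  h : F
  w : F
  i : F
  two_mul_h : 2 * h = 1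
  w_sq : w ^ 2 + w + 1 = 0
  i_sq : i ^ 2 = -1
  three_ne : (3 : F) ≠ 0
  five_ne : (5 : F) ≠ 0

namespace Params

variable {F : Type*} [Field F] (P : Params F)

include P in
lemma two_ne : (2 : F) ≠ 0 := by
  intro h
  simpa [h] using P.two_mul_h

/-- The orthogonal unipotent one-parameter subgroup. -/
def x (s : F) : SL(3, F) := upper s s (P.h * s ^ 2)

/-- The transposed one-parameter subgroup. -/
def y (s : F) : SL(3, F) := lower s s (P.h * s ^ 2)

/-- A diagonal involution inverting `P.x s` and `P.y s`. -/
def r (_ : Params F) : SL(3, F) := ⟨!![-1, 0, 0; 0, 1, 0; 0, 0, -1], by simp [det_fin_three]⟩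

/-- The antidiagonal form preserved by `P.x s`, `P.y s` and `P.r`. -/
def form (_ : Params F) : SL(3, F) := ⟨!![0, 0, 1; 0, -1, 0; 1, 0, 0], by simp [det_fin_three]⟩

/-- The second form, preserved by `P.x s`, `P.r` and compatible with `P.a`. -/
def form' : SL(3, F) :=
  ⟨!![P.w - 1, 0, P.w ^ 2; 0, -P.w ^ 2, 0; P.w ^ 2, 0, 0], by
    have := P.w_sq
    simp [det_fin_three]
    grind⟩

/-- The symmetric matrix defining the last generator. -/
def a : SL(3, F) :=
  ⟨!![-P.w, P.w, 1; P.w, 0, P.w ^ 2; 1, P.w ^ 2, -P.w ^ 2], by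
    have := P.w_sq
    simp [det_fin_three]
    grind⟩

@[simp] lemma coe_x (s : F) : (P.x s : Matrix (Fin 3) (Fin 3) F) =
    !![1, s, P.h * s ^ 2; 0, 1, s; 0, 0, 1] := rfl

@[simp] lemma coe_y (s : F) : (P.y s : Matrix (Fin 3) (Fin 3) F) =
    !![1, 0, 0; s, 1, 0; P.h * s ^ 2, s, 1] := rfl

@[simp] lemma coe_r : (P.r : Matrix (Fin 3) (Fin 3) F) =
    !![-1, 0, 0; 0, 1, 0; 0, 0, -1] := rfl

@[simp] lemma coe_form : (P.form : Matrix (Fin 3) (Fin 3) F) =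
    !![0, 0, 1; 0, -1, 0; 1, 0, 0] := rfl

@[simp] lemma coe_form' : (P.form' : Matrix (Fin 3) (Fin 3) F) =
    !![P.w - 1, 0, P.w ^ 2; 0, -P.w ^ 2, 0; P.w ^ 2, 0, 0] := rfl

@[simp] lemma coe_a : (P.a : Matrix (Fin 3) (Fin 3) F) =
    !![-P.w, P.w, 1; P.w, 0, P.w ^ 2; 1, P.w ^ 2, -P.w ^ 2] := rfl

lemma x_add (s s' : F) : P.x (s + s') = P.x s * P.x s' := by
  have := P.two_mul_h
  rw [x, x, x, upper_mul]
  congr 1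
  grind

@[simp] lemma x_zero : P.x 0 = 1 := by
  apply sl_ext
  simp [one_fin_three]

lemma r_mul_r : P.r * P.r = 1 := by
  apply sl_ext
  simp [one_fin_three]

lemma contra_x (s : F) : contra (P.x s) = P.y (-s) := by
  have := P.two_mul_h
  rw [x, y, contra_upper]
  congr 1
  grind

lemma contra_r : contra P.r = P.r := by
  apply contra_eq_of_mul
  simp [one_fin_three, transpose_fin_three]

lemma contra_form : contra P.form = P.form := by
  apply contra_eq_of_mul
  simp [one_fin_three, transpose_fin_three]

lemma contra_a : contra P.a = P.r * P.a * P.r := by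
  have := P.w_sq
  apply contra_eq_of_mul
  simp [one_fin_three, transpose_fin_three]
  grind

lemma contra_form' : (contra P.form' : Matrix (Fin 3) (Fin 3) F) =
    !![0, 0, P.w; 0, -P.w, 0; P.w, 0, P.w + 2 * P.w ^ 2] := by
  have := P.w_sq
  rw [coe_contra]
  simp [adjugate_fin_three, transpose_fin_three]
  grind

lemma r_mul_x (s : F) : P.r * P.x s = P.x (-s) * P.r := by
  apply sl_ext
  simp

end Params

end Parameters

section Stabilizers

open scoped MatrixGroups

namespace Params

variable {F : Type*} [Field F] (P : Params F)

lemma form_mul_form : P.form * P.form = 1 := by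
  apply sl_ext
  simp [one_fin_three]

lemma form'_comm {B C : SL(3, F)} (h1 : P.form * contra B = B * P.form)
    (h2 : P.form' * contra B = B * C) : P.form' * P.form * B * P.form = B * C := by
  rw [← h2, mul_assoc P.form', mul_assoc P.form', mul_assoc P.form, ← h1, ← mul_assoc P.form,
    form_mul_form, one_mul]

/-- No element of `SL₃` composed with the graph automorphism preserves both forms. -/
lemma not_outer_stabilizer {B : SL(3, F)} (h1 : P.form * contra B = B * P.form)
    (h2 : P.form' * contra B = B * contra P.form') : False := by
  have hw := P.w_sq
  have h3 := P.three_ne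
  have key := congrArg (fun M : SL(3, F) => (M : Matrix (Fin 3) (Fin 3) F)) (P.form'_comm h1 h2)
  obtain ⟨m, hm⟩ : ∃ m, m = (B : Matrix (Fin 3) (Fin 3) F) := ⟨_, rfl⟩
  have hdet := B.det_coe
  simp only [Matrix.SpecialLinearGroup.coe_mul, contra_form', coe_form, coe_form', ← hm] at key hdet
  rw [eta_fin_three m] at key
  have k01 := congrFun (congrFun key 0) 1
  have k11 := congrFun (congrFun key 1) 1
  have k21 := congrFun (congrFun key 2) 1
  simp at k01 k11 k21
  rw [det_fin_three] at hdet
  have e1 : m 1 1 = 0 := by clear * - k11 hw h3; grind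
  have e2 : m 2 1 = 0 := by clear * - k21 hw h3; grind
  have e0 : m 0 1 = 0 := by clear * - k01 e2 hw h3; grind
  simp [e0, e1, e2] at hdet

/-- The common stabilizer in `SL₃` of both forms. -/
lemma eq_of_stabilizer {B : SL(3, F)} (h1 : P.form * contra B = B * P.form)
    (h2 : P.form' * contra B = B * P.form') : ∃ b, B = P.x b ∨ B = P.x b * P.r := by
  have hw := P.w_sq
  have h3 := P.three_ne
  have hh := P.two_mul_h
  have key := congrArg (fun M : SL(3, F) => (M : Matrix (Fin 3) (Fin 3) F)) (P.form'_comm h1 h2)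
  have key2 := congrArg (fun M : SL(3, F) => (M : Matrix (Fin 3) (Fin 3) F)) h1
  obtain ⟨m, hm⟩ : ∃ m, m = (B : Matrix (Fin 3) (Fin 3) F) := ⟨_, rfl⟩
  have hdet := B.det_coe
  simp only [Matrix.SpecialLinearGroup.coe_mul, coe_form, coe_form', coe_contra, ← hm]
    at key key2 hdet
  rw [det_fin_three] at hdet
  rw [adjugate_fin_three, eta_fin_three m] at key2
  rw [eta_fin_three m] at key
  have k00 := congrFun (congrFun key 0) 0
  have k01 := congrFun (congrFun key 0) 1
  have k02 := congrFun (congrFun key 0) 2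
  have k10 := congrFun (congrFun key 1) 0
  simp at k00 k01 k02 k10
  have e20 : m 2 0 = 0 := by clear * - k02 hw h3; grind
  have e21 : m 2 1 = 0 := by clear * - k01 hw h3; grind
  have e10 : m 1 0 = 0 := by clear * - k10 hw h3; grind
  have e22 : m 2 2 = m 0 0 := by clear * - k00 hw h3; grind
  have q00 := congrFun (congrFun key2 0) 0
  have q01 := congrFun (congrFun key2 0) 1
  have q02 := congrFun (congrFun key2 0) 2
  simp [e20, e21, e10, e22, transpose_fin_three] at q00 q01 q02 hdet
  have h0 : m 0 0 ≠ 0 := by rintro h; simp [h] at hdet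
  have e11 : m 1 1 = 1 := mul_left_cancel₀ h0 (q02.trans (mul_one _).symm)
  have e00 : m 0 0 = 1 ∨ m 0 0 = -1 := by
    rw [e11, mul_one] at hdet
    exact mul_self_eq_one_iff.1 hdet
  refine ⟨m 0 1, ?_⟩
  rcases e00 with e00 | e00
  · left
    apply sl_ext
    rw [← hm, eta_fin_three m]
    simp [e00, e10, e11, e20, e21, e22]
    clear * - hh q00 q01 e00 e11
    grind
  · right
    apply sl_ext
    rw [← hm, eta_fin_three m]
    simp [e00, e10, e11, e20, e21, e22]
    clear * - hh q00 q01 e00 e11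
    grind

end Params

end Stabilizers

section GraphString

open scoped MatrixGroups

namespace Params

section Relations

variable {F : Type*} [Field F] (P : Params F)

lemma form_mul_x (s : F) : P.form * contra (P.x s) = P.x s * P.form := by
  rw [contra_x]
  apply sl_ext
  simp

lemma form_mul_r : P.form * P.r = P.r * P.form := by
  apply sl_ext
  simp

lemma form'_mul_x (s : F) : P.form' * contra (P.x s) = P.x s * P.form' := by
  have := P.two_mul_h
  rw [contra_x]
  apply sl_ext
  simp
  grind

lemma form'_mul_r : P.form' * P.r = P.r * P.form' := by
  apply sl_ext
  simp

lemma form'_mul_a : P.form' * contra P.a = P.a * contra P.form' := by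
  have := P.w_sq
  rw [contra_a]
  apply sl_ext
  simp [contra_form']
  grind

lemma contra_y (s : F) : contra (P.y s) = P.x (-s) := by
  rw [← neg_neg s, ← contra_x, contra_contra, neg_neg]

lemma x_mul_a : P.x (-2) * P.r * P.a = P.a * contra (P.x (-2) * P.r) := by
  have := P.w_sq
  have := P.two_mul_h
  rw [contra_mul, contra_x, contra_r]
  apply sl_ext
  simp
  grind

end Relations

variable {F : Type*} [Field F] {G : Type*} [Group G] (P : Params F) (ι : SL(3, F) →* G) (τ : G)

/-- The generating string of the graph extension. -/
def string : Fin 4 → G := ![ι P.r * τ, ι (P.x (-2) * P.r), ι P.r, ι P.a * τ]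

@[simp] lemma string_zero : P.string ι τ 0 = ι P.r * τ := rfl
@[simp] lemma string_one : P.string ι τ 1 = ι (P.x (-2) * P.r) := rfl
@[simp] lemma string_two : P.string ι τ 2 = ι P.r := rfl
@[simp] lemma string_three : P.string ι τ 3 = ι P.a * τ := rfl

variable {ι τ} (h : IsGraphExtension ι τ)
include h

lemma string_mul_self (j : Fin 4) : P.string ι τ j * P.string ι τ j = 1 := by
  fin_cases j
  · simp only [Fin.zero_eta, string_zero]
    rw [h.outer_mul_outer, contra_r, r_mul_r, map_one]
  · simp only [Fin.mk_one, string_one]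
    rw [← map_mul, mul_assoc, ← mul_assoc P.r, r_mul_x, mul_assoc, r_mul_r, mul_one, ← x_add]
    simp
  · change ι P.r * ι P.r = 1
    rw [← map_mul, r_mul_r, map_one]
  · change ι P.a * τ * (ι P.a * τ) = 1
    rw [h.outer_mul_outer, contra_a]
    have : P.a * (P.r * P.a * P.r) = 1 := by
      rw [← contra_a]
      apply sl_ext
      have := P.w_sq
      simp [contra_a, one_fin_three]
      grind
    rw [this, map_one]

lemma string_comm (j k : Fin 4) (hjk : 2 ≤ ((j : ℤ) - (k : ℤ)).natAbs) :
    Commute (P.string ι τ j) (P.string ι τ k) := by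
  have c02 : Commute (ι P.r * τ) (ι P.r) := by
    rw [Commute, SemiconjBy, h.outer_mul_map, contra_r, ← mul_assoc, ← map_mul]
  have c03 : Commute (ι P.r * τ) (ι P.a * τ) := by
    rw [Commute, SemiconjBy, h.outer_mul_outer, h.outer_mul_outer, contra_a, contra_r, mul_assoc,
      ← mul_assoc P.r P.r, r_mul_r, one_mul]
  have c13 : Commute (ι (P.x (-2) * P.r)) (ι P.a * τ) := by
    rw [Commute, SemiconjBy, h.outer_mul_map, ← x_mul_a, ← mul_assoc, ← map_mul]
  fin_cases j <;> fin_cases k <;>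
    first
    | exact c02
    | exact c03
    | exact c13
    | exact c02.symm
    | exact c03.symm
    | exact c13.symm
    | exact absurd hjk (by decide)

lemma map_comm_form {A S : SL(3, F)} :
    Commute (ι A) (ι S * τ) ↔ S * contra A = A * S := by
  rw [Commute, SemiconjBy, h.outer_mul_map, ← mul_assoc, ← map_mul]
  exact ⟨fun e => (h.outer_injective e).symm, fun e => by rw [e]⟩

lemma outer_comm_form {A S : SL(3, F)} :
    Commute (ι A * τ) (ι S * τ) ↔ S * contra A = A * contra S := by
  rw [Commute, SemiconjBy, h.outer_mul_outer, h.outer_mul_outer]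
  exact ⟨fun e => (h.injective e).symm, fun e => by rw [e]⟩

lemma commute_form {g : G} (hg : g ∈ Subgroup.closure (P.string ι τ '' {0, 1, 2})) :
    Commute g (ι P.form * τ) := by
  have : Subgroup.closure (P.string ι τ '' {0, 1, 2}) ≤
      Subgroup.centralizer {ι P.form * τ} := by
    rw [Subgroup.closure_le]
    rintro _ ⟨j, hj, rfl⟩
    rw [SetLike.mem_coe, Subgroup.mem_centralizer_singleton_iff]
    apply Commute.eq
    rcases hj with rfl | rfl | rfl
    · rw [string_zero, outer_comm_form h, contra_r, contra_form, form_mul_r]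
    · rw [string_one, map_comm_form h, contra_mul, contra_r, ← mul_assoc, form_mul_x, mul_assoc,
        form_mul_r, mul_assoc]
    · rw [string_two, map_comm_form h, contra_r, form_mul_r]
  exact Subgroup.mem_centralizer_singleton_iff.1 (this hg)

lemma commute_form' {g : G} (hg : g ∈ Subgroup.closure (P.string ι τ '' {1, 2, 3})) :
    Commute g (ι P.form' * τ) := by
  have : Subgroup.closure (P.string ι τ '' {1, 2, 3}) ≤
      Subgroup.centralizer {ι P.form' * τ} := by
    rw [Subgroup.closure_le]
    rintro _ ⟨j, hj, rfl⟩
    rw [SetLike.mem_coe, Subgroup.mem_centralizer_singleton_iff]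
    apply Commute.eq
    rcases hj with rfl | rfl | rfl
    · rw [string_one, map_comm_form h, contra_mul, contra_r, ← mul_assoc, form'_mul_x, mul_assoc,
        form'_mul_r, mul_assoc]
    · rw [string_two, map_comm_form h, contra_r, form'_mul_r]
    · rw [string_three, outer_comm_form h, form'_mul_a]
  exact Subgroup.mem_centralizer_singleton_iff.1 (this hg)

/-- The elements common to both facet stabilizers. -/
lemma eq_of_mem_facets {g : G} (h1 : g ∈ Subgroup.closure (P.string ι τ '' {0, 1, 2}))
    (h2 : g ∈ Subgroup.closure (P.string ι τ '' {1, 2, 3})) :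
    ∃ b, g = ι (P.x b) ∨ g = ι (P.x b * P.r) := by
  have c1 := P.commute_form h h1
  have c2 := P.commute_form' h h2
  obtain ⟨A, rfl | rfl⟩ := h.exists_eq g
  · rw [map_comm_form h] at c1 c2
    obtain ⟨b, hb⟩ := P.eq_of_stabilizer c1 c2
    exact ⟨b, hb.imp (congrArg ι) (congrArg ι)⟩
  · rw [outer_comm_form h, contra_form] at c1
    rw [outer_comm_form h] at c2
    exact (P.not_outer_stabilizer c1 c2).elim

lemma eq_of_mem_middle {g : G} (hg : g ∈ Subgroup.closure (P.string ι τ '' {1, 2})) :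
    ∃ b, g = ι (P.x b) ∨ g = ι (P.x b * P.r) :=
  P.eq_of_mem_facets h (IsSeparatedString.mono (by grind) hg)
    (IsSeparatedString.mono (by grind) hg)

omit h in
lemma entry_eq_zero {A : SL(3, F)} {b : F} (hA : A = P.x b ∨ A = P.x b * P.r) :
    (A : Matrix (Fin 3) (Fin 3) F) 2 0 = 0 := by
  rcases hA with rfl | rfl <;> simp

lemma entry_of_mem_middle {A : SL(3, F)} (hA : ι A ∈ Subgroup.closure (P.string ι τ '' {1, 2})) :
    (A : Matrix (Fin 3) (Fin 3) F) 2 0 = 0 := by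
  obtain ⟨b, hb⟩ := P.eq_of_mem_middle h hA
  exact P.entry_eq_zero (hb.imp (fun e => h.injective e) (fun e => h.injective e))

lemma outer_not_mem_middle {A : SL(3, F)} :
    ι A * τ ∉ Subgroup.closure (P.string ι τ '' {1, 2}) := by
  intro hA
  obtain ⟨b, hb | hb⟩ := P.eq_of_mem_middle h hA <;> exact h.map_ne_outer _ _ hb.symm

end Params

end GraphString

section PrimeField

open scoped MatrixGroups

lemma mem_of_oneParameter {p : ℕ} [Fact p.Prime] {G : Type*} [Group G] {f : ZMod p → G}
    (hf : ∀ a b, f (a + b) = f a * f b) {H : Subgroup G} {k : ZMod p} (hk : k ≠ 0)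
    (hmem : f k ∈ H) (s : ZMod p) : f s ∈ H := by
  have h0 : f 0 = 1 := by
    have := hf 0 0
    rwa [add_zero, left_eq_mul] at this
  have hn : ∀ n : ℕ, f (n * k) ∈ H := by
    intro n
    induction n with
    | zero => simp [h0]
    | succ n ih =>
      rw [Nat.cast_succ, add_mul, one_mul, hf]
      exact mul_mem ih hmem
  have := hn (s / k).val
  rwa [ZMod.natCast_zmod_val, div_mul_cancel₀ _ hk] at this

namespace Params

section Orders

variable {F : Type*} [Field F] {G : Type*} [Group G] (P : Params F) {ι : SL(3, F) →* G} {τ : G}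
  (h : IsGraphExtension ι τ)
include h

omit h in
lemma r_ne_one : P.r ≠ 1 := by
  intro e
  have := congrArg (fun A : SL(3, F) => (A : Matrix (Fin 3) (Fin 3) F) 0 0) e
  simp at this
  have h2 := P.two_ne
  grind

omit h in
lemma x_mul_r_ne : P.x (-2) * P.r ≠ P.r := by
  intro e
  have := congrArg (fun A : SL(3, F) => (A : Matrix (Fin 3) (Fin 3) F) 0 1) e
  simp at this
  exact P.two_ne this

omit h in
lemma x_mul_r_ne_one : P.x (-2) * P.r ≠ 1 := by
  intro e
  have := congrArg (fun A : SL(3, F) => (A : Matrix (Fin 3) (Fin 3) F) 0 0) e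
  simp at this
  have h2 := P.two_ne
  grind

lemma orderOf_string (j : Fin 4) : orderOf (P.string ι τ j) = 2 := by
  apply orderOf_eq_prime
  · rw [sq, P.string_mul_self h]
  · fin_cases j
    · change ι P.r * τ ≠ 1
      rw [← map_one ι]
      exact (h.map_ne_outer _ _).symm
    · change ι (P.x (-2) * P.r) ≠ 1
      rw [← map_one ι]
      exact h.injective.ne P.x_mul_r_ne_one
    · change ι P.r ≠ 1
      rw [← map_one ι]
      exact h.injective.ne P.r_ne_one
    · change ι P.a * τ ≠ 1
      rw [← map_one ι]
      exact (h.map_ne_outer _ _).symm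

lemma orderOf_eq_four {A : SL(3, F)} (h1 : A * contra A ≠ 1)
    (h2 : A * contra A * (A * contra A) = 1) : orderOf (ι A * τ) = 4 := by
  have hsq : (ι A * τ) ^ 2 = ι (A * contra A) := by rw [sq, h.outer_mul_outer]
  have : orderOf (ι A * τ) = 2 ^ (1 + 1) := by
    apply orderOf_eq_prime_pow
    · rw [pow_one, hsq, ← map_one ι]
      exact fun e => h1 (h.injective e)
    · rw [pow_add, pow_one, pow_mul, hsq, sq, ← map_mul, h2, map_one]
  exact this

lemma orderOf_zero_one : orderOf (P.string ι τ 0 * P.string ι τ 1) = 4 := by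
  have h2 := P.two_ne
  have hh := P.two_mul_h
  rw [string_zero, string_one, h.outer_mul_map]
  apply orderOf_eq_four h
  · intro e
    have := congrArg (fun A : SL(3, F) => (A : Matrix (Fin 3) (Fin 3) F) 0 1) e
    simp [contra_mul, contra_x, contra_y, contra_r] at this
    grind
  · simp only [contra_mul, contra_x, contra_y, contra_r]
    apply sl_ext
    simp [one_fin_three]
    grind

lemma orderOf_two_three : orderOf (P.string ι τ 2 * P.string ι τ 3) = 4 := by
  have h2 := P.two_ne
  have hw := P.w_sq
  rw [string_two, string_three, IsGraphExtension.map_mul_outer]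
  apply orderOf_eq_four h
  · intro e
    have e1 := congrArg (fun A : SL(3, F) => (A : Matrix (Fin 3) (Fin 3) F) 2 0) e
    simp [contra_mul, contra_a, contra_r] at e1
    clear e
    grind
  · simp only [contra_mul, contra_a, contra_r]
    apply sl_ext
    simp [one_fin_three]
    grind

lemma left_separated {g : G} (h1 : g ∈ Subgroup.closure (P.string ι τ '' {0, 1}))
    (h2 : g ∈ Subgroup.closure (P.string ι τ '' {1, 2})) :
    g ∈ Subgroup.closure (P.string ι τ '' {1}) := by
  rw [Set.image_pair] at h1
  have ho := pow_orderOf_eq_one (P.string ι τ 0 * P.string ι τ 1)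
  rw [P.orderOf_zero_one h] at ho
  obtain ⟨c, hc, hg⟩ := exists_coset_of_mem_closure_pair (P.string_mul_self h 0)
    (P.string_mul_self h 1) ho h1
  have m1 : P.string ι τ 1 ∈ Subgroup.closure (P.string ι τ '' {1, 2}) :=
    IsSeparatedString.mem_gen (by simp)
  have hcm : c ∈ Subgroup.closure (P.string ι τ '' {1, 2}) := by
    rcases hg with rfl | rfl
    · exact h2
    · exact (Subgroup.mul_mem_cancel_right _ m1).1 h2
  rcases hc with rfl | rfl | rfl | rfl
  · rcases hg with rfl | rfl
    · exact one_mem _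
    · rw [one_mul]
      exact IsSeparatedString.mem_gen rfl
  · exact (P.outer_not_mem_middle h hcm).elim
  · exact (P.outer_not_mem_middle h
      ((Subgroup.mul_mem_cancel_left _ m1).1 hcm)).elim
  · rw [string_zero, string_one, h.outer_mul_map, h.outer_mul_outer] at hcm
    have := P.entry_of_mem_middle h hcm
    rw [contra_mul, contra_x, contra_r] at this
    have hh := P.two_mul_h
    have h2 := P.two_ne
    simp at this
    clear * - this hh h2
    grind

lemma right_separated {g : G} (h1 : g ∈ Subgroup.closure (P.string ι τ '' {2, 3}))
    (h2 : g ∈ Subgroup.closure (P.string ι τ '' {1, 2})) :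
    g ∈ Subgroup.closure (P.string ι τ '' {2}) := by
  rw [Set.image_pair, Set.pair_comm] at h1
  have ho := pow_orderOf_eq_one (P.string ι τ 2 * P.string ι τ 3)
  rw [P.orderOf_two_three h] at ho
  have ho' : (P.string ι τ 3 * P.string ι τ 2) ^ 4 = 1 := by
    have e : P.string ι τ 3 * P.string ι τ 2 = (P.string ι τ 2 * P.string ι τ 3)⁻¹ := by
      rw [_root_.mul_inv_rev, inv_eq_of_mul_eq_one_left (P.string_mul_self h 3),
        inv_eq_of_mul_eq_one_left (P.string_mul_self h 2)]
    rw [e, inv_pow, ho, inv_one]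
  obtain ⟨c, hc, hg⟩ := exists_coset_of_mem_closure_pair (P.string_mul_self h 3)
    (P.string_mul_self h 2) ho' h1
  have m2 : P.string ι τ 2 ∈ Subgroup.closure (P.string ι τ '' {1, 2}) :=
    IsSeparatedString.mem_gen (by simp)
  have hcm : c ∈ Subgroup.closure (P.string ι τ '' {1, 2}) := by
    rcases hg with rfl | rfl
    · exact h2
    · exact (Subgroup.mul_mem_cancel_right _ m2).1 h2
  rcases hc with rfl | rfl | rfl | rfl
  · rcases hg with rfl | rfl
    · exact one_mem _
    · rw [one_mul]
      exact IsSeparatedString.mem_gen rfl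
  · exact (P.outer_not_mem_middle h hcm).elim
  · exact (P.outer_not_mem_middle h
      ((Subgroup.mul_mem_cancel_left _ m2).1 hcm)).elim
  · rw [string_two, string_three, h.outer_mul_map, h.outer_mul_outer] at hcm
    have := P.entry_of_mem_middle h hcm
    rw [contra_a, contra_r] at this
    have hw := P.w_sq
    have h2 := P.two_ne
    have h3 := P.three_ne
    simp at this
    clear * - this hw h2 h3
    grind

end Orders

variable {p : ℕ} [Fact p.Prime] {G : Type*} [Group G] (P : Params (ZMod p))
  {ι : SL(3, ZMod p) →* G} {τ : G} (h : IsGraphExtension ι τ)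
include h

omit h in
lemma x_mem_middle (s : ZMod p) : ι (P.x s) ∈ Subgroup.closure (P.string ι τ '' {1, 2}) := by
  refine mem_of_oneParameter (f := fun s => ι (P.x s)) (fun a b => ?_) (k := -2)
    (neg_ne_zero.2 P.two_ne) ?_ s
  · rw [x_add, map_mul]
  · have := mul_mem (IsSeparatedString.mem_gen (t := P.string ι τ) (i := 1) (J := {1, 2}) (by simp))
      (IsSeparatedString.mem_gen (t := P.string ι τ) (i := 2) (J := {1, 2}) (by simp))
    rwa [string_one, string_two, ← map_mul, mul_assoc, r_mul_r, mul_one] at this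

lemma orderOf_one_two : orderOf (P.string ι τ 1 * P.string ι τ 2) = p := by
  rw [string_one, string_two, ← map_mul, mul_assoc, r_mul_r, mul_one]
  have hpow : ∀ (n : ℕ) s, ι (P.x s) ^ n = ι (P.x (n * s)) := by
    intro n s
    induction n with
    | zero => simp
    | succ n ih => rw [pow_succ, ih, ← map_mul, ← x_add, Nat.cast_succ, add_mul, one_mul]
  apply orderOf_eq_prime
  · rw [hpow, CharP.cast_eq_zero, zero_mul, x_zero, map_one]
  · rw [← map_one ι]
    refine h.injective.ne fun e => ?_
    apply P.x_mul_r_ne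
    rw [e, one_mul]

lemma isSeparatedString : IsSeparatedString (P.string ι τ) where
  mul_self := P.string_mul_self h
  comm := P.string_comm h
  facets g h1 h2 := by
    have m2 : P.string ι τ 2 ∈ Subgroup.closure (P.string ι τ '' {1, 2}) :=
      IsSeparatedString.mem_gen (by simp)
    obtain ⟨b, rfl | rfl⟩ := P.eq_of_mem_facets h h1 h2
    · exact P.x_mem_middle b
    · rw [map_mul]
      exact mul_mem (P.x_mem_middle b) m2
  left _ := P.left_separated h
  right _ := P.right_separated h
  first h1 := by
    obtain ⟨b, hb | hb⟩ := P.eq_of_mem_facets h (IsSeparatedString.mem_gen (by simp)) h1 <;>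
      exact h.map_ne_outer _ _ hb.symm
  last h1 := by
    obtain ⟨b, hb | hb⟩ := P.eq_of_mem_facets h h1 (IsSeparatedString.mem_gen (by simp)) <;>
      exact h.map_ne_outer _ _ hb.symm
  ne := h.injective.ne P.x_mul_r_ne
  one_ne := by
    rw [← map_one ι]
    exact h.injective.ne P.x_mul_r_ne_one
  two_ne := by
    rw [← map_one ι]
    exact h.injective.ne P.r_ne_one

end Params

end PrimeField

section Conjugate

open scoped MatrixGroups

namespace Params

variable {F : Type*} [Field F] (P : Params F)

/-- The off-diagonal entry of the unipotent matrix relating the two forms. -/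
def f : F := P.h + P.w

lemma f_sq : P.f ^ 2 = P.h ^ 2 - 1 := by
  have := P.w_sq
  have := P.two_mul_h
  unfold f
  grind

lemma f_ne : P.f ≠ 0 := by
  intro e
  have h1 := P.f_sq
  have h2 := P.two_mul_h
  have h3 := P.three_ne
  rw [e] at h1
  clear e
  grind

/-- The conjugate of `P.y s` by `upper 0 0 (-P.f)`. -/
def y' (s : F) : SL(3, F) := upper 0 0 (-P.f) * P.y s * upper 0 0 P.f

/-- The conjugate of `P.a` by `P.x 1`, in the graph extension. -/
def b : SL(3, F) := P.x 1 * P.a * contra (P.x (-1))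

lemma coe_b : (P.b : Matrix (Fin 3) (Fin 3) F) =
    !![-P.w ^ 2 * P.h ^ 2, 0, P.w ^ 2 * P.f; 0, P.w ^ 2, 0; P.w ^ 2 * P.f, 0, -P.w ^ 2] := by
  have := P.w_sq
  have := P.two_mul_h
  rw [b, contra_x]
  simp [f]
  grind

lemma b_mul_y (s : F) : P.b * contra (P.x s) = P.y' s * P.b := by
  have h1 := P.f_sq
  have h2 := P.two_mul_h
  rw [contra_x]
  apply sl_ext
  simp [y', coe_b]
  grind

/-- The antidiagonal monomial matrix with corner entries `c` and `d`. -/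
def antidiag (c d : F) (hcd : c * d = 1) : SL(3, F) :=
  ⟨!![0, 0, c; 0, -1, 0; d, 0, 0], by simp [det_fin_three, hcd]⟩

@[simp] lemma coe_antidiag (c d : F) (hcd : c * d = 1) :
    (antidiag c d hcd : Matrix (Fin 3) (Fin 3) F) = !![0, 0, c; 0, -1, 0; d, 0, 0] := rfl

lemma x_mul_y_mul_x {a d c e : F} (had : a * d = 2) (hce : c * e = 1) (hc : P.h * a ^ 2 = c)
    (he : P.h * d ^ 2 = e) : P.x a * P.y (-d) * P.x a = antidiag c e hce := by
  have := P.two_mul_h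
  apply sl_ext
  simp
  grind

lemma upper_mul_x (k s : F) : upper 0 0 k * P.x s = P.x s * upper 0 0 k := by
  rw [x, upper_mul, upper_mul]
  congr 1 <;> ring

lemma x_mul_y'_mul_x (a d : F) : P.x a * P.y' d * P.x a =
    upper 0 0 (-P.f) * (P.x a * P.y d * P.x a) * upper 0 0 P.f := by
  simp only [y', mul_assoc]
  rw [upper_mul_x, ← mul_assoc, ← P.upper_mul_x (-P.f)]
  simp only [mul_assoc]

lemma commutator_eq : P.x 2 * P.y' (-1) * P.x 2 * (P.x 1 * P.y' (-2) * P.x 1) =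
    upper 0 0 (15 * P.f) * (P.x 2 * P.y (-1) * P.x 2 * (P.x 1 * P.y (-2) * P.x 1)) := by
  have hh := P.two_mul_h
  have e : P.h * 2 ^ 2 = 2 := by linear_combination 2 * hh
  rw [x_mul_y'_mul_x, x_mul_y'_mul_x, P.x_mul_y_mul_x (by norm_num) hh e (by ring),
    P.x_mul_y_mul_x (c := P.h) (e := 2) (one_mul 2) (by linear_combination hh) (by ring) e]
  apply sl_ext
  simp
  grind

/-- The scalar matrix `P.w ^ 2`. -/
def omega : SL(3, F) :=
  ⟨!![P.w ^ 2, 0, 0; 0, P.w ^ 2, 0; 0, 0, P.w ^ 2], by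
    have := P.w_sq
    simp [det_fin_three]
    grind⟩

@[simp] lemma coe_omega : (P.omega : Matrix (Fin 3) (Fin 3) F) =
    !![P.w ^ 2, 0, 0; 0, P.w ^ 2, 0; 0, 0, P.w ^ 2] := rfl

lemma omega_eq : P.x (1 - P.i) * P.y' (-(1 + P.i)) * P.x (1 - P.i) * P.b =
    P.omega * (P.x (1 + P.i) * P.y (-(1 - P.i)) * P.x (1 + P.i)) := by
  have hh := P.two_mul_h
  have hi := P.i_sq
  have hf := P.f_sq
  rw [x_mul_y'_mul_x, P.x_mul_y_mul_x (c := -P.i) (e := P.i) (by grind) (by grind) (by grind)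
    (by grind), P.x_mul_y_mul_x (c := P.i) (e := -P.i) (by grind) (by grind) (by grind) (by grind)]
  apply sl_ext
  simp [coe_b]
  grind

lemma weyl_mul_x (s : F) : P.y s * (upper 0 0 1 * lower 0 0 (-1) * upper 0 0 1 * P.x s *
    (upper 0 0 1 * lower 0 0 (-1) * upper 0 0 1)⁻¹) = lower (2 * s) 0 (s ^ 2) := by
  have := P.two_mul_h
  rw [← mul_assoc, mul_inv_eq_iff_eq_mul]
  apply sl_ext
  simp
  grind

end Params

end Conjugate

section Generation

open scoped MatrixGroups

namespace Params

variable {p : ℕ} [Fact p.Prime] (P : Params (ZMod p))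

/-- The subgroups `P.x` and `P.y'` together with the graph automorphism generate `SL₃`. -/
lemma eq_top_of_mem {Q : Subgroup SL(3, ZMod p)} (hx : ∀ s, P.x s ∈ Q) (hy' : ∀ s, P.y' s ∈ Q)
    (hc : ∀ A ∈ Q, contra A ∈ Q) : Q = ⊤ := by
  have hy : ∀ s, P.y s ∈ Q := by
    intro s
    have := hc _ (hx (-s))
    rwa [contra_x, neg_neg] at this
  have hcorner : ∀ s, upper 0 0 s ∈ Q := by
    refine mem_of_oneParameter (f := fun s => upper 0 0 s) (fun a b => ?_) (k := 15 * P.f)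
      (mul_ne_zero ?_ P.f_ne) ?_
    · rw [upper_mul]
      congr 1 <;> ring
    · have := mul_ne_zero P.three_ne P.five_ne
      norm_num at this
      exact this
    · have h1 := mul_mem (mul_mem (mul_mem (hx 2) (hy' (-1))) (hx 2))
        (mul_mem (mul_mem (hx 1) (hy' (-2))) (hx 1))
      rw [commutator_eq] at h1
      exact (Subgroup.mul_mem_cancel_right _
        (mul_mem (mul_mem (mul_mem (hx 2) (hy (-1))) (hx 2))
          (mul_mem (mul_mem (hx 1) (hy (-2))) (hx 1)))).1 h1
  have hcorner' : ∀ s, lower 0 0 s ∈ Q := by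
    intro s
    have := hc _ (hcorner (-s))
    rw [contra_upper] at this
    simpa using this
  have hL : ∀ a b c, lower a b c ∈ Q := by
    have hdouble : ∀ s, lower (2 * s) 0 (s ^ 2) ∈ Q := by
      intro s
      rw [← weyl_mul_x]
      have hw := mul_mem (mul_mem (hcorner 1) (hcorner' (-1))) (hcorner 1)
      exact mul_mem (hy s) (mul_mem (mul_mem hw (hx s)) (inv_mem hw))
    intro a b c
    have h1 := mul_mem (mul_mem (hy b) (hdouble (P.h * (a - b)))) (hcorner' (c - P.h * b ^ 2 -
      (P.h * (a - b)) ^ 2 - b * (a - b)))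
    convert h1 using 1
    have := P.two_mul_h
    rw [y, lower_mul, lower_mul]
    congr 1 <;> grind
  refine eq_top_of_unitriangular (fun a b c => ?_) hL
  have := hc _ (hL (-a) (-b) (a * b - c))
  rw [contra_lower] at this
  convert this using 2 <;> ring

variable {G : Type*} [Group G] {ι : SL(3, ZMod p) →* G} {τ : G} (h : IsGraphExtension ι τ)
include h

lemma outer_b_mem : ι P.b * τ ∈ Subgroup.closure (P.string ι τ '' {1, 2, 3}) := by
  have hx (s) : ι (P.x s) ∈ Subgroup.closure (P.string ι τ '' {1, 2, 3}) :=
    IsSeparatedString.mono (by grind) (P.x_mem_middle s)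
  have h3 := IsSeparatedString.mem_gen (t := P.string ι τ) (i := 3) (J := {1, 2, 3}) (by simp)
  have := mul_mem (mul_mem (hx 1) h3) (hx (-1))
  rwa [string_three, IsGraphExtension.map_mul_outer, h.outer_mul_map] at this

lemma map_y'_mem (s : ZMod p) :
    ι (P.y' s) ∈ Subgroup.closure (P.string ι τ '' {1, 2, 3}) := by
  have hx (s) : ι (P.x s) ∈ Subgroup.closure (P.string ι τ '' {1, 2, 3}) :=
    IsSeparatedString.mono (by grind) (P.x_mem_middle s)
  have hb := P.outer_b_mem h
  have := mul_mem hb (hx s)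
  rw [h.outer_mul_map, b_mul_y, ← IsGraphExtension.map_mul_outer] at this
  exact (Subgroup.mul_mem_cancel_right _ hb).1 this

omit h in
lemma tau_mem : τ ∈ Subgroup.closure (P.string ι τ '' {0, 1, 2}) := by
  have := mul_mem
    (IsSeparatedString.mem_gen (t := P.string ι τ) (i := 2) (J := {0, 1, 2}) (by simp))
    (IsSeparatedString.mem_gen (t := P.string ι τ) (i := 0) (J := {0, 1, 2}) (by simp))
  rwa [string_zero, string_two, ← mul_assoc, ← map_mul, r_mul_r, map_one, one_mul] at this

lemma map_y_mem (s : ZMod p) :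
    ι (P.y s) ∈ Subgroup.closure (P.string ι τ '' {0, 1, 2}) := by
  have := mul_mem (mul_mem (P.tau_mem (ι := ι) (τ := τ)) (IsSeparatedString.mono
    (by grind : ({1, 2} : Set (Fin 4)) ⊆ {0, 1, 2}) (P.x_mem_middle (-s)))) P.tau_mem
  rwa [h.tau_mul_map_mul_tau, contra_x, neg_neg] at this

lemma closure_string : Subgroup.closure (Set.range (P.string ι τ)) = ⊤ := by
  rw [← Set.image_univ]
  have hτ : τ ∈ Subgroup.closure (P.string ι τ '' Set.univ) :=
    IsSeparatedString.mono (Set.subset_univ _) P.tau_mem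
  have htop : (Subgroup.closure (P.string ι τ '' Set.univ)).comap ι = ⊤ := by
    refine P.eq_top_of_mem (fun s => ?_) (fun s => ?_) (fun A hA => ?_)
    · exact IsSeparatedString.mono (Set.subset_univ _) (P.x_mem_middle s)
    · exact IsSeparatedString.mono (Set.subset_univ _) (P.map_y'_mem h s)
    · rw [Subgroup.mem_comap, ← h.tau_mul_map_mul_tau]
      exact mul_mem (mul_mem hτ hA) hτ
  have hι (A) : ι A ∈ Subgroup.closure (P.string ι τ '' Set.univ) := by
    rw [← Subgroup.mem_comap, htop]
    trivial
  rw [eq_top_iff]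
  rintro g -
  obtain ⟨A, rfl | rfl⟩ := h.exists_eq g
  · exact hι A
  · exact mul_mem (hι A) hτ

lemma isCString : IsCString (P.string ι τ) :=
  ⟨P.orderOf_string h, P.closure_string h, P.string_comm h, (P.isSeparatedString h).inf_eq⟩

/-- A normal subgroup containing only scalar elements does not give a C-string quotient. -/
lemma not_isCString_quotient {N : Subgroup G} [N.Normal] (hω : ι P.omega ∈ N)
    (hN : ∀ X, ι X * τ ∉ N) :
    ¬ IsCString (fun j => (QuotientGroup.mk (P.string ι τ j) : G ⧸ N)) := by
  intro hq
  have hmap (J : Set (Fin 4)) :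
      Subgroup.closure ((fun j => (QuotientGroup.mk (P.string ι τ j) : G ⧸ N)) '' J) =
        (Subgroup.closure (P.string ι τ '' J)).map (QuotientGroup.mk' N) := by
    rw [MonoidHom.map_closure, Set.image_image]
    rfl
  have hx (J : Set (Fin 4)) (hJ : {1, 2} ⊆ J) (s) :
      ι (P.x s) ∈ Subgroup.closure (P.string ι τ '' J) :=
    IsSeparatedString.mono hJ (P.x_mem_middle s)
  obtain ⟨B, hB⟩ : ∃ B, B = P.x (1 + P.i) * P.y (-(1 - P.i)) * P.x (1 + P.i) := ⟨_, rfl⟩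
  have hK : ι B * τ ∈ Subgroup.closure (P.string ι τ '' {0, 1, 2}) := by
    rw [hB, map_mul, map_mul]
    exact mul_mem (mul_mem (mul_mem (hx _ (by grind) _) (P.map_y_mem h _))
      (hx _ (by grind) _)) P.tau_mem
  have hL : ι (P.omega * B) * τ ∈ Subgroup.closure (P.string ι τ '' {1, 2, 3}) := by
    rw [hB, ← omega_eq, map_mul, mul_assoc, map_mul, map_mul]
    exact mul_mem (mul_mem (mul_mem (hx _ (by grind) _) (P.map_y'_mem h _))
      (hx _ (by grind) _)) (P.outer_b_mem h)
  have hmk : QuotientGroup.mk' N (ι (P.omega * B) * τ) = QuotientGroup.mk' N (ι B * τ) := by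
    rw [map_mul ι, mul_assoc, map_mul (QuotientGroup.mk' N)]
    have : QuotientGroup.mk' N (ι P.omega) = 1 := (QuotientGroup.eq_one_iff _).2 hω
    rw [this, one_mul]
  have hmem : QuotientGroup.mk' N (ι B * τ) ∈
      (Subgroup.closure (P.string ι τ '' {1, 2})).map (QuotientGroup.mk' N) := by
    have hinter := hq.2.2.2 {0, 1, 2} {1, 2, 3}
    have he : ({0, 1, 2} ∩ {1, 2, 3} : Set (Fin 4)) = {1, 2} := by
      ext j
      fin_cases j <;> simp
    rw [hmap, hmap, hmap, he] at hinter
    rw [← hinter]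
    exact ⟨⟨_, hK, rfl⟩, ⟨_, hL, hmk⟩⟩
  obtain ⟨d, hd, hdB⟩ := hmem
  have hdN : d⁻¹ * (ι B * τ) ∈ N := QuotientGroup.eq.1 hdB
  obtain ⟨s, rfl | rfl⟩ := P.eq_of_mem_middle h hd <;>
  · rw [← map_inv, IsGraphExtension.map_mul_outer] at hdN
    exact hN _ hdN

omit h in
/-- A normal subgroup containing a non-scalar element identifies two generators. -/
lemma not_injective_quotient {N : Subgroup G} [N.Normal] {A : SL(3, ZMod p)} (hAN : ι A ∈ N)
    (hA : ∀ z, (A : Matrix (Fin 3) (Fin 3) (ZMod p)) ≠ scalar (Fin 3) z) :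
    ¬ Function.Injective (fun j => (QuotientGroup.mk (P.string ι τ j) : G ⧸ N)) := by
  intro hinj
  have hx : P.x 2 ∈ N.comap ι := upper_mem_of_normal (N := N.comap ι) hAN hA _ _ _
  have : (1 : Fin 4) = 2 := by
    apply hinj
    simp only
    rw [QuotientGroup.eq, string_one, string_two, ← map_inv, ← map_mul]
    have e : (P.x (-2) * P.r)⁻¹ * P.r = P.r⁻¹ * P.x 2 * P.r := by
      rw [_root_.mul_inv_rev, inv_eq_of_mul_eq_one_left (a := P.x 2) (b := P.x (-2))]
      rw [← x_add]
      simp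
    rw [e]
    have := (inferInstance : (N.comap ι).Normal).conj_mem _ hx P.r⁻¹
    rwa [inv_inv] at this
  exact absurd this (by decide)

omit h in
lemma omega_mem {N : Subgroup G} {A : SL(3, ZMod p)} (hAN : ι A ∈ N) (h1 : A ≠ 1) {z : ZMod p}
    (hz : (A : Matrix (Fin 3) (Fin 3) (ZMod p)) = scalar (Fin 3) z) : ι P.omega ∈ N := by
  have hw := P.w_sq
  have hA : (A : Matrix (Fin 3) (Fin 3) (ZMod p)) = !![z, 0, 0; 0, z, 0; 0, 0, z] := by
    rw [hz]
    ext i j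
    fin_cases i <;> fin_cases j <;> simp
  have hdet := A.det_coe
  rw [hA] at hdet
  simp [det_fin_three] at hdet
  have hz1 : z ≠ 1 := by
    rintro rfl
    exact h1 (sl_ext (by rw [hA]; simp [one_fin_three]))
  have hcases : z = P.w ∨ z = P.w ^ 2 := by
    have : (z - 1) * ((z - P.w) * (z - P.w ^ 2)) = 0 := by grind
    rcases mul_eq_zero.1 this with e | e
    · exact (hz1 (sub_eq_zero.1 e)).elim
    · rcases mul_eq_zero.1 e with e | e
      · exact Or.inl (sub_eq_zero.1 e)
      · exact Or.inr (sub_eq_zero.1 e)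
  rcases hcases with rfl | rfl
  · have : P.omega = A * A := by
      apply sl_ext
      simp [hA, sq]
    rw [this, map_mul]
    exact mul_mem hAN hAN
  · have : P.omega = A := sl_ext (by rw [hA]; rfl)
    rwa [this]

lemma isUnravelled : IsUnravelled (P.string ι τ) := by
  intro N _ hN _
  by_cases hs : ∃ A, ι A ∈ N ∧ ∀ z, (A : Matrix (Fin 3) (Fin 3) (ZMod p)) ≠ scalar (Fin 3) z
  · obtain ⟨A, hAN, hA⟩ := hs
    exact Or.inl (P.not_injective_quotient hAN hA)
  · right
    have hout (X) : ι X * τ ∉ N := fun hX => hs (h.exists_nonscalar hX)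
    refine P.not_isCString_quotient h ?_ hout
    obtain ⟨g, hg, hg1⟩ := N.bot_or_exists_ne_one.resolve_left hN
    obtain ⟨A, rfl | rfl⟩ := h.exists_eq g
    · push Not at hs
      obtain ⟨z, hz⟩ := hs A hg
      exact P.omega_mem hg (by rintro rfl; simp at hg1) hz
    · exact (hout A hg).elim

end Params

end Generation

section Concrete

open scoped MatrixGroups

/-- The scalars of the construction exist in the prime fields under consideration. -/
lemma nonempty_params {p : ℕ} [Fact p.Prime] (hp3 : p % 3 = 1) (hp8 : p % 8 = 5) :
    Nonempty (Params (ZMod p)) := by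
  have hp := (Fact.out : p.Prime)
  have hne (q : ℕ) (hq : q.Prime) (hqp : q ≠ p) : (q : ZMod p) ≠ 0 := by
    rw [Ne, ZMod.natCast_eq_zero_iff]
    exact fun hd => hqp ((Nat.prime_dvd_prime_iff_eq hp hq).1 hd).symm
  have h2 : (2 : ZMod p) ≠ 0 := mod_cast hne 2 Nat.prime_two (by omega)
  have h3 : (3 : ZMod p) ≠ 0 := mod_cast hne 3 Nat.prime_three (by omega)
  have h5 : (5 : ZMod p) ≠ 0 := mod_cast hne 5 Nat.prime_five (by omega)
  obtain ⟨i, hi⟩ := ZMod.exists_sq_eq_neg_one_iff.2 (show p % 4 ≠ 3 by omega)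
  have : Fact (Nat.Prime 3) := ⟨Nat.prime_three⟩
  obtain ⟨w, hw⟩ := exists_prime_orderOf_dvd_card (G := (ZMod p)ˣ) 3 (by
    rw [ZMod.card_units]
    omega)
  have hw3 : (w : ZMod p) ^ 3 = 1 := by
    rw [← Units.val_pow_eq_pow_val, ← hw, pow_orderOf_eq_one, Units.val_one]
  have hw1 : (w : ZMod p) - 1 ≠ 0 := by
    intro e
    have : w = 1 := Units.ext (sub_eq_zero.1 e)
    rw [this, orderOf_one] at hw
    omega
  exact ⟨⟨2⁻¹, w, i, mul_inv_cancel₀ h2, mul_left_cancel₀ hw1 (by linear_combination hw3),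
    by rw [sq, ← hi], h3, h5⟩⟩

/-- The block-diagonal embedding of `SL₃` into `GL₆`. -/
noncomputable def blockHom (F : Type*) [Field F] : SL(3, F) →* GL (Fin 3 ⊕ Fin 3) F :=
  MonoidHom.toHomUnits
    { toFun := fun A => fromBlocks (A : Matrix (Fin 3) (Fin 3) F) 0 0
        (contra A : Matrix (Fin 3) (Fin 3) F)
      map_one' := by simp
      map_mul' := fun A B => by simp [contra_mul, fromBlocks_multiply] }

@[simp] lemma coe_blockHom {F : Type*} [Field F] (A : SL(3, F)) :
    (blockHom F A : Matrix (Fin 3 ⊕ Fin 3) (Fin 3 ⊕ Fin 3) F) =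
      fromBlocks (A : Matrix (Fin 3) (Fin 3) F) 0 0 (contra A : Matrix (Fin 3) (Fin 3) F) := rfl

lemma coe_contra_eq_inv {F : Type*} [Field F] (A : SL(3, F)) :
    (contra A : Matrix (Fin 3) (Fin 3) F) = ((A : Matrix (Fin 3) (Fin 3) F)ᵀ)⁻¹ := by
  rw [coe_contra, inv_def, det_transpose, A.det_coe, Ring.inverse_one, one_smul,
    adjugate_transpose]

lemma mem_blockHom_range {F : Type*} [Field F] {g : GL (Fin 3 ⊕ Fin 3) F} :
    (∃ A : Matrix (Fin 3) (Fin 3) F, A.det = 1 ∧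
      (g : Matrix (Fin 3 ⊕ Fin 3) (Fin 3 ⊕ Fin 3) F) = fromBlocks A 0 0 (Aᵀ)⁻¹) ↔
      ∃ A, blockHom F A = g := by
  constructor
  · rintro ⟨A, hA, hg⟩
    obtain ⟨B, rfl⟩ : ∃ B : SL(3, F), (B : Matrix (Fin 3) (Fin 3) F) = A := ⟨⟨A, hA⟩, rfl⟩
    refine ⟨B, Units.ext ?_⟩
    rw [coe_blockHom, coe_contra_eq_inv, hg]
  · rintro ⟨A, rfl⟩
    exact ⟨A, A.det_coe, by rw [coe_blockHom, coe_contra_eq_inv]⟩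

/-- The matrix group generated by the block-diagonal `SL₃` and the block swap is a graph
extension of `SL₃`. -/
lemma exists_isGraphExtension {F : Type*} [Field F] {tu : GL (Fin 3 ⊕ Fin 3) F}
    (htu : (tu : Matrix (Fin 3 ⊕ Fin 3) (Fin 3 ⊕ Fin 3) F) = fromBlocks 0 1 1 0)
    {G : Subgroup (GL (Fin 3 ⊕ Fin 3) F)}
    (hG : G = Subgroup.closure
      ({g : GL (Fin 3 ⊕ Fin 3) F | ∃ A : Matrix (Fin 3) (Fin 3) F,
          A.det = 1 ∧ (g : Matrix (Fin 3 ⊕ Fin 3) (Fin 3 ⊕ Fin 3) F) =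
            fromBlocks A 0 0 (Aᵀ)⁻¹} ∪ {tu})) :
    ∃ (ι : SL(3, F) →* G) (τ : G), IsGraphExtension ι τ := by
  have hι (A) : blockHom F A ∈ G := by
    rw [hG]
    exact Subgroup.subset_closure (Or.inl (mem_blockHom_range.2 ⟨A, rfl⟩))
  have hτ : tu ∈ G := by
    rw [hG]
    exact Subgroup.subset_closure (Or.inr rfl)
  have hself : tu * tu = 1 := by
    apply Units.ext
    simp [htu, fromBlocks_multiply]
  have hmap (A) : tu * blockHom F A = blockHom F (contra A) * tu := by
    apply Units.ext
    simp [htu, fromBlocks_multiply, contra_contra]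
  have hcover (g) (hg : g ∈ G) : ∃ A, g = blockHom F A ∨ g = blockHom F A * tu := by
    rw [hG] at hg
    induction hg using Subgroup.closure_induction with
    | mem g hg =>
      rcases hg with hg | rfl
      · obtain ⟨A, rfl⟩ := mem_blockHom_range.1 hg
        exact ⟨A, Or.inl rfl⟩
      · exact ⟨1, Or.inr (by rw [map_one, one_mul])⟩
    | one => exact ⟨1, Or.inl (map_one _).symm⟩
    | mul g k _ _ hg hk =>
      obtain ⟨A, rfl | rfl⟩ := hg <;> obtain ⟨B, rfl | rfl⟩ := hk
      · exact ⟨A * B, Or.inl (map_mul _ _ _).symm⟩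
      · exact ⟨A * B, Or.inr (by rw [map_mul, mul_assoc])⟩
      · exact ⟨A * contra B, Or.inr (by rw [mul_assoc, hmap, map_mul, mul_assoc])⟩
      · exact ⟨A * contra B, Or.inl (by
          rw [mul_assoc, ← mul_assoc tu, hmap, mul_assoc _ tu, hself, mul_one, map_mul])⟩
    | inv g _ hg =>
      obtain ⟨A, rfl | rfl⟩ := hg
      · exact ⟨A⁻¹, Or.inl (map_inv _ _).symm⟩
      · exact ⟨contra A⁻¹, Or.inr (by
          rw [_root_.mul_inv_rev, inv_eq_of_mul_eq_one_left hself, ← map_inv, hmap])⟩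
  refine ⟨(blockHom F).codRestrict G hι, ⟨tu, hτ⟩, ?_, Subtype.ext hself,
    fun A => Subtype.ext (hmap A), ?_, ?_⟩
  · intro A B hAB
    have e := congrArg Units.val (congrArg Subtype.val hAB)
    exact sl_ext (fromBlocks_inj.1 e).1
  · intro A hA
    have e : (blockHom F A : Matrix (Fin 3 ⊕ Fin 3) (Fin 3 ⊕ Fin 3) F) = tu :=
      congrArg Units.val (congrArg Subtype.val hA)
    rw [htu, coe_blockHom, fromBlocks_inj] at e
    exact zero_ne_one e.2.1
  · rintro ⟨g, hg⟩
    obtain ⟨A, hA⟩ := hcover g hg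
    exact ⟨A, hA.imp (fun e => Subtype.ext e) (fun e => Subtype.ext e)⟩

end Concrete

theorem stmt_1 (p : ℕ) [Fact p.Prime] (hp3 : p % 3 = 1) (hp8 : p % 8 = 5)
    (tu : GL (Fin 3 ⊕ Fin 3) (ZMod p))
    (htu : (tu : Matrix (Fin 3 ⊕ Fin 3) (Fin 3 ⊕ Fin 3) (ZMod p)) = fromBlocks 0 1 1 0)
    (G : Subgroup (GL (Fin 3 ⊕ Fin 3) (ZMod p)))
    (hG : G = Subgroup.closure
      ({g : GL (Fin 3 ⊕ Fin 3) (ZMod p) | ∃ A : Matrix (Fin 3) (Fin 3) (ZMod p),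
          A.det = 1 ∧ (g : Matrix (Fin 3 ⊕ Fin 3) (Fin 3 ⊕ Fin 3) (ZMod p)) =
            fromBlocks A 0 0 (Aᵀ)⁻¹} ∪ {tu})) :
    ∃ ts : Fin 4 → ↥G, IsCString ts ∧ IsUnravelled ts ∧
      orderOf (ts 0 * ts 1) = 4 ∧ orderOf (ts 1 * ts 2) = p ∧ orderOf (ts 2 * ts 3) = 4 := by
  obtain ⟨P⟩ := nonempty_params hp3 hp8
  obtain ⟨ι, τ, h⟩ := exists_isGraphExtension htu hG
  exact ⟨P.string ι τ, P.isCString h, P.isUnravelled h, P.orderOf_zero_one h,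
    P.orderOf_one_two h, P.orderOf_two_three h⟩
end

section
/- Under the full Section-3 setup (including hypothesis (iii)), the subgroup ⟨t₂, t₃⟩ of G equals C_G(t) ∩ C_G(r), and this subgroup is isomorphic to the dihedral group of order 2(q+1). -/
open Matrix

/-- A group generated by two involutions `s`, `t` is dihedral when `s` is not a power of `s * t`. -/
theorem nonempty_closure_pair_mulEquiv_dihedralGroup {G : Type*} [Group G] {n : ℕ} {s t : G}
    (hs : s * s = 1) (ht : t * t = 1) (hn : orderOf (s * t) = n)
    (hst : s ∉ Subgroup.zpowers (s * t)) :
    Nonempty (↥(Subgroup.closure {s, t}) ≃* DihedralGroup n) := by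
  obtain ⟨x, hx⟩ : ∃ x, x = s * t := ⟨_, rfl⟩
  rw [← hx] at hn hst
  let f : ZMod n →+ Additive G := ZMod.lift n ⟨zmultiplesHom _ (Additive.ofMul x), by
    simp [← ofMul_pow, ← hn, pow_orderOf_eq_one]⟩
  let p : ZMod n → G := fun i => (f i).toMul
  have hp : ∀ k : ℤ, p k = x ^ k := fun k => by simp [p, f]
  have hsurj : ∀ i : ZMod n, ∃ k : ℤ, (k : ZMod n) = i := ZMod.intCast_surjective
  have hadd : ∀ i j, p (i + j) = p i * p j := fun i j => by simp [p]
  have hinj : ∀ i, p i = 1 → i = 0 := by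
    intro i hi
    obtain ⟨k, rfl⟩ := hsurj i
    rw [hp, ← orderOf_dvd_iff_zpow_eq_one, hn] at hi
    exact (ZMod.intCast_zmod_eq_zero_iff_dvd k n).2 hi
  have hsinv : s⁻¹ = s := inv_eq_of_mul_eq_one_left hs
  have htinv : t⁻¹ = t := inv_eq_of_mul_eq_one_left ht
  have hconj : ∀ i, p i * s = s * p (-i) := by
    intro i
    obtain ⟨k, rfl⟩ := hsurj i
    rw [← Int.cast_neg, hp, hp, _root_.zpow_neg, ← _root_.inv_zpow]
    have h1 : SemiconjBy s x⁻¹ x := by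
      simp [SemiconjBy, hx, hsinv, htinv, mul_assoc]
    exact ((h1.zpow_right k).eq).symm
  let φ : DihedralGroup n →* G := MonoidHom.mk' (fun g => match g with
    | .r i => p i
    | .sr i => s * p i) (by
      rintro (i | i) (j | j)
      · exact hadd i j
      · change s * p (j - i) = p i * (s * p j)
        rw [← mul_assoc, hconj, mul_assoc, ← hadd, neg_add_eq_sub]
      · change s * p (i + j) = s * p i * p j
        rw [hadd, mul_assoc]
      · change p (j - i) = s * p i * (s * p j)
        rw [mul_assoc, ← mul_assoc (p i), hconj, mul_assoc, ← mul_assoc, hs, one_mul, ← hadd,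
          neg_add_eq_sub])
  have hφ : Function.Injective φ := by
    rw [injective_iff_map_eq_one]
    rintro (i | i) hi
    · rw [hinj i hi, DihedralGroup.r_zero]
    · obtain ⟨k, rfl⟩ := hsurj i
      replace hi : s * p k = 1 := hi
      refine absurd ?_ hst
      rw [eq_inv_of_mul_eq_one_left hi, hp]
      exact inv_mem (zpow_mem (Subgroup.mem_zpowers x) k)
  have hxs : x ∈ Subgroup.closure {s, t} := hx ▸
    mul_mem (Subgroup.subset_closure (by simp)) (Subgroup.subset_closure (by simp))
  have hrange : φ.range = Subgroup.closure {s, t} := by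
    apply le_antisymm
    · rintro _ ⟨i | i, rfl⟩ <;> obtain ⟨k, rfl⟩ := hsurj i
      · change p k ∈ _
        rw [hp]
        exact zpow_mem hxs k
      · change s * p k ∈ _
        rw [hp]
        exact mul_mem (Subgroup.subset_closure (by simp)) (zpow_mem hxs k)
    · rw [Subgroup.closure_le]
      rintro g (rfl | rfl)
      · exact ⟨.sr (0 : ℤ), by change g * p _ = g; rw [hp]; simp⟩
      · exact ⟨.sr (1 : ℤ), by
          change s * p _ = g
          rw [hp, zpow_one, hx, ← mul_assoc, hs, one_mul]⟩
  exact ⟨((MonoidHom.ofInjective hφ).trans (MulEquiv.subgroupCongr hrange)).symm⟩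

section Rotation

variable {F : Type*} [Field F]

/-- The matrix of the plane rotation with cosine `a` and sine `b`, fixing the third axis. -/
def planeRotation (a b : F) : Matrix (Fin 3) (Fin 3) F :=
  !![a, -b, 0; b, a, 0; 0, 0, 1]

theorem planeRotation_mul (a b c d : F) :
    planeRotation a b * planeRotation c d =
      planeRotation (a * c - b * d) (a * d + b * c) := by
  ext i j
  fin_cases i <;> fin_cases j <;>
    simp [planeRotation, Matrix.mul_apply, Fin.sum_univ_three] <;> ring

theorem planeRotation_one_zero : planeRotation (1 : F) 0 = 1 := by
  ext i j
  fin_cases i <;> fin_cases j <;> simp [planeRotation]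

theorem exists_planeRotation_pow {K : Type*} [Field K] [Algebra F K] {ι : K} (hι : ι ^ 2 = -1)
    (a b : F) (n : ℕ) :
    ∃ c d : F, planeRotation a b ^ n = planeRotation c d ∧
      (algebraMap F K a + algebraMap F K b * ι) ^ n = algebraMap F K c + algebraMap F K d * ι := by
  induction n with
  | zero => exact ⟨1, 0, by simp [planeRotation_one_zero], by simp⟩
  | succ n ih =>
    obtain ⟨c, d, h1, h2⟩ := ih
    refine ⟨c * a - d * b, c * b + d * a, by rw [pow_succ, h1, planeRotation_mul], ?_⟩
    rw [pow_succ, h2]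
    simp only [map_sub, map_add, map_mul]
    linear_combination algebraMap F K d * algebraMap F K b * hι

theorem algebraMap_add_mul_inj {K : Type*} [Field K] [Algebra F K] {ι : K}
    (hι : ∀ j : F, algebraMap F K j ≠ ι) {a b c d : F}
    (h : algebraMap F K a + algebraMap F K b * ι = algebraMap F K c + algebraMap F K d * ι) :
    a = c ∧ b = d := by
  have hbd : b = d := by
    by_contra hne
    have hne' : algebraMap F K (b - d) ≠ 0 := by simpa [sub_eq_zero] using hne
    apply hι ((c - a) / (b - d))
    rw [map_div₀, div_eq_iff hne', map_sub, map_sub]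
    linear_combination -h
  subst hbd
  exact ⟨(algebraMap F K).injective (add_right_cancel h), rfl⟩

/-- If `a + bι` has order `|F| + 1` in an extension containing a square root `ι` of `-1`, then the
rotation by `(a, b)` has order `|F| + 1` and generates the group of all plane rotations. -/
theorem orderOf_planeRotation_and_eq_pow [Fintype F] {K : Type*} [Field K] [Algebra F K]
    {ι : K} (hι : ι ^ 2 = -1) (h2 : (2 : F) ≠ 0) {a b : F}
    (hord : orderOf (algebraMap F K a + algebraMap F K b * ι) = Fintype.card F + 1) :
    orderOf (planeRotation a b) = Fintype.card F + 1 ∧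
      ∀ c d : F, c ^ 2 + d ^ 2 = 1 → ∃ n : ℕ, planeRotation c d = planeRotation a b ^ n := by
  set z := algebraMap F K a + algebraMap F K b * ι with hz
  set φ := FiniteField.frobeniusAlgHom F K
  have hφpow : ∀ x, φ x = x ^ Fintype.card F := fun x => rfl
  have hq : 1 < Fintype.card F := Fintype.one_lt_card
  have hz0 : z ≠ 0 := by
    intro h0
    have := pow_orderOf_eq_one z
    rw [hord, h0, zero_pow (Nat.succ_ne_zero _)] at this
    exact zero_ne_one this
  have hφι : φ ι = -ι := by
    have hsq : φ ι ^ 2 = ι ^ 2 := by rw [← map_pow, hι, map_neg, map_one]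
    rcases sq_eq_sq_iff_eq_or_eq_neg.1 hsq with h | h
    · exfalso
      have hfix : φ z = z := by simp [hz, h]
      rw [hφpow] at hfix
      have h1 : z ^ (Fintype.card F - 1) = 1 := by
        apply mul_right_cancel₀ hz0
        rw [← pow_succ, Nat.sub_add_cancel hq.le, hfix, one_mul]
      have h2 := Nat.le_of_dvd (by omega) (orderOf_dvd_of_pow_eq_one h1)
      omega
    · exact h
  have h2K : (2 : K) ≠ 0 := by
    rw [← map_ofNat (algebraMap F K) 2]
    exact (map_ne_zero _).2 h2
  have hι0 : ι ≠ 0 := by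
    rintro rfl
    norm_num at hι
  have hιF : ∀ j : F, algebraMap F K j ≠ ι := by
    intro j hj
    rw [← hj, AlgHom.commutes, hj] at hφι
    exact mul_ne_zero h2K hι0 (by linear_combination hφι)
  have key : ∀ n, planeRotation a b ^ n = 1 ↔ z ^ n = 1 := by
    intro n
    obtain ⟨c, d, h1, h3⟩ := exists_planeRotation_pow hι a b n
    rw [h1, hz, h3]
    constructor
    · intro h
      have hc := congrFun (congrFun h 0) 0
      have hd := congrFun (congrFun h 1) 0
      simp [planeRotation] at hc hd
      simp [hc, hd]
    · intro h
      obtain ⟨rfl, rfl⟩ := algebraMap_add_mul_inj hιF (c := 1) (d := 0) (by simpa using h)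
      exact planeRotation_one_zero
  refine ⟨?_, fun c d hcd => ?_⟩
  · rw [← hord]
    exact orderOf_eq_orderOf_iff.2 key
  · have hnorm : (algebraMap F K c + algebraMap F K d * ι) ^ (Fintype.card F + 1) = 1 := by
      rw [pow_succ, ← hφpow, map_add, map_mul, AlgHom.commutes, AlgHom.commutes, hφι]
      have := congrArg (algebraMap F K) hcd
      simp only [map_add, map_pow, map_one] at this
      linear_combination this - algebraMap F K d ^ 2 * hι
    have hprim : IsPrimitiveRoot z (Fintype.card F + 1) := hord ▸ IsPrimitiveRoot.orderOf z
    obtain ⟨n, -, hn⟩ := hprim.eq_pow_of_pow_eq_one hnorm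
    obtain ⟨c', d', h1, h3⟩ := exists_planeRotation_pow hι a b n
    obtain ⟨rfl, rfl⟩ := algebraMap_add_mul_inj hιF (hn.symm.trans h3)
    exact ⟨n, h1.symm⟩

/-- A special orthogonal matrix commuting with `diag(x, x, y)`, where `x ≠ y`, is a plane rotation,
possibly after multiplication by the half-turn `diag(-1, 1, -1)`. -/
theorem exists_eq_planeRotation {A : Matrix (Fin 3) (Fin 3) F} (hdet : A.det = 1)
    (horth : A * Aᵀ = 1) {x y : F} (hxy : x ≠ y)
    (hcomm : diagonal ![x, x, y] * A = A * diagonal ![x, x, y]) :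
    ∃ a b : F, a ^ 2 + b ^ 2 = 1 ∧
      (A = planeRotation a b ∨ diagonal ![(-1 : F), 1, -1] * A = planeRotation a b) := by
  have hentry : ∀ i j, ![x, x, y] i * A i j = A i j * ![x, x, y] j := fun i j => by
    have := congrFun (congrFun hcomm i) j
    rwa [diagonal_mul, mul_diagonal] at this
  have hxy' : x - y ≠ 0 := sub_ne_zero.2 hxy
  have h02 : A 0 2 = 0 := by
    have := hentry 0 2
    simp at this
    exact (mul_eq_zero.1 (by linear_combination this : (x - y) * A 0 2 = 0)).resolve_left hxy'
  have h12 : A 1 2 = 0 := by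
    have := hentry 1 2
    simp at this
    exact (mul_eq_zero.1 (by linear_combination this : (x - y) * A 1 2 = 0)).resolve_left hxy'
  have h20 : A 2 0 = 0 := by
    have := hentry 2 0
    simp at this
    exact (mul_eq_zero.1 (by linear_combination -this : (x - y) * A 2 0 = 0)).resolve_left hxy'
  have h21 : A 2 1 = 0 := by
    have := hentry 2 1
    simp at this
    exact (mul_eq_zero.1 (by linear_combination -this : (x - y) * A 2 1 = 0)).resolve_left hxy'
  have o00 := congrFun (congrFun horth 0) 0
  have o01 := congrFun (congrFun horth 0) 1
  have o11 := congrFun (congrFun horth 1) 1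
  have o22 := congrFun (congrFun horth 2) 2
  rw [det_fin_three] at hdet
  simp [Matrix.mul_apply, Fin.sum_univ_three, h02, h12, h20, h21] at o00 o01 o11 o22 hdet
  have h22 : A 2 2 = 1 ∨ A 2 2 = -1 := mul_self_eq_one_iff.1 o22
  rcases h22 with h22 | h22 <;> rw [h22] at hdet
  · have e1 : A 1 1 = A 0 0 := by
      linear_combination A 0 0 * hdet + A 0 1 * o01 - A 1 1 * o00
    have e2 : A 0 1 = -A 1 0 := by
      linear_combination -A 1 0 * o00 + A 0 0 * o01 - A 0 1 * hdet
    refine ⟨A 0 0, A 1 0, ?_, Or.inl ?_⟩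
    · rw [e2] at o00
      linear_combination o00
    · ext i j
      fin_cases i <;> fin_cases j <;> simp [planeRotation, h02, h12, h20, h21, h22, e1, e2]
  · have e1 : A 1 1 = -A 0 0 := by
      linear_combination -A 0 0 * hdet + A 0 1 * o01 - A 1 1 * o00
    have e2 : A 0 1 = A 1 0 := by
      linear_combination A 1 0 * o00 - A 0 0 * o01 - A 0 1 * hdet
    refine ⟨-A 0 0, A 1 0, ?_, Or.inr ?_⟩
    · rw [e2] at o00
      linear_combination o00
    · ext i j
      fin_cases i <;> fin_cases j <;>
        simp [planeRotation, h02, h12, h20, h21, h22, e1, e2]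

end Rotation

section BlockForm

variable {F : Type*} [Field F]

theorem fromBlocks_diagonal_self_pow {m R : Type*} [Fintype m] [DecidableEq m] [Semiring R]
    (A : Matrix m m R) (n : ℕ) : fromBlocks A 0 0 A ^ n = fromBlocks (A ^ n) 0 0 (A ^ n) := by
  induction n with
  | zero => simp [fromBlocks_one]
  | succ n ih => simp [pow_succ, ih, fromBlocks_multiply]

/-- The elements of the group generated by the matrices `diag(A, A⁻ᵀ)` with `det A = 1` and the
block swap are block diagonal or block antidiagonal. -/
theorem block_form_of_mem_closure {tu g : GL (Fin 3 ⊕ Fin 3) F}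
    (htu : (tu : Matrix (Fin 3 ⊕ Fin 3) (Fin 3 ⊕ Fin 3) F) = fromBlocks 0 1 1 0)
    (hg : g ∈ Subgroup.closure ({g : GL (Fin 3 ⊕ Fin 3) F | ∃ A : Matrix (Fin 3) (Fin 3) F,
      A.det = 1 ∧ (g : Matrix (Fin 3 ⊕ Fin 3) (Fin 3 ⊕ Fin 3) F) =
        fromBlocks A 0 0 (Aᵀ)⁻¹} ∪ {tu})) :
    ∃ A B : Matrix (Fin 3) (Fin 3) F, A.det = 1 ∧ A * Bᵀ = 1 ∧
      ((g : Matrix (Fin 3 ⊕ Fin 3) (Fin 3 ⊕ Fin 3) F) = fromBlocks A 0 0 B ∨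
        (g : Matrix (Fin 3 ⊕ Fin 3) (Fin 3 ⊕ Fin 3) F) = fromBlocks 0 A B 0) := by
  have flip : ∀ {A B : Matrix (Fin 3) (Fin 3) F}, A * Bᵀ = 1 → B * Aᵀ = 1 := by
    intro A B h
    simpa using congrArg transpose h
  have hdet : ∀ {A B : Matrix (Fin 3) (Fin 3) F}, A.det = 1 → A * Bᵀ = 1 → B.det = 1 := by
    intro A B hA h
    simpa [hA] using congrArg det h
  have hmul : ∀ {A B C D : Matrix (Fin 3) (Fin 3) F}, A * Bᵀ = 1 → C * Dᵀ = 1 →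
      A * C * (B * D)ᵀ = 1 := by
    intro A B C D h1 h2
    rw [transpose_mul, mul_assoc, ← mul_assoc C, h2, one_mul, h1]
  induction hg using Subgroup.closure_induction with
  | mem g hg =>
    rcases hg with ⟨A, hA, h⟩ | rfl
    · refine ⟨A, (Aᵀ)⁻¹, hA, ?_, Or.inl h⟩
      rw [transpose_nonsing_inv, transpose_transpose, mul_nonsing_inv _ (by simp [hA])]
    · exact ⟨1, 1, by simp, by simp, Or.inr htu⟩
  | one => exact ⟨1, 1, by simp, by simp, Or.inl (by simp [fromBlocks_one])⟩
  | mul g h _ _ ihg ihh =>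
    obtain ⟨A, B, hA, hAB, hg⟩ := ihg
    obtain ⟨C, D, hC, hCD, hh⟩ := ihh
    rcases hg with hg | hg <;> rcases hh with hh | hh
    · exact ⟨A * C, B * D, by simp [hA, hC], hmul hAB hCD,
        Or.inl (by simp [hg, hh, fromBlocks_multiply])⟩
    · exact ⟨A * C, B * D, by simp [hA, hC], hmul hAB hCD,
        Or.inr (by simp [hg, hh, fromBlocks_multiply])⟩
    · exact ⟨A * D, B * C, by simp [hA, hdet hC hCD], hmul hAB (flip hCD),
        Or.inr (by simp [hg, hh, fromBlocks_multiply])⟩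
    · exact ⟨A * D, B * C, by simp [hA, hdet hC hCD], hmul hAB (flip hCD),
        Or.inl (by simp [hg, hh, fromBlocks_multiply])⟩
  | inv g _ ih =>
    obtain ⟨A, B, hA, hAB, hg⟩ := ih
    have hBA := flip hAB
    rcases hg with hg | hg
    · refine ⟨Bᵀ, Aᵀ, by simp [hdet hA hAB], by simpa using mul_eq_one_comm.1 hAB, Or.inl ?_⟩
      rw [coe_units_inv]
      apply inv_eq_right_inv
      rw [hg, fromBlocks_multiply]
      simp [hAB, hBA, fromBlocks_one]
    · refine ⟨Aᵀ, Bᵀ, by simp [hA], by simpa using mul_eq_one_comm.1 hBA, Or.inr ?_⟩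
      rw [coe_units_inv]
      apply inv_eq_right_inv
      rw [hg, fromBlocks_multiply]
      simp [hAB, hBA, fromBlocks_one]

/-- The elements of the centralizer of the block swap and of the twisted swap given by
`diag(x, x, y)` are `diag(A, A)` with `A` special orthogonal and commuting with `diag(x, x, y)`. -/
theorem exists_eq_fromBlocks_of_mem_centralizer {tu ru g : GL (Fin 3 ⊕ Fin 3) F} {x y : F}
    (hx : x ≠ 0) (hx2 : x ^ 2 ≠ 1) (hxy : x * y ≠ 1) (hy : y ≠ 0)
    (htu : (tu : Matrix (Fin 3 ⊕ Fin 3) (Fin 3 ⊕ Fin 3) F) = fromBlocks 0 1 1 0)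
    (hru : (ru : Matrix (Fin 3 ⊕ Fin 3) (Fin 3 ⊕ Fin 3) F) =
      fromBlocks 0 (diagonal ![x, x, y]) (diagonal ![x⁻¹, x⁻¹, y⁻¹]) 0)
    (hg : g ∈ Subgroup.closure ({g : GL (Fin 3 ⊕ Fin 3) F | ∃ A : Matrix (Fin 3) (Fin 3) F,
      A.det = 1 ∧ (g : Matrix (Fin 3 ⊕ Fin 3) (Fin 3 ⊕ Fin 3) F) =
        fromBlocks A 0 0 (Aᵀ)⁻¹} ∪ {tu}))
    (hgt : g ∈ Subgroup.centralizer {tu}) (hgr : g ∈ Subgroup.centralizer {ru}) :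
    ∃ A : Matrix (Fin 3) (Fin 3) F, A.det = 1 ∧ A * Aᵀ = 1 ∧
      diagonal ![x, x, y] * A = A * diagonal ![x, x, y] ∧
      (g : Matrix (Fin 3 ⊕ Fin 3) (Fin 3 ⊕ Fin 3) F) = fromBlocks A 0 0 A := by
  obtain ⟨A, B, hA, hAB, hg⟩ := block_form_of_mem_closure htu hg
  have ht := congrArg Units.val (Subgroup.mem_centralizer_singleton_iff.1 hgt)
  have hr := congrArg Units.val (Subgroup.mem_centralizer_singleton_iff.1 hgr)
  rw [Units.val_mul, Units.val_mul, htu] at ht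
  rw [Units.val_mul, Units.val_mul, hru] at hr
  rcases hg with hg | hg
  · rw [hg] at ht hr
    simp only [fromBlocks_multiply, fromBlocks_inj, mul_zero, zero_mul, mul_one, one_mul, zero_add,
      add_zero] at ht hr
    obtain rfl : A = B := by tauto
    exact ⟨A, hA, hAB, hr.2.1.symm, hg⟩
  · exfalso
    rw [hg] at ht hr
    simp only [fromBlocks_multiply, fromBlocks_inj, mul_zero, zero_mul, mul_one, one_mul, zero_add,
      add_zero] at ht hr
    obtain rfl : A = B := by tauto
    have hrow : ∀ j, A 0 j = 0 := by
      intro j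
      have h := congrFun (congrFun hr.1 0) j
      rw [diagonal_mul, mul_diagonal] at h
      have hx2' : x ^ 2 - 1 ≠ 0 := sub_ne_zero.2 hx2
      have hxy' : x * y - 1 ≠ 0 := sub_ne_zero.2 hxy
      fin_cases j <;> simp at h ⊢ <;> field_simp at h
      · exact (mul_eq_zero.1 (by linear_combination -h : (x ^ 2 - 1) * A 0 0 = 0)).resolve_left hx2'
      · exact (mul_eq_zero.1 (by linear_combination -h : (x ^ 2 - 1) * A 0 1 = 0)).resolve_left hx2'
      · exact (mul_eq_zero.1 (by linear_combination -h : (x * y - 1) * A 0 2 = 0)).resolve_left hxy'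
    rw [det_eq_zero_of_row_eq_zero 0 hrow] at hA
    exact zero_ne_one hA

/-- The matrix `diag(A, A)`, with `A` special orthogonal, block diagonal of type `(2, 1)`, lies in
the centralizer of the block swap and of the twisted swap given by `diag(x, x, y)`. -/
theorem mem_centralizer_of_eq_fromBlocks {tu ru g : GL (Fin 3 ⊕ Fin 3) F} {x y : F}
    (htu : (tu : Matrix (Fin 3 ⊕ Fin 3) (Fin 3 ⊕ Fin 3) F) = fromBlocks 0 1 1 0)
    (hru : (ru : Matrix (Fin 3 ⊕ Fin 3) (Fin 3 ⊕ Fin 3) F) =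
      fromBlocks 0 (diagonal ![x, x, y]) (diagonal ![x⁻¹, x⁻¹, y⁻¹]) 0)
    {a b c d e : F} (hdet : !![a, b, 0; c, d, 0; 0, 0, e].det = 1)
    (horth : !![a, b, 0; c, d, 0; 0, 0, e] * !![a, b, 0; c, d, 0; 0, 0, e]ᵀ = 1)
    (hg : (g : Matrix (Fin 3 ⊕ Fin 3) (Fin 3 ⊕ Fin 3) F) =
      fromBlocks !![a, b, 0; c, d, 0; 0, 0, e] 0 0 !![a, b, 0; c, d, 0; 0, 0, e]) :
    g ∈ Subgroup.closure ({g : GL (Fin 3 ⊕ Fin 3) F | ∃ A : Matrix (Fin 3) (Fin 3) F,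
      A.det = 1 ∧ (g : Matrix (Fin 3 ⊕ Fin 3) (Fin 3 ⊕ Fin 3) F) =
        fromBlocks A 0 0 (Aᵀ)⁻¹} ∪ {tu}) ∧
    g ∈ Subgroup.centralizer {tu} ∧ g ∈ Subgroup.centralizer {ru} := by
  refine ⟨Subgroup.subset_closure (Or.inl ⟨_, hdet, ?_⟩), ?_, ?_⟩
  · rw [inv_eq_left_inv horth, hg]
  · rw [Subgroup.mem_centralizer_singleton_iff]
    apply Units.ext
    rw [Units.val_mul, Units.val_mul, htu, hg]
    simp [fromBlocks_multiply]
  · rw [Subgroup.mem_centralizer_singleton_iff]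
    have hcomm : ∀ u v : F, diagonal ![u, u, v] * !![a, b, 0; c, d, 0; 0, 0, e] =
        !![a, b, 0; c, d, 0; 0, 0, e] * diagonal ![u, u, v] := by
      intro u v
      ext i j
      rw [diagonal_mul, mul_diagonal]
      fin_cases i <;> fin_cases j <;> simp [mul_comm]
    apply Units.ext
    rw [Units.val_mul, Units.val_mul, hru, hg]
    simp only [fromBlocks_multiply, hcomm, mul_zero, zero_mul, zero_add, add_zero]

end BlockForm

theorem stmt_10 (q : ℕ) (F : Type) [Field F] [Fintype F]
    (hF : Fintype.card F = q) (h6 : 6 ∣ q - 1)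
    (K : Type) [Field K] [Fintype K] [Algebra F K] (hK : Fintype.card K = q ^ 2)
    (rho lam mu alpha beta xi eta tau : F)
    (hrho : orderOf rho = 6)
    (hlam : 2 * lam ^ 2 = 1) (hmu : 2 * mu ^ 2 - lam ^ 2 = 0)
    (halpha : alpha = ((mu ^ 2)⁻¹ - 1)⁻¹)
    (hbeta : beta = 2 * alpha * lam * mu⁻¹)
    (hxi : xi = rho ^ 2 + (1 - rho ^ 2) * 2⁻¹)
    (heta : eta = (1 - rho ^ 2) * 2⁻¹)
    (htau : tau = rho ^ 4)
    (hiii : ∃ theta : K, theta ^ 2 = algebraMap F K ((3 : F)⁻¹ ^ 2 - 1) ∧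
      (orderOf (-(algebraMap F K (3 : F)⁻¹) + theta) = q + 1 ∨
       orderOf (-(algebraMap F K (3 : F)⁻¹) - theta) = q + 1))
    (u1 u2 u3 u4 tu : GL (Fin 3 ⊕ Fin 3) F)
    (hu1 : (u1 : Matrix (Fin 3 ⊕ Fin 3) (Fin 3 ⊕ Fin 3) F) =
      fromBlocks 0 !![mu, lam, mu; lam, 0, -lam; mu, -lam, mu]
        !![mu, lam, mu; lam, 0, -lam; mu, -lam, mu] 0)
    (hu2 : (u2 : Matrix (Fin 3 ⊕ Fin 3) (Fin 3 ⊕ Fin 3) F) =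
      fromBlocks (diagonal ![(-1 : F), 1, -1]) 0 0 (diagonal ![(-1 : F), 1, -1]))
    (hu3 : (u3 : Matrix (Fin 3 ⊕ Fin 3) (Fin 3 ⊕ Fin 3) F) =
      fromBlocks !![alpha, beta, 0; beta, -alpha, 0; 0, 0, -1] 0 0
        !![alpha, beta, 0; beta, -alpha, 0; 0, 0, -1])
    (hu4 : (u4 : Matrix (Fin 3 ⊕ Fin 3) (Fin 3 ⊕ Fin 3) F) =
      fromBlocks 0 !![xi, 0, eta; 0, tau, 0; eta, 0, xi]
        !![xi * (rho ^ 2)⁻¹, 0, eta * rho; 0, tau * (rho ^ 2)⁻¹, 0; eta * rho, 0, xi * (rho ^ 2)⁻¹] 0)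
    (htu : (tu : Matrix (Fin 3 ⊕ Fin 3) (Fin 3 ⊕ Fin 3) F) = fromBlocks 0 1 1 0)
    (G : Subgroup (GL (Fin 3 ⊕ Fin 3) F))
    (hG : G = Subgroup.closure
      ({g : GL (Fin 3 ⊕ Fin 3) F | ∃ A : Matrix (Fin 3) (Fin 3) F,
          A.det = 1 ∧ (g : Matrix (Fin 3 ⊕ Fin 3) (Fin 3 ⊕ Fin 3) F) =
            fromBlocks A 0 0 (Aᵀ)⁻¹} ∪ {tu}))
    (ru : GL (Fin 3 ⊕ Fin 3) F)
    (hru : (ru : Matrix (Fin 3 ⊕ Fin 3) (Fin 3 ⊕ Fin 3) F) =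
      fromBlocks 0 (diagonal ![rho, rho, (rho ^ 2)⁻¹]) (diagonal ![rho⁻¹, rho⁻¹, rho ^ 2]) 0) :
    (G ⊓ Subgroup.centralizer {tu}) ⊓ (G ⊓ Subgroup.centralizer {ru}) =
      Subgroup.closure {u2, u3} ∧
    Nonempty (↥(Subgroup.closure {u2, u3}) ≃* DihedralGroup (q + 1)) := by
  subst hF
  have h2 : (2 : F) ≠ 0 := fun h => by simp [h] at hlam
  have h4 : (4 : F) ≠ 0 := by
    rw [show (4 : F) = 2 * 2 by norm_num]
    exact mul_ne_zero h2 h2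
  have hrho6 : rho ^ 6 = 1 := hrho ▸ pow_orderOf_eq_one rho
  have hrho0 : rho ≠ 0 := by
    rintro rfl
    simp at hrho6
  have hrho2 : rho ^ 2 ≠ 1 := pow_ne_one_of_lt_orderOf (by norm_num) (by omega)
  have hrho3 : rho ^ 3 ≠ 1 := pow_ne_one_of_lt_orderOf (by norm_num) (by omega)
  have hrhoq : rho ^ 2 - rho + 1 = 0 := by
    have e : (rho ^ 3 - 1) * (rho + 1) * (rho ^ 2 - rho + 1) = 0 := by linear_combination hrho6
    refine (mul_eq_zero.1 e).resolve_left (mul_ne_zero (sub_ne_zero.2 hrho3) fun h => hrho2 ?_)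
    linear_combination (rho - 1) * h
  have h3 : (3 : F) ≠ 0 := by
    intro h
    have e : (rho + 1) ^ 2 = 0 := by linear_combination hrhoq + rho * h
    apply hrho2
    linear_combination (rho - 1) * (pow_eq_zero_iff two_ne_zero).1 e
  have h9 : (9 : F) ≠ 0 := by
    rw [show (9 : F) = 3 * 3 by norm_num]
    exact mul_ne_zero h3 h3
  have hmu2 : mu ^ 2 = 4⁻¹ := by
    field_simp
    linear_combination 2 * hmu + hlam
  have hmu0 : mu ≠ 0 := by
    rintro rfl
    rw [zero_pow two_ne_zero] at hmu2
    exact inv_ne_zero h4 hmu2.symm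
  have hal : alpha = 3⁻¹ := by
    rw [halpha, hmu2, inv_inv]
    norm_num
  have hbe : beta ^ 2 = 8 * 9⁻¹ := by
    rw [hbeta, hal, mul_pow, mul_pow, mul_pow, inv_pow, inv_pow, hmu2]
    field_simp
    linear_combination 72 * hlam
  have hnorm : alpha ^ 2 + beta ^ 2 = 1 := by
    rw [hbe, hal]
    field_simp
    norm_num
  have hbe0 : beta ≠ 0 := by
    rintro rfl
    rw [show (8 : F) = 2 * 4 by norm_num] at hbe
    simp [h2, h4, h9] at hbe
  obtain ⟨ι, hι, hord⟩ : ∃ ι : K, ι ^ 2 = -1 ∧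
      orderOf (algebraMap F K (-alpha) + algebraMap F K beta * ι) = Fintype.card F + 1 := by
    obtain ⟨theta, hth, hor⟩ := hiii
    have hbK : algebraMap F K beta ≠ 0 := (map_ne_zero _).2 hbe0
    have hth' : theta ^ 2 = -algebraMap F K beta ^ 2 := by
      rw [hth, ← map_pow, ← map_neg]
      congr 1
      rw [← hal]
      linear_combination hnorm
    have hsq : (theta / algebraMap F K beta) ^ 2 = -1 := by
      rw [div_pow, hth', neg_div, div_self (pow_ne_zero 2 hbK)]
    rcases hor with hor | hor
    · refine ⟨theta / algebraMap F K beta, hsq, ?_⟩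
      rw [mul_div_cancel₀ _ hbK, map_neg, hal, hor]
    · refine ⟨-(theta / algebraMap F K beta), by rw [neg_sq, hsq], ?_⟩
      rw [mul_neg, mul_div_cancel₀ _ hbK, map_neg, hal, ← sub_eq_add_neg, hor]
  obtain ⟨hR, hpow⟩ := orderOf_planeRotation_and_eq_pow hι h2 hord
  have hx : ((u2 * u3 : GL (Fin 3 ⊕ Fin 3) F) : Matrix (Fin 3 ⊕ Fin 3) (Fin 3 ⊕ Fin 3) F) =
      fromBlocks (planeRotation (-alpha) beta) 0 0 (planeRotation (-alpha) beta) := by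
    have e : diagonal ![(-1 : F), 1, -1] * !![alpha, beta, 0; beta, -alpha, 0; 0, 0, -1] =
        planeRotation (-alpha) beta := by
      ext i j
      rw [diagonal_mul]
      fin_cases i <;> fin_cases j <;> simp [planeRotation]
    rw [Units.val_mul, hu2, hu3, fromBlocks_multiply]
    simp [e]
  have hxpow : ∀ n : ℕ,
      (((u2 * u3) ^ n : GL (Fin 3 ⊕ Fin 3) F) : Matrix (Fin 3 ⊕ Fin 3) (Fin 3 ⊕ Fin 3) F) =
      fromBlocks (planeRotation (-alpha) beta ^ n) 0 0 (planeRotation (-alpha) beta ^ n) :=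
    fun n => by rw [Units.val_pow_eq_pow_val, hx, fromBlocks_diagonal_self_pow]
  have hordx : orderOf (u2 * u3) = Fintype.card F + 1 := by
    rw [← hR]
    refine orderOf_eq_orderOf_iff.2 fun n => ?_
    rw [Units.ext_iff, hxpow, Units.val_one, ← fromBlocks_one, fromBlocks_inj]
    simp
  have hdiag : diagonal ![(-1 : F), 1, -1] = !![-1, 0, 0; 0, 1, 0; 0, 0, -1] := by
    ext i j
    fin_cases i <;> fin_cases j <;> simp
  have hd2 : diagonal ![(-1 : F), 1, -1] * diagonal ![(-1 : F), 1, -1] = 1 := by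
    rw [hdiag]
    ext i j
    fin_cases i <;> fin_cases j <;> simp [Matrix.mul_apply, Fin.sum_univ_three]
  have hu3t : !![alpha, beta, 0; beta, -alpha, 0; 0, 0, -1]ᵀ =
      !![alpha, beta, 0; beta, -alpha, 0; 0, 0, -1] := by
    ext i j
    fin_cases i <;> fin_cases j <;> simp
  have hd3 : !![alpha, beta, 0; beta, -alpha, 0; 0, 0, -1] *
      !![alpha, beta, 0; beta, -alpha, 0; 0, 0, -1] = 1 := by
    ext i j
    fin_cases i <;> fin_cases j <;> simp [Matrix.mul_apply, Fin.sum_univ_three] <;>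
      first | linear_combination hnorm | ring
  have hs2 : u2 * u2 = 1 := by
    apply Units.ext
    rw [Units.val_mul, hu2, fromBlocks_multiply]
    simp only [hd2, mul_zero, zero_mul, add_zero, zero_add, fromBlocks_one, Units.val_one]
  have hs3 : u3 * u3 = 1 := by
    apply Units.ext
    rw [Units.val_mul, hu3, fromBlocks_multiply]
    simp only [hd3, mul_zero, zero_mul, add_zero, zero_add, fromBlocks_one, Units.val_one]
  have hru' : (ru : Matrix (Fin 3 ⊕ Fin 3) (Fin 3 ⊕ Fin 3) F) =
      fromBlocks 0 (diagonal ![rho, rho, (rho ^ 2)⁻¹])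
        (diagonal ![rho⁻¹, rho⁻¹, ((rho ^ 2)⁻¹)⁻¹]) 0 := by rw [hru, inv_inv]
  have hu2mem := mem_centralizer_of_eq_fromBlocks (g := u2) htu hru' (a := -1) (b := 0) (c := 0)
    (d := 1) (e := -1) (by simp [det_fin_three])
    (by rw [← hdiag, diagonal_transpose, hd2]) (by rw [hu2, hdiag])
  have hu3mem := mem_centralizer_of_eq_fromBlocks (g := u3) htu hru' (a := alpha) (b := beta)
    (c := beta) (d := -alpha) (e := -1)
    (by simp [det_fin_three]; linear_combination hnorm) (by rw [hu3t, hd3]) hu3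
  refine ⟨le_antisymm ?_ ?_, nonempty_closure_pair_mulEquiv_dihedralGroup hs2 hs3 hordx ?_⟩
  · rintro g ⟨⟨hgG, hgt⟩, -, hgr⟩
    have hrho1 : rho ≠ 1 := fun h => hrho2 (by rw [h, one_pow])
    obtain ⟨A, hA, hAA, hcomm, hg⟩ := exists_eq_fromBlocks_of_mem_centralizer hrho0 hrho2
      (fun h => hrho1 (by field_simp at h; exact h.symm)) (inv_ne_zero (pow_ne_zero 2 hrho0))
      htu hru' (hG ▸ hgG) hgt hgr
    have hmem2 : u2 ∈ Subgroup.closure {u2, u3} := Subgroup.subset_closure (by simp)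
    have hmem3 : u3 ∈ Subgroup.closure {u2, u3} := Subgroup.subset_closure (by simp)
    have hxmem : u2 * u3 ∈ Subgroup.closure {u2, u3} := mul_mem hmem2 hmem3
    obtain ⟨a, b, hab, h⟩ := exists_eq_planeRotation hA hAA (fun h => hrho3 (by
      field_simp at h
      linear_combination h)) hcomm
    obtain ⟨n, hn⟩ := hpow a b hab
    rcases h with h | h
    · have : g = (u2 * u3) ^ n := Units.ext (by rw [hxpow, hg, h, hn])
      exact this ▸ pow_mem hxmem n
    · have h' : u2 * g = (u2 * u3) ^ n := by
        apply Units.ext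
        rw [hxpow, Units.val_mul, hu2, hg, fromBlocks_multiply]
        simp [h, hn]
      have : g = u2 * (u2 * u3) ^ n := by rw [← h', ← mul_assoc, hs2, one_mul]
      exact this ▸ mul_mem hmem2 (pow_mem hxmem n)
  · rw [Subgroup.closure_le]
    rintro g (rfl | rfl) <;> rw [hG]
    · exact ⟨⟨hu2mem.1, hu2mem.2.1⟩, hu2mem.1, hu2mem.2.2⟩
    · exact ⟨⟨hu3mem.1, hu3mem.2.1⟩, hu3mem.1, hu3mem.2.2⟩
  · intro hmem
    rw [← mem_powers_iff_mem_zpowers] at hmem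
    obtain ⟨n, hn⟩ := hmem
    obtain ⟨c, d, hcd, -⟩ := exists_planeRotation_pow hι (-alpha) beta n
    have e := congrArg Units.val hn
    simp only [hxpow, hu2, hcd, fromBlocks_inj] at e
    have e22 := congrFun (congrFun e.1 2) 2
    simp [planeRotation] at e22
    exact h2 (by linear_combination e22)
end

section
/- Under the full Section-3 setup (including hypothesis (iii)), let Z = ⟨diag(ρ², ρ², ρ², ρ⁻², ρ⁻², ρ⁻²)⟩, a normal subgroup of G of order 3 (the centre of H), and write ḡ for the image of g in Ḡ = G/Z. Then the images t̄₁, t̄₂, t̄₃, t̄₄ are four distinct involutions, but the intersection property fails for them: ⟨t̄₁, t̄₂, t̄₃⟩ ∩ ⟨t̄₂, t̄₃, t̄₄⟩ strictly contains ⟨t̄₂, t̄₃⟩. In particular {t̄₁, t̄₂, t̄₃, t̄₄} is not a C-string for Ḡ. -/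
open Matrix

/-- The block-diagonal matrix with two copies of the plane rotation by `(c, s)`, extended by `1`. -/
def rotBlock {F : Type*} [CommRing F] (c s : F) : Matrix (Fin 3 ⊕ Fin 3) (Fin 3 ⊕ Fin 3) F :=
  fromBlocks !![c, -s, 0; s, c, 0; 0, 0, 1] 0 0 !![c, -s, 0; s, c, 0; 0, 0, 1]

lemma rotBlock_mul {F : Type*} [CommRing F] (c s c' s' : F) :
    rotBlock c s * rotBlock c' s' = rotBlock (c * c' - s * s') (s * c' + c * s') := by
  have h : !![c, -s, 0; s, c, 0; 0, 0, 1] * !![c', -s', 0; s', c', 0; 0, 0, 1] =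
      !![c * c' - s * s', -(s * c' + c * s'), 0; s * c' + c * s', c * c' - s * s', 0; 0, 0, 1] := by
    ext i j
    fin_cases i <;> fin_cases j <;> simp [Matrix.mul_apply, Fin.sum_univ_three] <;> ring
  simp [rotBlock, fromBlocks_multiply, h]

lemma rotBlock_one_zero {F : Type*} [CommRing F] : rotBlock (1 : F) 0 = 1 := by
  have h : !![(1 : F), -0, 0; 0, 1, 0; 0, 0, 1] = 1 := by
    ext i j
    fin_cases i <;> fin_cases j <;> simp
  rw [rotBlock, h, fromBlocks_one]

/-- If the eigenvalue `c₀ + i s₀` has order `q + 1`, the powers of the rotation by `(c₀, s₀)`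
exhaust the rotations over `F`. -/
lemma exists_pow_eq_rotBlock {F K : Type*} [Field F] [Fintype F] [Field K] [Finite K] [Algebra F K]
    (h2 : (2 : F) ≠ 0) {i : K} (hi : i ^ 2 = -1) {c₀ s₀ : F}
    (hord : orderOf (algebraMap F K c₀ + i * algebraMap F K s₀) = Fintype.card F + 1)
    {g : GL (Fin 3 ⊕ Fin 3) F}
    (hg : (g : Matrix (Fin 3 ⊕ Fin 3) (Fin 3 ⊕ Fin 3) F) = rotBlock c₀ s₀)
    {c s : F} (hcs : c ^ 2 + s ^ 2 = 1) :
    ∃ k : ℕ, ((g ^ k : GL (Fin 3 ⊕ Fin 3) F) : Matrix (Fin 3 ⊕ Fin 3) (Fin 3 ⊕ Fin 3) F) =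
      rotBlock c s := by
  have hcard := Fintype.one_lt_card (α := F)
  have h2K : (2 : K) ≠ 0 := by
    rw [← map_ofNat (algebraMap F K) 2]
    exact (map_ne_zero _).2 h2
  set φ := FiniteField.frobeniusAlgHom F K with hφ
  have hφa : ∀ x : K, φ x = x ^ Fintype.card F := fun x => rfl
  have hi0 : i ≠ 0 := by
    rintro rfl
    simp at hi
  have hφi : φ i = -i := by
    have h : φ i ^ 2 = i ^ 2 := by rw [← map_pow, hi, map_neg, map_one]
    rcases sq_eq_sq_iff_eq_or_eq_neg.1 h with h | h
    · exfalso
      set w := algebraMap F K c₀ + i * algebraMap F K s₀ with hw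
      have hw0 : w ≠ 0 := by
        intro h0
        rw [h0] at hord
        simp at hord
      have h1 : φ w = w := by simp [hw, h]
      rw [hφa] at h1
      have h3 : w ^ (Fintype.card F - 1) = 1 := by
        apply mul_right_cancel₀ hw0
        rw [← pow_succ, Nat.sub_add_cancel hcard.le, h1, one_mul]
      have := Nat.le_of_dvd (by omega) (orderOf_dvd_of_pow_eq_one h3)
      omega
    · exact h
  have hpow : ∀ k : ℕ, ∃ c' s' : F,
      ((g ^ k : GL (Fin 3 ⊕ Fin 3) F) : Matrix (Fin 3 ⊕ Fin 3) (Fin 3 ⊕ Fin 3) F) =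
        rotBlock c' s' ∧
      (algebraMap F K c₀ + i * algebraMap F K s₀) ^ k =
        algebraMap F K c' + i * algebraMap F K s' := by
    intro k
    induction k with
    | zero => exact ⟨1, 0, by simp [rotBlock_one_zero], by simp⟩
    | succ k ih =>
      obtain ⟨c', s', h, h'⟩ := ih
      refine ⟨c' * c₀ - s' * s₀, s' * c₀ + c' * s₀, ?_, ?_⟩
      · rw [pow_succ, Units.val_mul, h, hg, rotBlock_mul]
      · rw [pow_succ, h']
        simp only [map_sub, map_add, map_mul]
        linear_combination algebraMap F K s' * algebraMap F K s₀ * hi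
  have hroot : (algebraMap F K c + i * algebraMap F K s) ^ (Fintype.card F + 1) = 1 := by
    rw [pow_succ, ← hφa, map_add, map_mul, hφi, AlgHom.commutes, AlgHom.commutes]
    have := congrArg (algebraMap F K) hcs
    simp only [map_add, map_pow, map_one] at this
    linear_combination this - algebraMap F K s ^ 2 * hi
  have hprim := IsPrimitiveRoot.orderOf (algebraMap F K c₀ + i * algebraMap F K s₀)
  rw [hord] at hprim
  obtain ⟨k, -, hk⟩ := hprim.eq_pow_of_pow_eq_one hroot
  obtain ⟨c', s', h, h'⟩ := hpow k
  rw [hk] at h'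
  have h'' := congrArg φ h'
  simp only [map_add, map_mul, hφi, AlgHom.commutes] at h''
  have hc : c = c' := by
    apply (algebraMap F K).injective
    apply mul_left_cancel₀ h2K
    linear_combination h' + h''
  have hs : s = s' := by
    apply (algebraMap F K).injective
    apply mul_left_cancel₀ (mul_ne_zero h2K hi0)
    linear_combination h' - h''
  exact ⟨k, by rw [h, hc, hs]⟩

/-- If `b` is an involution commuting with `a` and `a * b` is unipotent, then `b` is a power
of `a`. -/
lemma pow_char_eq_of_commute {F n : Type*} [Field F] [Fintype n] [DecidableEq n]
    (p : ℕ) [Fact p.Prime] [CharP F p] (hp : p ≠ 2) {a b : GL n F} (hab : Commute a b)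
    (hb : b * b = 1) (hN : ((a * b : GL n F) - 1 : Matrix n n F) ^ 3 = 0) : a ^ p = b := by
  have hp2 := (Fact.out : p.Prime).two_le
  have hodd : Odd p := (Fact.out : p.Prime).odd_of_ne_two hp
  rcases isEmpty_or_nonempty n with hn | hn
  · exact Units.ext (Subsingleton.elim _ _)
  have h1 : ((a * b : GL n F) - 1 : Matrix n n F) ^ p = 0 := pow_eq_zero_of_le (by omega) hN
  rw [sub_pow_char_of_commute p (Commute.one_right _), one_pow, sub_eq_zero] at h1
  have h2 : (a * b) ^ p = 1 := Units.ext (by simpa using h1)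
  rw [hab.mul_pow] at h2
  obtain ⟨m, hm⟩ := hodd
  have h3 : b ^ p = b := by rw [hm, pow_succ, pow_mul, sq, hb, one_pow, one_mul]
  rw [h3] at h2
  rw [eq_inv_of_mul_eq_one_left h2, inv_eq_of_mul_eq_one_left hb]

/-- Elements of the extension of `SL₃` by the block swap have blocks of determinant one. -/
lemma exists_blocks_of_mem_closure {F : Type*} [Field F] {tu : GL (Fin 3 ⊕ Fin 3) F}
    (htu : (tu : Matrix (Fin 3 ⊕ Fin 3) (Fin 3 ⊕ Fin 3) F) = fromBlocks 0 1 1 0)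
    {g : GL (Fin 3 ⊕ Fin 3) F}
    (hg : g ∈ Subgroup.closure
      ({g : GL (Fin 3 ⊕ Fin 3) F | ∃ A : Matrix (Fin 3) (Fin 3) F,
          A.det = 1 ∧ (g : Matrix (Fin 3 ⊕ Fin 3) (Fin 3 ⊕ Fin 3) F) =
            fromBlocks A 0 0 (Aᵀ)⁻¹} ∪ {tu})) :
    ∃ A B : Matrix (Fin 3) (Fin 3) F, A.det = 1 ∧ B.det = 1 ∧
      ((g : Matrix (Fin 3 ⊕ Fin 3) (Fin 3 ⊕ Fin 3) F) = fromBlocks A 0 0 B ∨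
       (g : Matrix (Fin 3 ⊕ Fin 3) (Fin 3 ⊕ Fin 3) F) = fromBlocks 0 A B 0) := by
  induction hg using Subgroup.closure_induction with
  | mem x hx =>
    rcases hx with ⟨A, hA, hx⟩ | rfl
    · exact ⟨A, (Aᵀ)⁻¹, hA, by simp [Matrix.det_nonsing_inv, hA], .inl hx⟩
    · exact ⟨1, 1, by simp, by simp, .inr htu⟩
  | one => exact ⟨1, 1, by simp, by simp, .inl (by simp)⟩
  | mul x y _ _ hx hy =>
    obtain ⟨A, B, hA, hB, hx⟩ := hx
    obtain ⟨A', B', hA', hB', hy⟩ := hy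
    rcases hx with hx | hx <;> rcases hy with hy | hy
    · exact ⟨A * A', B * B', by simp [hA, hA'], by simp [hB, hB'],
        .inl (by simp [hx, hy, fromBlocks_multiply])⟩
    · exact ⟨A * A', B * B', by simp [hA, hA'], by simp [hB, hB'],
        .inr (by simp [hx, hy, fromBlocks_multiply])⟩
    · exact ⟨A * B', B * A', by simp [hA, hB'], by simp [hB, hA'],
        .inr (by simp [hx, hy, fromBlocks_multiply])⟩
    · exact ⟨A * B', B * A', by simp [hA, hB'], by simp [hB, hA'],
        .inl (by simp [hx, hy, fromBlocks_multiply])⟩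
  | inv x _ hx =>
    obtain ⟨A, B, hA, hB, hx⟩ := hx
    have hA' : A * A⁻¹ = 1 := Matrix.mul_nonsing_inv _ (by simp [hA])
    have hB' : B * B⁻¹ = 1 := Matrix.mul_nonsing_inv _ (by simp [hB])
    rcases hx with hx | hx
    · exact ⟨A⁻¹, B⁻¹, by simp [Matrix.det_nonsing_inv, hA], by simp [Matrix.det_nonsing_inv, hB],
        .inl (Units.inv_eq_of_mul_eq_one_right (by
          simp [hx, fromBlocks_multiply, hA', hB']))⟩
    · exact ⟨B⁻¹, A⁻¹, by simp [Matrix.det_nonsing_inv, hB], by simp [Matrix.det_nonsing_inv, hA],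
        .inr (Units.inv_eq_of_mul_eq_one_right (by
          simp [hx, fromBlocks_multiply, hA', hB']))⟩

lemma axis_sq {F : Type*} [Field F] {lam mu : F} (hmu : 2 * mu ^ 2 - lam ^ 2 = 0)
    (hlam : 2 * lam ^ 2 = 1) :
    !![mu, lam, mu; lam, 0, -lam; mu, -lam, mu] * !![mu, lam, mu; lam, 0, -lam; mu, -lam, mu] =
      1 := by
  have h2 : (2 : F) ≠ 0 := by
    intro h
    simp [h] at hlam
  ext i j
  fin_cases i <;> fin_cases j <;> simp [Matrix.mul_apply, Fin.sum_univ_three] <;> grind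

lemma planar_reflection_sq {F : Type*} [CommRing F] {a b : F} (h : a ^ 2 + b ^ 2 = 1) :
    !![a, b, 0; b, -a, 0; 0, 0, -1] * !![a, b, 0; b, -a, 0; 0, 0, -1] = 1 := by
  ext i j
  fin_cases i <;> fin_cases j <;> simp [Matrix.mul_apply, Fin.sum_univ_three] <;> grind

lemma twisting_mul_dual {F : Type*} [Field F] {rho xi eta : F}
    (hrho : rho ^ 2 = rho - 1) (hxi : 2 * xi = rho) (heta : 2 * eta = 2 - rho) :
    !![xi, 0, eta; 0, -rho, 0; eta, 0, xi] *
      !![xi * -rho, 0, eta * rho; 0, -rho * -rho, 0; eta * rho, 0, xi * -rho] = 1 := by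
  ext i j
  fin_cases i <;> fin_cases j <;> simp [Matrix.mul_apply, Fin.sum_univ_three] <;> grind

lemma rotation_unipotent {F : Type*} [Field F] {rho lam mu c s : F}
    (hrho : rho ^ 2 = rho - 1) (hlam : 2 * lam ^ 2 = 1) (hmu : 2 * mu = -1)
    (hc : c = -7) (hs : s = 8 * rho - 4) :
    (!![mu, lam, mu; lam, 0, -lam; mu, -lam, mu] * !![c, -s, 0; s, c, 0; 0, 0, 1] - 1) ^ 3 = 0 := by
  subst hc hs
  ext i j
  fin_cases i <;> fin_cases j <;>
    simp [pow_succ, Matrix.mul_apply, Fin.sum_univ_three, Matrix.one_apply] <;> grind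

lemma twisted_unipotent {F : Type*} [Field F] {rho xi eta c s : F}
    (hrho : rho ^ 2 = rho - 1) (hxi : 2 * xi = rho) (heta : 2 * eta = 2 - rho)
    (hc : c = -7) (hs : s = 4 - 8 * rho) :
    (diagonal ![rho ^ 2, rho ^ 2, rho ^ 2] * !![xi, 0, eta; 0, -rho, 0; eta, 0, xi] *
      !![c, -s, 0; s, c, 0; 0, 0, 1] * !![-1, -0, 0; 0, -1, 0; 0, 0, 1] - 1) ^ 3 = 0 := by
  subst hc hs
  ext i j
  fin_cases i <;> fin_cases j <;>
    simp [pow_succ, Matrix.mul_apply, Fin.sum_univ_three, Matrix.one_apply] <;> grind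

lemma twisted_unipotent_dual {F : Type*} [Field F] {rho xi eta c s : F}
    (hrho : rho ^ 2 = rho - 1) (hxi : 2 * xi = rho) (heta : 2 * eta = 2 - rho)
    (hc : c = -7) (hs : s = 4 - 8 * rho) :
    (diagonal ![-rho, -rho, -rho] *
      !![xi * -rho, 0, eta * rho; 0, -rho * -rho, 0; eta * rho, 0, xi * -rho] *
      !![c, -s, 0; s, c, 0; 0, 0, 1] * !![-1, -0, 0; 0, -1, 0; 0, 0, 1] - 1) ^ 3 = 0 := by
  subst hc hs
  ext i j
  fin_cases i <;> fin_cases j <;>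
    simp [pow_succ, Matrix.mul_apply, Fin.sum_univ_three, Matrix.one_apply] <;> grind

lemma fromBlocks_sub_one_cube {F : Type*} [Field F] {A B : Matrix (Fin 3) (Fin 3) F}
    (hA : (A - 1) ^ 3 = 0) (hB : (B - 1) ^ 3 = 0) :
    (fromBlocks A 0 0 B - 1 : Matrix (Fin 3 ⊕ Fin 3) (Fin 3 ⊕ Fin 3) F) ^ 3 = 0 := by
  rw [← fromBlocks_one, sub_eq_add_neg, fromBlocks_neg, fromBlocks_add]
  rw [pow_succ, pow_two] at *
  simp [fromBlocks_multiply, ← sub_eq_add_neg, hA, hB]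

/-- The block swap lies in the group generated by the first three involutions. -/
lemma swap_eq_pow {F : Type*} [Field F] {p : ℕ} [Fact p.Prime] [CharP F p] {rho lam mu : F}
    (hp : p ≠ 2) (hrho : rho ^ 2 = rho - 1) (hlam : 2 * lam ^ 2 = 1)
    (hmu : 2 * mu = -1) {u r tu : GL (Fin 3 ⊕ Fin 3) F}
    (hu : (u : Matrix (Fin 3 ⊕ Fin 3) (Fin 3 ⊕ Fin 3) F) =
      fromBlocks 0 !![mu, lam, mu; lam, 0, -lam; mu, -lam, mu]
        !![mu, lam, mu; lam, 0, -lam; mu, -lam, mu] 0)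
    (hr : (r : Matrix (Fin 3 ⊕ Fin 3) (Fin 3 ⊕ Fin 3) F) = rotBlock (-7) (8 * rho - 4))
    (htu : (tu : Matrix (Fin 3 ⊕ Fin 3) (Fin 3 ⊕ Fin 3) F) = fromBlocks 0 1 1 0) :
    (u * r) ^ p = tu := by
  apply pow_char_eq_of_commute p hp
  · ext1
    simp [hu, hr, htu, rotBlock, fromBlocks_multiply, -cons_mul]
  · ext1
    simp [htu, fromBlocks_multiply]
  · have h := rotation_unipotent hrho hlam hmu rfl rfl
    have hm : ((u * r * tu : GL (Fin 3 ⊕ Fin 3) F) : Matrix (Fin 3 ⊕ Fin 3) (Fin 3 ⊕ Fin 3) F) =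
        fromBlocks (!![mu, lam, mu; lam, 0, -lam; mu, -lam, mu] *
          !![-7, -(8 * rho - 4), 0; 8 * rho - 4, -7, 0; 0, 0, 1]) 0 0
          (!![mu, lam, mu; lam, 0, -lam; mu, -lam, mu] *
          !![-7, -(8 * rho - 4), 0; 8 * rho - 4, -7, 0; 0, 0, 1]) := by
      simp [hu, hr, htu, rotBlock, fromBlocks_multiply, -cons_mul]
    rw [hm]
    exact fromBlocks_sub_one_cube h h

/-- Up to a central element and a half turn, the block swap is a power of a rotation times the
fourth involution. -/
lemma twisted_swap_eq_pow {F : Type*} [Field F] {p : ℕ} [Fact p.Prime] [CharP F p]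
    {rho xi eta : F} (hp : p ≠ 2) (hrho : rho ^ 2 = rho - 1)
    (hxi : 2 * xi = rho) (heta : 2 * eta = 2 - rho) {z u r h tu : GL (Fin 3 ⊕ Fin 3) F}
    (hz : (z : Matrix (Fin 3 ⊕ Fin 3) (Fin 3 ⊕ Fin 3) F) =
      fromBlocks (diagonal ![rho ^ 2, rho ^ 2, rho ^ 2]) 0 0 (diagonal ![-rho, -rho, -rho]))
    (hu : (u : Matrix (Fin 3 ⊕ Fin 3) (Fin 3 ⊕ Fin 3) F) =
      fromBlocks 0 !![xi, 0, eta; 0, -rho, 0; eta, 0, xi]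
        !![xi * -rho, 0, eta * rho; 0, -rho * -rho, 0; eta * rho, 0, xi * -rho] 0)
    (hr : (r : Matrix (Fin 3 ⊕ Fin 3) (Fin 3 ⊕ Fin 3) F) = rotBlock (-7) (4 - 8 * rho))
    (hh : (h : Matrix (Fin 3 ⊕ Fin 3) (Fin 3 ⊕ Fin 3) F) = rotBlock (-1) 0)
    (htu : (tu : Matrix (Fin 3 ⊕ Fin 3) (Fin 3 ⊕ Fin 3) F) = fromBlocks 0 1 1 0) :
    (z * u * r) ^ p = h * tu := by
  have hm : ((z * u * r * (h * tu) : GL (Fin 3 ⊕ Fin 3) F) :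
      Matrix (Fin 3 ⊕ Fin 3) (Fin 3 ⊕ Fin 3) F) =
      fromBlocks (diagonal ![rho ^ 2, rho ^ 2, rho ^ 2] * !![xi, 0, eta; 0, -rho, 0; eta, 0, xi] *
      !![-7, -(4 - 8 * rho), 0; (4 - 8 * rho), -7, 0; 0, 0, 1] *
        !![-1, -0, 0; 0, -1, 0; 0, 0, 1]) 0 0
      (diagonal ![-rho, -rho, -rho] *
      !![xi * -rho, 0, eta * rho; 0, -rho * -rho, 0; eta * rho, 0, xi * -rho] *
      !![-7, -(4 - 8 * rho), 0; (4 - 8 * rho), -7, 0; 0, 0, 1] *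
        !![-1, -0, 0; 0, -1, 0; 0, 0, 1]) := by
    simp only [Units.val_mul, hz, hu, hr, hh, htu, rotBlock, fromBlocks_multiply, mul_zero,
      zero_mul, add_zero, zero_add, mul_one]
  apply pow_char_eq_of_commute p hp
  · ext1
    rw [hm]
    simp only [Units.val_mul, hz, hu, hr, hh, htu, rotBlock, fromBlocks_multiply, mul_zero,
      zero_mul, add_zero, zero_add, mul_one]
    congr 1 <;> ext i j <;> fin_cases i <;> fin_cases j <;>
      simp [Matrix.mul_apply, Fin.sum_univ_three] <;> grind
  · have hF : !![(-1 : F), -0, 0; 0, -1, 0; 0, 0, 1] * !![(-1 : F), -0, 0; 0, -1, 0; 0, 0, 1] =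
        1 := by
      ext i j
      fin_cases i <;> fin_cases j <;> simp [Matrix.mul_apply, Fin.sum_univ_three]
    ext1
    simp only [Units.val_mul, Units.val_one, hh, htu, rotBlock, fromBlocks_multiply, mul_zero,
      zero_mul, add_zero, zero_add, mul_one, hF, fromBlocks_one]
  · rw [hm]
    exact fromBlocks_sub_one_cube (twisted_unipotent hrho hxi heta rfl rfl)
      (twisted_unipotent_dual hrho hxi heta rfl rfl)

lemma eq_of_eq_mul_scalar {F : Type*} [Field F] {rho lam mu beta : F} (h2 : (2 : F) ≠ 0)
    (hrho : rho ≠ 0) (hbeta : beta ≠ 0) (alpha xi eta : F)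
    (D : Matrix (Fin 3) (Fin 3) F) {v : Fin 4 → Matrix (Fin 3 ⊕ Fin 3) (Fin 3 ⊕ Fin 3) F}
    (h0 : v 0 = fromBlocks 0 !![mu, lam, mu; lam, 0, -lam; mu, -lam, mu]
      !![mu, lam, mu; lam, 0, -lam; mu, -lam, mu] 0)
    (h1 : v 1 = fromBlocks (diagonal ![(-1 : F), 1, -1]) 0 0 (diagonal ![(-1 : F), 1, -1]))
    (h2' : v 2 = fromBlocks !![alpha, beta, 0; beta, -alpha, 0; 0, 0, -1] 0 0
      !![alpha, beta, 0; beta, -alpha, 0; 0, 0, -1])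
    (h3 : v 3 = fromBlocks 0 !![xi, 0, eta; 0, -rho, 0; eta, 0, xi] D 0)
    {a b : F} (ha : a ≠ 0) (hb : b ≠ 0) :
    (∀ i j, v j = v i * fromBlocks (diagonal fun _ => a) 0 0 (diagonal fun _ => b) → i = j) ∧
    ∀ i, v i ≠ fromBlocks (diagonal fun _ => a) 0 0 (diagonal fun _ => b) := by
  have hneg : (-1 : F) ≠ 1 := fun h => h2 (by linear_combination -h)
  constructor
  · intro i j hab
    by_contra hij
    have e01 := congrFun₂ hab (Sum.inl 0) (Sum.inl 1)
    have e22 := congrFun₂ hab (Sum.inl 2) (Sum.inl 2)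
    have f11 := congrFun₂ hab (Sum.inl 1) (Sum.inr 1)
    have f01 := congrFun₂ hab (Sum.inl 0) (Sum.inr 1)
    clear hab
    fin_cases i <;> fin_cases j <;>
      simp_all [fromBlocks_multiply, -fromBlocks_diagonal]
  · intro i hab
    have e00 := congrFun₂ hab (Sum.inl 0) (Sum.inl 0)
    have e11 := congrFun₂ hab (Sum.inl 1) (Sum.inl 1)
    have e01 := congrFun₂ hab (Sum.inl 0) (Sum.inl 1)
    clear hab
    fin_cases i <;> simp_all [-fromBlocks_diagonal]

/-- If every element of `S` commutes with `W` under `f`, then every element of the subgroup of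
`G ⧸ N` generated by the image of `S` has a representative commuting with `W`. -/
lemma exists_commute_rep {G M : Type*} [Group G] [Monoid M] (f : G →* M) (N : Subgroup G)
    [N.Normal] (W : M) {S : Set G} (hS : ∀ g ∈ S, Commute (f g) W) {x : G ⧸ N}
    (hx : x ∈ Subgroup.closure ((QuotientGroup.mk : G → G ⧸ N) '' S)) :
    ∃ g : G, (QuotientGroup.mk g : G ⧸ N) = x ∧ Commute (f g) W := by
  induction hx using Subgroup.closure_induction with
  | mem x hx =>
    obtain ⟨g, hg, rfl⟩ := hx
    exact ⟨g, rfl, hS g hg⟩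
  | one => exact ⟨1, rfl, by simp⟩
  | mul x y _ _ hx hy =>
    obtain ⟨g, rfl, hg⟩ := hx
    obtain ⟨g', rfl, hg'⟩ := hy
    exact ⟨g * g', rfl, by rw [map_mul]; exact hg.mul_left hg'⟩
  | inv x _ hx =>
    obtain ⟨g, rfl, hg⟩ := hx
    refine ⟨g⁻¹, rfl, ?_⟩
    have := Commute.units_inv_left (u := f.toHomUnits g) (a := W) hg
    rwa [← map_inv] at this

theorem stmt_13 (q : ℕ) (F : Type) [Field F] [Fintype F]
    (hF : Fintype.card F = q) (h6 : 6 ∣ q - 1)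
    (K : Type) [Field K] [Fintype K] [Algebra F K] (hK : Fintype.card K = q ^ 2)
    (rho lam mu alpha beta xi eta tau : F)
    (hrho : orderOf rho = 6)
    (hlam : 2 * lam ^ 2 = 1) (hmu : 2 * mu ^ 2 - lam ^ 2 = 0)
    (halpha : alpha = ((mu ^ 2)⁻¹ - 1)⁻¹)
    (hbeta : beta = 2 * alpha * lam * mu⁻¹)
    (hxi : xi = rho ^ 2 + (1 - rho ^ 2) * 2⁻¹)
    (heta : eta = (1 - rho ^ 2) * 2⁻¹)
    (htau : tau = rho ^ 4)
    (hiii : ∃ theta : K, theta ^ 2 = algebraMap F K ((3 : F)⁻¹ ^ 2 - 1) ∧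
      (orderOf (-(algebraMap F K (3 : F)⁻¹) + theta) = q + 1 ∨
       orderOf (-(algebraMap F K (3 : F)⁻¹) - theta) = q + 1))
    (u1 u2 u3 u4 tu : GL (Fin 3 ⊕ Fin 3) F)
    (hu1 : (u1 : Matrix (Fin 3 ⊕ Fin 3) (Fin 3 ⊕ Fin 3) F) =
      fromBlocks 0 !![mu, lam, mu; lam, 0, -lam; mu, -lam, mu]
        !![mu, lam, mu; lam, 0, -lam; mu, -lam, mu] 0)
    (hu2 : (u2 : Matrix (Fin 3 ⊕ Fin 3) (Fin 3 ⊕ Fin 3) F) =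
      fromBlocks (diagonal ![(-1 : F), 1, -1]) 0 0 (diagonal ![(-1 : F), 1, -1]))
    (hu3 : (u3 : Matrix (Fin 3 ⊕ Fin 3) (Fin 3 ⊕ Fin 3) F) =
      fromBlocks !![alpha, beta, 0; beta, -alpha, 0; 0, 0, -1] 0 0
        !![alpha, beta, 0; beta, -alpha, 0; 0, 0, -1])
    (hu4 : (u4 : Matrix (Fin 3 ⊕ Fin 3) (Fin 3 ⊕ Fin 3) F) =
      fromBlocks 0 !![xi, 0, eta; 0, tau, 0; eta, 0, xi]
        !![xi * (rho ^ 2)⁻¹, 0, eta * rho; 0, tau * (rho ^ 2)⁻¹, 0; eta * rho, 0, xi * (rho ^ 2)⁻¹] 0)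
    (htu : (tu : Matrix (Fin 3 ⊕ Fin 3) (Fin 3 ⊕ Fin 3) F) = fromBlocks 0 1 1 0)
    (G : Subgroup (GL (Fin 3 ⊕ Fin 3) F))
    (hG : G = Subgroup.closure
      ({g : GL (Fin 3 ⊕ Fin 3) F | ∃ A : Matrix (Fin 3) (Fin 3) F,
          A.det = 1 ∧ (g : Matrix (Fin 3 ⊕ Fin 3) (Fin 3 ⊕ Fin 3) F) =
            fromBlocks A 0 0 (Aᵀ)⁻¹} ∪ {tu}))
    (zu : GL (Fin 3 ⊕ Fin 3) F)
    (hzu : (zu : Matrix (Fin 3 ⊕ Fin 3) (Fin 3 ⊕ Fin 3) F) =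
      fromBlocks (diagonal ![rho ^ 2, rho ^ 2, rho ^ 2]) 0 0
        (diagonal ![(rho ^ 2)⁻¹, (rho ^ 2)⁻¹, (rho ^ 2)⁻¹]))
    (h1 : u1 ∈ G) (h2 : u2 ∈ G) (h3 : u3 ∈ G) (h4 : u4 ∈ G) (hz : zu ∈ G)
    (N : Subgroup ↥G) (hN : N = Subgroup.closure {(⟨zu, hz⟩ : ↥G)}) [hNn : N.Normal] :
    Nat.card N = 3 ∧ N.Normal ∧
    Function.Injective (fun i : Fin 4 =>
      (QuotientGroup.mk (![(⟨u1, h1⟩ : ↥G), ⟨u2, h2⟩, ⟨u3, h3⟩, ⟨u4, h4⟩] i) : ↥G ⧸ N)) ∧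
    (∀ i : Fin 4,
      orderOf (QuotientGroup.mk (![(⟨u1, h1⟩ : ↥G), ⟨u2, h2⟩, ⟨u3, h3⟩, ⟨u4, h4⟩] i) : ↥G ⧸ N)
        = 2) ∧
    Subgroup.closure {(QuotientGroup.mk (⟨u2, h2⟩ : ↥G) : ↥G ⧸ N),
        QuotientGroup.mk (⟨u3, h3⟩ : ↥G)} <
      Subgroup.closure {(QuotientGroup.mk (⟨u1, h1⟩ : ↥G) : ↥G ⧸ N),
          QuotientGroup.mk (⟨u2, h2⟩ : ↥G), QuotientGroup.mk (⟨u3, h3⟩ : ↥G)} ⊓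
        Subgroup.closure {(QuotientGroup.mk (⟨u2, h2⟩ : ↥G) : ↥G ⧸ N),
          QuotientGroup.mk (⟨u3, h3⟩ : ↥G), QuotientGroup.mk (⟨u4, h4⟩ : ↥G)} ∧
    ¬ IsCString (fun i : Fin 4 =>
      (QuotientGroup.mk (![(⟨u1, h1⟩ : ↥G), ⟨u2, h2⟩, ⟨u3, h3⟩, ⟨u4, h4⟩] i) : ↥G ⧸ N)) := by
  subst hF
  have hr6 : rho ^ 6 = 1 := hrho ▸ pow_orderOf_eq_one rho
  have hr3 : rho ^ 3 ≠ 1 := fun h => by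
    have := orderOf_dvd_of_pow_eq_one h
    rw [hrho] at this
    omega
  have hr2 : rho ^ 2 ≠ 1 := fun h => by
    have := orderOf_dvd_of_pow_eq_one h
    rw [hrho] at this
    omega
  have hr0 : rho ≠ 0 := by
    rintro rfl
    simp at hr6
  have two_ne : (2 : F) ≠ 0 := by
    intro h
    rw [h] at hlam
    simp at hlam
  have hrq : rho ^ 2 = rho - 1 := by
    have h : (rho ^ 3 - 1) * ((rho + 1) * (rho ^ 2 - rho + 1)) = 0 := by
      linear_combination hr6
    rcases mul_eq_zero.1 h with h | h
    · exact absurd (sub_eq_zero.1 h) hr3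
    rcases mul_eq_zero.1 h with h | h
    · exact absurd (by linear_combination (rho - 1) * h) hr2
    · linear_combination h
  have hri : (rho ^ 2)⁻¹ = -rho :=
    inv_eq_of_mul_eq_one_right (by linear_combination (-rho - 1) * hrq)
  have three_ne : (3 : F) ≠ 0 := by
    intro h
    have h' : (rho + 1) ^ 2 = 0 := by linear_combination hrq + rho * h
    exact hr2 (by linear_combination (rho - 1) * (pow_eq_zero_iff two_ne_zero).1 h')
  obtain ⟨p, hchar⟩ := CharP.exists F
  have hpp : Fact p.Prime := ⟨CharP.char_is_prime F p⟩
  have hp2 : p ≠ 2 := by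
    rintro rfl
    exact two_ne (by exact_mod_cast CharP.cast_eq_zero F 2)
  have hmu' : 2 * mu = -1 := by
    obtain ⟨A, B, hA, -, h | h⟩ := exists_blocks_of_mem_closure htu (hG ▸ h1)
    · have h' := congrArg toBlocks₁₁ (hu1.symm.trans h)
      simp only [toBlocks_fromBlocks₁₁] at h'
      simp [← h'] at hA
    · have h' := congrArg toBlocks₁₂ (hu1.symm.trans h)
      simp only [toBlocks_fromBlocks₁₂] at h'
      rw [← h', det_fin_three] at hA
      simp at hA
      linear_combination -hA - 2 * mu * hlam
  have hmui : mu⁻¹ = -2 := inv_eq_of_mul_eq_one_right (by linear_combination -hmu')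
  have ha : 3 * alpha = 1 := by
    have h : (mu ^ 2)⁻¹ - 1 = 3 := by
      rw [← inv_pow, hmui]
      norm_num
    rw [halpha, h, mul_inv_cancel₀ three_ne]
  have hb : 9 * beta ^ 2 = 8 := by
    rw [hbeta, hmui]
    linear_combination 16 * lam ^ 2 * (3 * alpha + 1) * ha + 8 * hlam
  have hb0 : beta ≠ 0 := by
    rintro rfl
    apply pow_ne_zero 3 two_ne
    linear_combination -hb
  have hxi' : 2 * xi = rho := by
    rw [hxi]
    field_simp
    linear_combination hrq
  have heta' : 2 * eta = 2 - rho := by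
    rw [heta]
    field_simp
    linear_combination -hrq
  have htau' : tau = -rho := by
    rw [htau]
    linear_combination (rho ^ 2 + rho) * hrq
  subst htau'
  rw [hri] at hu4 hzu
  have hrot : ∀ c s : F, c ^ 2 + s ^ 2 = 1 → ∃ k : ℕ,
      (((u2 * u3) ^ k : GL (Fin 3 ⊕ Fin 3) F) : Matrix (Fin 3 ⊕ Fin 3) (Fin 3 ⊕ Fin 3) F) =
        rotBlock c s := by
    have h23 : ((u2 * u3 : GL (Fin 3 ⊕ Fin 3) F) : Matrix (Fin 3 ⊕ Fin 3) (Fin 3 ⊕ Fin 3) F) =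
        rotBlock (-alpha) beta := by
      have h : diagonal ![(-1 : F), 1, -1] * !![alpha, beta, 0; beta, -alpha, 0; 0, 0, -1] =
          !![-alpha, -beta, 0; beta, -alpha, 0; 0, 0, 1] := by
        ext i j
        fin_cases i <;> fin_cases j <;> simp
      rw [Units.val_mul, hu2, hu3, fromBlocks_multiply, rotBlock]
      simp only [h, mul_zero, zero_mul, add_zero, zero_add]
    have ha' : (3 : F)⁻¹ = alpha := inv_eq_of_mul_eq_one_right ha
    obtain ⟨theta, hth, hord⟩ := hiii
    have hbK : algebraMap F K beta ≠ 0 := (map_ne_zero _).2 hb0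
    have hi : (theta / algebraMap F K beta) ^ 2 = -1 := by
      rw [div_pow, hth, ← map_pow, ← map_div₀]
      have : ((3 : F)⁻¹ ^ 2 - 1) / beta ^ 2 = -1 := by
        rw [div_eq_iff (pow_ne_zero 2 hb0)]
        field_simp
        linear_combination hb
      rw [this, map_neg, map_one]
    intro c s hcs
    rcases hord with hord | hord
    · refine exists_pow_eq_rotBlock two_ne hi ?_ h23 hcs
      rwa [div_mul_cancel₀ _ hbK, map_neg, ← ha', map_inv₀, ← map_inv₀]
    · refine exists_pow_eq_rotBlock (i := -(theta / algebraMap F K beta)) two_ne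
        (by rw [neg_sq, hi]) ?_ h23 hcs
      rwa [neg_mul, div_mul_cancel₀ _ hbK, map_neg, ← ha', map_inv₀, ← map_inv₀,
        ← sub_eq_add_neg]
  have htuG : tu ∈ G := hG ▸ Subgroup.subset_closure (Or.inr rfl)
  obtain ⟨k, hk⟩ := hrot (-7) (8 * rho - 4) (by linear_combination 64 * hrq)
  obtain ⟨l, hl⟩ := hrot (-7) (4 - 8 * rho) (by linear_combination 64 * hrq)
  obtain ⟨m, hm⟩ := hrot (-1) 0 (by ring)
  have hA := swap_eq_pow hp2 hrq hlam hmu' hu1 hk htu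
  have hB := twisted_swap_eq_pow hp2 hrq hxi' heta' hzu hu4 hl hm htu
  have hzpow : ∀ j : ℕ, ((zu ^ j : GL (Fin 3 ⊕ Fin 3) F) :
      Matrix (Fin 3 ⊕ Fin 3) (Fin 3 ⊕ Fin 3) F) =
      fromBlocks (diagonal fun _ => (rho ^ 2) ^ j) 0 0 (diagonal fun _ => (-rho) ^ j) := by
    intro j
    induction j with
    | zero => simp
    | succ j ih =>
      rw [pow_succ, Units.val_mul, ih, hzu, fromBlocks_multiply]
      congr 1
      all_goals
        ext a b
        fin_cases a <;> fin_cases b <;> simp [pow_succ]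
  have hz3 : zu ^ 3 = 1 := by
    ext1
    have e1 : (rho ^ 2) ^ 3 = 1 := by linear_combination hr6
    have e2 : (-rho) ^ 3 = 1 := by linear_combination (-rho - 1) * hrq
    rw [hzpow, e1, e2]
    simp
  have hz1 : zu ≠ 1 := by
    intro h
    have h' := congrFun₂ (hzu.symm.trans (congrArg Units.val h)) (Sum.inl 0) (Sum.inl 0)
    exact hr2 (by simpa using h')
  have hzo : orderOf (⟨zu, hz⟩ : ↥G) = 3 := by
    have : Fact (Nat.Prime 3) := ⟨Nat.prime_three⟩
    exact orderOf_eq_prime (Subtype.ext hz3) (fun h => hz1 (congrArg Subtype.val h))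
  have hNz : N = Subgroup.zpowers (⟨zu, hz⟩ : ↥G) := by
    rw [hN, Subgroup.zpowers_eq_closure]
  have hmkz : (QuotientGroup.mk (⟨zu, hz⟩ : ↥G) : ↥G ⧸ N) = 1 :=
    (QuotientGroup.eq_one_iff _).2 (hNz ▸ Subgroup.mem_zpowers _)
  have hsep : ∀ x y : ↥G, (QuotientGroup.mk x : ↥G ⧸ N) = QuotientGroup.mk y →
      ∃ a b : F, a ≠ 0 ∧ b ≠ 0 ∧
        ((y : GL (Fin 3 ⊕ Fin 3) F) : Matrix (Fin 3 ⊕ Fin 3) (Fin 3 ⊕ Fin 3) F) =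
        ((x : GL (Fin 3 ⊕ Fin 3) F) : Matrix (Fin 3 ⊕ Fin 3) (Fin 3 ⊕ Fin 3) F) *
          fromBlocks (diagonal fun _ => a) 0 0 (diagonal fun _ => b) := by
    intro x y hxy
    rw [QuotientGroup.eq, hNz, ← mem_powers_iff_mem_zpowers] at hxy
    obtain ⟨j, hj⟩ := hxy
    replace hj : (⟨zu, hz⟩ : ↥G) ^ j = x⁻¹ * y := hj
    refine ⟨(rho ^ 2) ^ j, (-rho) ^ j, pow_ne_zero _ (pow_ne_zero _ hr0),
      pow_ne_zero _ (neg_ne_zero.2 hr0), ?_⟩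
    have hy : y = x * (⟨zu, hz⟩ : ↥G) ^ j := by
      rw [hj, mul_inv_cancel_left]
    rw [hy, ← hzpow]
    rfl
  have hsq : ∀ i, (![u1, u2, u3, u4] i) ^ 2 = 1 := by
    have e1 := axis_sq hmu hlam
    have e2 : diagonal ![(-1 : F), 1, -1] * diagonal ![(-1 : F), 1, -1] = 1 := by
      ext a b
      fin_cases a <;> fin_cases b <;> simp
    have e3 := planar_reflection_sq (a := alpha) (b := beta) (by
      apply mul_left_cancel₀ (mul_ne_zero three_ne three_ne)
      linear_combination (3 * alpha + 1) * ha + hb)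
    have e4 := twisting_mul_dual hrq hxi' heta'
    have e5 := mul_eq_one_comm.1 e4
    intro i
    fin_cases i <;> ext1 <;>
      simp only [Fin.zero_eta, Fin.mk_one, Fin.reduceFinMk, cons_val, Units.val_mul,
        Units.val_one, hu1, hu2, hu3, hu4, sq, fromBlocks_multiply, mul_zero, zero_mul, add_zero,
        zero_add, e1, e2, e3, e4, e5, fromBlocks_one]
  have hscal := fun {a b : F} => eq_of_eq_mul_scalar (a := a) (b := b)
    (v := fun i => ((![u1, u2, u3, u4] i : GL (Fin 3 ⊕ Fin 3) F) :
      Matrix (Fin 3 ⊕ Fin 3) (Fin 3 ⊕ Fin 3) F))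
    two_ne hr0 hb0 alpha xi eta _ hu1 hu2 hu3 hu4
  have htnot : (QuotientGroup.mk (⟨tu, htuG⟩ : ↥G) : ↥G ⧸ N) ∉
      Subgroup.closure {(QuotientGroup.mk (⟨u2, h2⟩ : ↥G) : ↥G ⧸ N),
        QuotientGroup.mk (⟨u3, h3⟩ : ↥G)} := by
    intro h
    rw [← Set.image_pair] at h
    obtain ⟨g, hg, hc⟩ := exists_commute_rep
      ((Units.coeHom (Matrix (Fin 3 ⊕ Fin 3) (Fin 3 ⊕ Fin 3) F)).comp G.subtype) N
      (fromBlocks 1 0 0 (-1)) (by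
        rintro x (rfl | rfl) <;>
          simp [commute_iff_eq, hu2, hu3, fromBlocks_multiply, -fromBlocks_diagonal]) h
    obtain ⟨a, b, -, hb', hab⟩ := hsep _ _ hg.symm
    have hc' : (g : GL (Fin 3 ⊕ Fin 3) F).val * fromBlocks 1 0 0 (-1) =
      fromBlocks 1 0 0 (-1) * (g : GL (Fin 3 ⊕ Fin 3) F).val := hc
    have hc'' := congrFun₂ hc' (Sum.inl 0) (Sum.inr 0)
    simp [hab, htu, fromBlocks_multiply, -fromBlocks_diagonal] at hc''
    apply mul_ne_zero two_ne hb'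
    linear_combination -hc''
  have hin1 : (QuotientGroup.mk (⟨tu, htuG⟩ : ↥G) : ↥G ⧸ N) ∈
      Subgroup.closure {(QuotientGroup.mk (⟨u1, h1⟩ : ↥G) : ↥G ⧸ N),
          QuotientGroup.mk (⟨u2, h2⟩ : ↥G), QuotientGroup.mk (⟨u3, h3⟩ : ↥G)} := by
    have h : (⟨tu, htuG⟩ : ↥G) = (⟨u1, h1⟩ * (⟨u2, h2⟩ * ⟨u3, h3⟩) ^ k) ^ p :=
      Subtype.ext hA.symm
    rw [h]
    simp only [QuotientGroup.mk_pow, QuotientGroup.mk_mul]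
    exact pow_mem (mul_mem (Subgroup.subset_closure (by simp)) (pow_mem (mul_mem
      (Subgroup.subset_closure (by simp)) (Subgroup.subset_closure (by simp))) _)) _
  have hin2 : (QuotientGroup.mk (⟨tu, htuG⟩ : ↥G) : ↥G ⧸ N) ∈
      Subgroup.closure {(QuotientGroup.mk (⟨u2, h2⟩ : ↥G) : ↥G ⧸ N),
          QuotientGroup.mk (⟨u3, h3⟩ : ↥G), QuotientGroup.mk (⟨u4, h4⟩ : ↥G)} := by
    have h : (⟨tu, htuG⟩ : ↥G) = ((⟨u2, h2⟩ * ⟨u3, h3⟩) ^ m)⁻¹ *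
        (⟨zu, hz⟩ * ⟨u4, h4⟩ * (⟨u2, h2⟩ * ⟨u3, h3⟩) ^ l) ^ p :=
      eq_inv_mul_of_mul_eq (Subtype.ext hB.symm)
    rw [h]
    simp only [QuotientGroup.mk_pow, QuotientGroup.mk_mul, QuotientGroup.mk_inv, hmkz, one_mul]
    have h23 := fun j : ℕ => pow_mem (mul_mem
      (Subgroup.subset_closure (by simp) : (QuotientGroup.mk (⟨u2, h2⟩ : ↥G) : ↥G ⧸ N) ∈
        Subgroup.closure {(QuotientGroup.mk (⟨u2, h2⟩ : ↥G) : ↥G ⧸ N),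
          QuotientGroup.mk (⟨u3, h3⟩ : ↥G), QuotientGroup.mk (⟨u4, h4⟩ : ↥G)})
      (Subgroup.subset_closure (by simp) : (QuotientGroup.mk (⟨u3, h3⟩ : ↥G) : ↥G ⧸ N) ∈ _)) j
    exact mul_mem (inv_mem (h23 m))
      (pow_mem (mul_mem (Subgroup.subset_closure (by simp)) (h23 l)) _)
  refine ⟨?_, hNn, ?_, ?_, ?_, ?_⟩
  · rw [hNz, Nat.card_zpowers, hzo]
  · intro i j heq
    obtain ⟨a, b, ha0, hb0', hab⟩ := hsep _ _ heq
    exact (hscal ha0 hb0').1 i j (by fin_cases i <;> fin_cases j <;> exact hab)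
  · intro i
    refine orderOf_eq_prime ?_ fun heq => ?_
    · rw [← QuotientGroup.mk_pow]
      refine congrArg (QuotientGroup.mk : ↥G → ↥G ⧸ N) (a₂ := 1) (Subtype.ext ?_)
      have := hsq i
      fin_cases i <;> exact this
    · obtain ⟨a, b, ha0, hb0', hab⟩ := hsep 1 _ heq.symm
      refine (hscal ha0 hb0').2 i ?_
      fin_cases i <;> exact hab.trans (one_mul _)
  · refine lt_of_le_of_ne (le_inf ?_ ?_) fun h => htnot (h ▸ ⟨hin1, hin2⟩)
    all_goals
      apply Subgroup.closure_mono
      rintro x (rfl | rfl) <;> simp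
  · rintro ⟨-, -, -, hint⟩
    have h := hint {0, 1, 2} {1, 2, 3}
    have hJ : ({0, 1, 2} ∩ {1, 2, 3} : Set (Fin 4)) = {1, 2} := by
      ext i
      fin_cases i <;> simp
    rw [hJ] at h
    simp only [Set.image_insert_eq, Set.image_singleton] at h
    exact htnot (h ▸ ⟨hin1, hin2⟩)
end

section
/- With the Section-4 setup, the subgroups G₁₂₃ = ⟨t₁, t₂, t₃⟩ and G₂₃₄ = ⟨t₂, t₃, t₄⟩ of GL₆(GF(p)) are each isomorphic to PGL₂(p) (the quotient of GL₂(GF(p)) by its centre). -/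
open Matrix

/-- If `φ` has the centre as its kernel, then the image of a set that generates `G` modulo the
centre generates a copy of `G ⧸ center G`. -/
theorem nonempty_closure_image_mulEquiv_quotient_center {G H : Type*} [Group G] [Group H]
    (φ : G →* H) (hker : φ.ker = Subgroup.center G) (s : Set G)
    (hs : Subgroup.closure s ⊔ Subgroup.center G = ⊤) :
    Nonempty (↥(Subgroup.closure (φ '' s)) ≃* G ⧸ Subgroup.center G) := by
  have hrange : φ.range = Subgroup.closure (φ '' s) := by
    rw [MonoidHom.range_eq_map, ← hs, Subgroup.map_sup, ← hker, ← MonoidHom.map_closure,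
      (Subgroup.map_eq_bot_iff _).2 le_rfl, sup_bot_eq]
  exact ⟨(MulEquiv.subgroupCongr hrange).symm.trans
    ((QuotientGroup.quotientKerEquivRange φ).symm.trans (QuotientGroup.quotientMulEquivOfEq hker))⟩

theorem isSquare_mul_of_not_isSquare {F : Type*} [Field F] [Finite F] {a b : F}
    (ha : ¬ IsSquare a) (hb : ¬ IsSquare b) : IsSquare (a * b) := by
  classical
  have := Fintype.ofFinite F
  by_cases h0 : a * b = 0
  · simp [h0]
  · rw [← quadraticChar_one_iff_isSquare h0, map_mul,
      quadraticChar_neg_one_iff_not_isSquare.2 ha, quadraticChar_neg_one_iff_not_isSquare.2 hb]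
    rfl

section Generation

variable {p : ℕ} [Fact p.Prime]

theorem map_mem_of_map_mem (K : Subgroup (GL (Fin 2) (ZMod p)))
    (u : ZMod p → GL (Fin 2) (ZMod p)) (hadd : ∀ x y, u (x + y) = u x * u y) (h0 : u 0 = 1)
    {t : ZMod p} (ht : t ≠ 0) (hu : u t ∈ K) (x : ZMod p) : u x ∈ K := by
  have hn (n : ℕ) : u (n * t) ∈ K := by
    induction n with
    | zero => simp [h0]
    | succ n ih => simpa [add_mul, hadd] using mul_mem ih hu
  simpa [ht] using hn (x / t).val

/-- A subgroup of `GL₂(p)` containing both full root subgroups contains all matrices of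
determinant one. -/
theorem mem_of_det_eq_one {F : Type*} [Field F] (K : Subgroup (GL (Fin 2) F))
    (hU : ∀ (x : F) (g : GL (Fin 2) F), g.val = !![1, x; 0, 1] → g ∈ K)
    (hL : ∀ (x : F) (g : GL (Fin 2) F), g.val = !![1, 0; x, 1] → g ∈ K)
    (g : GL (Fin 2) F) (hg : g.val.det = 1) : g ∈ K := by
  have upper (x : F) : ∃ u ∈ K, u.val = !![1, x; 0, 1] :=
    ⟨GeneralLinearGroup.mkOfDetNeZero !![1, x; 0, 1] (by simp), hU x _ rfl, rfl⟩
  have lower (x : F) : ∃ u ∈ K, u.val = !![1, 0; x, 1] :=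
    ⟨GeneralLinearGroup.mkOfDetNeZero !![1, 0; x, 1] (by simp), hL x _ rfl, rfl⟩
  have main (g : GL (Fin 2) F) (hg : g.val.det = 1) (hc : g.val 1 0 ≠ 0) : g ∈ K := by
    obtain ⟨u, hu, hu'⟩ := upper ((g.val 0 0 - 1) / g.val 1 0)
    obtain ⟨v, hv, hv'⟩ := upper ((g.val 1 1 - 1) / g.val 1 0)
    obtain ⟨l, hl, hl'⟩ := lower (g.val 1 0)
    suffices g = u * l * v by rw [this]; exact mul_mem (mul_mem hu hl) hv
    rw [det_fin_two] at hg
    ext i j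
    rw [Units.val_mul, Units.val_mul, hu', hv', hl']
    fin_cases i <;> fin_cases j <;> simp [Matrix.mul_apply, Fin.sum_univ_two] <;> field_simp <;>
      grind
  by_cases hc : g.val 1 0 = 0
  · obtain ⟨l, hl, hl'⟩ := lower 1
    rw [← mul_mem_cancel_left hl]
    refine main _ (by rw [Units.val_mul, det_mul, hg, hl']; simp) ?_
    rw [det_fin_two] at hg
    rw [Units.val_mul, hl']
    simp [Matrix.mul_apply, Fin.sum_univ_two, hc]
    grind
  · exact main g hg hc

/-- Three elements generating `GL₂(p)` modulo scalars. -/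
theorem closure_sup_center_eq_top {b : ZMod p} (hb : ¬ IsSquare (-b))
    {w h k : GL (Fin 2) (ZMod p)} (hw : w.val = !![0, b; 1, 0]) (hh : h.val = !![1, 0; 0, -1])
    (hk : k.val = !![1, 1; 0, -1]) :
    Subgroup.closure {w, h, k} ⊔ Subgroup.center (GL (Fin 2) (ZMod p)) = ⊤ := by
  set K := Subgroup.closure {w, h, k} ⊔ Subgroup.center (GL (Fin 2) (ZMod p))
  have hgen {g} (hg : g ∈ ({w, h, k} : Set (GL (Fin 2) (ZMod p)))) : g ∈ K :=
    Subgroup.mem_sup_left (Subgroup.subset_closure hg)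
  have hwK : w ∈ K := hgen (by simp)
  have hb0 : b ≠ 0 := by
    rintro rfl
    exact hb (by simp)
  have hU (x : ZMod p) (g : GL (Fin 2) (ZMod p)) (hg : g.val = !![1, x; 0, 1]) : g ∈ K := by
    obtain rfl : g = GeneralLinearGroup.upperRightHom x := Units.ext hg
    refine map_mem_of_map_mem K GeneralLinearGroup.upperRightHom
      (fun x y ↦ AddChar.map_add_eq_mul _ x y) (AddChar.map_zero_eq_one _) one_ne_zero ?_ x
    have : GeneralLinearGroup.upperRightHom 1 = h * k := by
      apply Units.ext
      simp [hh, hk]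
    rw [this]
    exact mul_mem (hgen (by simp)) (hgen (by simp))
  have hL (x : ZMod p) (g : GL (Fin 2) (ZMod p)) (hg : g.val = !![1, 0; x, 1]) : g ∈ K := by
    have hg' : g = w * GeneralLinearGroup.upperRightHom (b * x) * w⁻¹ := by
      rw [eq_mul_inv_iff_mul_eq]
      apply Units.ext
      simp [hw, hg, mul_comm]
    rw [hg']
    exact mul_mem (mul_mem hwK (hU _ _ rfl)) (inv_mem hwK)
  have hsq (g : GL (Fin 2) (ZMod p)) (hg : IsSquare g.val.det) : g ∈ K := by
    obtain ⟨d, hd⟩ := hg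
    have hd0 : d ≠ 0 := by
      rintro rfl
      exact g.det_ne_zero (by simpa using hd)
    have hz : GeneralLinearGroup.scalar (Fin 2) (Units.mk0 d hd0)⁻¹ ∈ K := by
      refine Subgroup.mem_sup_right ?_
      rw [GeneralLinearGroup.center_eq_range_scalar]
      exact ⟨_, rfl⟩
    rw [← mul_mem_cancel_left hz]
    refine mem_of_det_eq_one K hU hL _ ?_
    rw [Units.val_mul, det_mul, hd, GeneralLinearGroup.coe_scalar]
    simp
    field_simp
  refine eq_top_iff.2 fun g _ ↦ ?_
  by_cases hg : IsSquare g.val.det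
  · exact hsq g hg
  · rw [← mul_mem_cancel_left hwK]
    refine hsq _ ?_
    rw [Units.val_mul, det_mul, hw]
    simpa using isSquare_mul_of_not_isSquare hb hg

end Generation

section Representation

variable {F : Type*} [Field F]

/-- The action of `g` on binary quadratic forms, in the basis `x², xy, y²`. -/
def symSquare (g : Matrix (Fin 2) (Fin 2) F) : Matrix (Fin 3) (Fin 3) F :=
  !![g 0 0 ^ 2, g 0 0 * g 0 1, g 0 1 ^ 2;
    2 * g 0 0 * g 1 0, g 0 0 * g 1 1 + g 0 1 * g 1 0, 2 * g 0 1 * g 1 1;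
    g 1 0 ^ 2, g 1 0 * g 1 1, g 1 1 ^ 2]

theorem symSquare_one : symSquare (1 : Matrix (Fin 2) (Fin 2) F) = 1 := by
  ext i j
  fin_cases i <;> fin_cases j <;> simp [symSquare]

theorem symSquare_mul (g h : Matrix (Fin 2) (Fin 2) F) :
    symSquare (g * h) = symSquare g * symSquare h := by
  ext i j
  fin_cases i <;> fin_cases j <;>
    simp [symSquare, Matrix.mul_apply, Fin.sum_univ_two, Fin.sum_univ_three] <;> ring

/-- The symmetric square twisted by the inverse of the determinant. -/
def twistedSymSquare (g : Matrix (Fin 2) (Fin 2) F) : Matrix (Fin 3) (Fin 3) F :=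
  g.det⁻¹ • symSquare g

theorem twistedSymSquare_one : twistedSymSquare (1 : Matrix (Fin 2) (Fin 2) F) = 1 := by
  simp [twistedSymSquare, symSquare_one]

theorem twistedSymSquare_mul (g h : Matrix (Fin 2) (Fin 2) F) :
    twistedSymSquare (g * h) = twistedSymSquare g * twistedSymSquare h := by
  simp [twistedSymSquare, symSquare_mul, smul_smul, mul_comm]

theorem twistedSymSquare_eq_one_iff (g : GL (Fin 2) F) :
    twistedSymSquare g.val = 1 ↔ g ∈ Subgroup.center (GL (Fin 2) F) := by
  have hdet : g.val.det ≠ 0 := g.det_ne_zero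
  rw [GeneralLinearGroup.mem_center_iff_val_mem_range_scalar]
  constructor
  · intro h
    rw [twistedSymSquare, inv_smul_eq_iff₀ hdet] at h
    have h02 := congr_fun₂ h 0 2
    have h20 := congr_fun₂ h 2 0
    have h00 := congr_fun₂ h 0 0
    simp [symSquare] at h02 h20 h00
    rw [det_fin_two] at h00 hdet
    have h : g.val 0 0 = g.val 1 1 := by grind
    refine ⟨g.val 0 0, ?_⟩
    ext i j
    fin_cases i <;> fin_cases j <;> simp [h02, h20, h]
  · rintro ⟨a, ha⟩
    rw [← ha] at hdet
    rw [← ha, twistedSymSquare, inv_smul_eq_iff₀ hdet]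
    ext i j
    fin_cases i <;> fin_cases j <;> simp [symSquare, sq]

variable [Fintype F] [DecidableEq F]

/-- The sum of the twisted symmetric square and its tensor product with the sign character of
`PGL₂`, in a basis in which elements of nonsquare determinant swap the two summands. -/
noncomputable def inducedRep (h2 : (2 : F) ≠ 0) : GL (Fin 2) F →* GL (Fin 3 ⊕ Fin 3) F :=
  MonoidHom.toHomUnits
  { toFun g :=
      let c : F := (quadraticChar F g.val.det : ℤ)
      fromBlocks (((1 + c) / 2) • twistedSymSquare g.val) (((1 - c) / 2) • twistedSymSquare g.val)
        (((1 - c) / 2) • twistedSymSquare g.val) (((1 + c) / 2) • twistedSymSquare g.val)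
    map_one' := by simp [twistedSymSquare_one, one_add_one_eq_two, h2]
    map_mul' g h := by
      simp only [fromBlocks_multiply, Units.val_mul, twistedSymSquare_mul, det_mul, map_mul,
        Int.cast_mul, smul_mul_smul_comm, ← add_smul]
      congr 2 <;> field_simp <;> ring }

theorem val_inducedRep_of_isSquare (h2 : (2 : F) ≠ 0) {g : GL (Fin 2) F}
    (hg : IsSquare g.val.det) : (inducedRep h2 g).val =
      fromBlocks (twistedSymSquare g.val) 0 0 (twistedSymSquare g.val) := by
  simp [inducedRep, (quadraticChar_one_iff_isSquare g.det_ne_zero).2 hg,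
    -quadraticChar_apply, one_add_one_eq_two, h2]

theorem val_inducedRep_of_not_isSquare (h2 : (2 : F) ≠ 0) {g : GL (Fin 2) F}
    (hg : ¬ IsSquare g.val.det) : (inducedRep h2 g).val =
      fromBlocks 0 (twistedSymSquare g.val) (twistedSymSquare g.val) 0 := by
  simp [inducedRep, quadraticChar_neg_one_iff_not_isSquare.2 hg,
    -quadraticChar_apply, one_add_one_eq_two, h2]

theorem ker_inducedRep (h2 : (2 : F) ≠ 0) :
    (inducedRep h2).ker = Subgroup.center (GL (Fin 2) F) := by
  ext g
  rw [MonoidHom.mem_ker, Units.ext_iff, ← twistedSymSquare_eq_one_iff]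
  by_cases hg : IsSquare g.val.det
  · rw [val_inducedRep_of_isSquare h2 hg, Units.val_one, ← fromBlocks_one, fromBlocks_inj]
    tauto
  · rw [val_inducedRep_of_not_isSquare h2 hg, Units.val_one, ← fromBlocks_one, fromBlocks_inj]
    refine ⟨fun h ↦ (zero_ne_one h.1).elim, fun h ↦ (hg ?_).elim⟩
    rw [twistedSymSquare_eq_one_iff, GeneralLinearGroup.mem_center_iff_val_mem_range_scalar] at h
    obtain ⟨a, ha⟩ := h
    rw [← ha]
    exact ⟨a, by simp [sq]⟩

end Representation

/-- A triple in `GL₆(p)` is conjugate, by the block-diagonal matrix with blocks `S` and `T`, to the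
image of a generating triple of `PGL₂(p)`. -/
theorem nonempty_closure_mulEquiv_of_intertwining {p : ℕ} [Fact p.Prime]
    (h2 : ¬ IsSquare (2 : ZMod p)) (hneg : IsSquare (-1 : ZMod p))
    {S T A B H K : Matrix (Fin 3) (Fin 3) (ZMod p)} (hS : S.det ≠ 0) (hT : T.det ≠ 0)
    {w h k : GL (Fin 3 ⊕ Fin 3) (ZMod p)} (hw : w.val = fromBlocks 0 A B 0)
    (hh : h.val = fromBlocks H 0 0 H) (hk : k.val = fromBlocks K 0 0 K)
    (hA : A * T = S * !![0, 0, -2⁻¹; 0, -1, 0; -2, 0, 0])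
    (hB : B * S = T * !![0, 0, -2⁻¹; 0, -1, 0; -2, 0, 0])
    (hHS : H * S = S * !![-1, 0, 0; 0, 1, 0; 0, 0, -1])
    (hHT : H * T = T * !![-1, 0, 0; 0, 1, 0; 0, 0, -1])
    (hKS : K * S = S * !![-1, -1, -1; 0, 1, 2; 0, 0, -1])
    (hKT : K * T = T * !![-1, -1, -1; 0, 1, 2; 0, 0, -1]) :
    Nonempty (↥(Subgroup.closure {w, h, k}) ≃*
      (GL (Fin 2) (ZMod p) ⧸ Subgroup.center (GL (Fin 2) (ZMod p)))) := by
  have h20 : (2 : ZMod p) ≠ 0 := fun h ↦ h2 (by simp [h])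
  have hhalf : ¬ IsSquare (-2⁻¹ : ZMod p) := fun h ↦ h2 (by simpa using (hneg.mul h).inv)
  let w₀ : GL (Fin 2) (ZMod p) :=
    GeneralLinearGroup.mkOfDetNeZero !![0, 2⁻¹; 1, 0] (by simpa using h20)
  let h₀ : GL (Fin 2) (ZMod p) := GeneralLinearGroup.mkOfDetNeZero !![1, 0; 0, -1] (by simp)
  let k₀ : GL (Fin 2) (ZMod p) := GeneralLinearGroup.mkOfDetNeZero !![1, 1; 0, -1] (by simp)
  have hw₀ : w₀.val = !![0, 2⁻¹; 1, 0] := rfl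
  have hh₀ : h₀.val = !![1, 0; 0, -1] := rfl
  have hk₀ : k₀.val = !![1, 1; 0, -1] := rfl
  have hwρ : (inducedRep h20 w₀).val = fromBlocks 0 !![0, 0, -2⁻¹; 0, -1, 0; -2, 0, 0]
      !![0, 0, -2⁻¹; 0, -1, 0; -2, 0, 0] 0 := by
    rw [val_inducedRep_of_not_isSquare h20 (by simpa [hw₀] using hhalf), hw₀]
    congr 1 <;> ext i j <;> fin_cases i <;> fin_cases j <;>
      simp [twistedSymSquare, symSquare] <;> field_simp
  have hhρ : (inducedRep h20 h₀).val = fromBlocks !![-1, 0, 0; 0, 1, 0; 0, 0, -1] 0 0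
      !![-1, 0, 0; 0, 1, 0; 0, 0, -1] := by
    rw [val_inducedRep_of_isSquare h20 (by simpa [hh₀] using hneg), hh₀]
    congr 1 <;> ext i j <;> fin_cases i <;> fin_cases j <;>
      simp [twistedSymSquare, symSquare]
  have hkρ : (inducedRep h20 k₀).val = fromBlocks !![-1, -1, -1; 0, 1, 2; 0, 0, -1] 0 0
      !![-1, -1, -1; 0, 1, 2; 0, 0, -1] := by
    rw [val_inducedRep_of_isSquare h20 (by simpa [hk₀] using hneg), hk₀]
    congr 1 <;> ext i j <;> fin_cases i <;> fin_cases j <;>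
      simp [twistedSymSquare, symSquare]
  let P : GL (Fin 3 ⊕ Fin 3) (ZMod p) :=
    GeneralLinearGroup.mkOfDetNeZero (fromBlocks S 0 0 T) (by simp [hS, hT])
  have hP : P.val = fromBlocks S 0 0 T := rfl
  let φ := (MulAut.conj P).toMonoidHom.comp (inducedRep h20)
  have hφ : φ.ker = Subgroup.center _ := by
    rw [← ker_inducedRep h20]
    exact MonoidHom.ker_comp_of_injective _ _ (MulAut.conj P).injective
  have conj_eq {x y : GL (Fin 3 ⊕ Fin 3) (ZMod p)} (hxy : y.val * P.val = P.val * x.val) :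
      MulAut.conj P x = y := by
    rw [MulAut.conj_apply, mul_inv_eq_iff_eq_mul]
    exact (Units.ext hxy).symm
  have hwφ : φ w₀ = w := conj_eq (by
    rw [hw, hP, hwρ]
    simp [fromBlocks_multiply, hA, hB])
  have hhφ : φ h₀ = h := conj_eq (by
    rw [hh, hP, hhρ]
    simp [fromBlocks_multiply, hHS, hHT])
  have hkφ : φ k₀ = k := conj_eq (by
    rw [hk, hP, hkρ]
    simp [fromBlocks_multiply, hKS, hKT])
  have := nonempty_closure_image_mulEquiv_quotient_center φ hφ {w₀, h₀, k₀}
    (closure_sup_center_eq_top hhalf hw₀ hh₀ hk₀)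
  rwa [Set.image_insert_eq, Set.image_pair, hwφ, hhφ, hkφ] at this

section Intertwiners

variable {F : Type*} [Field F]

/-- The common diagonal block of `u3`, written in terms of a cube root of unity `rho`, a square root
`iota` of `-1`, and a sign `s`. -/
def involutionBlock (rho iota s : F) : Matrix (Fin 3) (Fin 3) F :=
  !![1, s * (2 + 2 * rho - 2 * rho * iota), s * (-2 * rho - 2 * iota - 2 * rho * iota);
    s * (2 + 2 * rho - 2 * rho * iota), 1 + 4 * rho + 4 * iota, 4 - 2 * iota - 4 * rho * iota;
    s * (-2 * rho - 2 * iota - 2 * rho * iota), 4 - 2 * iota - 4 * rho * iota,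
    -3 - 4 * rho - 4 * iota]

/-- Carries the twisted symmetric square to the representation of `⟨u1, u2, u3⟩` on each of the
two summands. -/
def commutingIntertwiner (rho iota s : F) : Matrix (Fin 3) (Fin 3) F :=
  !![0, s * (1 + rho), s * (1 + rho); 2 * (rho + iota), rho + iota, rho;
    2 * (1 - rho * iota), 1 - rho * iota, 1]

/-- With `secondIntertwiner`, carries the twisted symmetric square to the representations of the
even part of `⟨u2, u3, u4⟩` on the two summands. -/
def firstIntertwiner (rho iota s : F) : Matrix (Fin 3) (Fin 3) F :=
  !![0, s * (1 + iota + rho * iota), 0; -2 * rho, 0, -rho * iota;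
    2 * rho * iota, 0, rho - 2 * iota - rho * iota]

/-- See `firstIntertwiner`. -/
def secondIntertwiner (rho iota s : F) : Matrix (Fin 3) (Fin 3) F :=
  !![0, s * (-1 - rho - rho * iota), 0; -2, 0, 1 + 2 * rho - iota; 2 * iota, 0, 1]

theorem det_commutingIntertwiner_ne_zero {rho iota s : F} (h20 : (2 : F) ≠ 0)
    (hrho : rho ^ 2 = -1 - rho) (hiota : iota ^ 2 = -1) (hs : s ^ 2 = 1) :
    (commutingIntertwiner rho iota s).det ≠ 0 := by
  have : (commutingIntertwiner rho iota s).det * (s * iota) = 2 := by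
    simp [commutingIntertwiner, det_fin_three]
    grind
  exact left_ne_zero_of_mul (this ▸ h20)

theorem det_firstIntertwiner_ne_zero {rho iota s : F} (h20 : (2 : F) ≠ 0)
    (hrho : rho ^ 2 = -1 - rho) (hiota : iota ^ 2 = -1) (hs : s ^ 2 = 1) :
    (firstIntertwiner rho iota s).det ≠ 0 := by
  have : (firstIntertwiner rho iota s).det * (s * (4 + 3 * rho + iota - 3 * rho * iota)) = 2 := by
    simp [firstIntertwiner, det_fin_three]
    grind
  exact left_ne_zero_of_mul (this ▸ h20)

theorem det_secondIntertwiner_ne_zero {rho iota s : F} (h20 : (2 : F) ≠ 0)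
    (hrho : rho ^ 2 = -1 - rho) (hiota : iota ^ 2 = -1) (hs : s ^ 2 = 1) :
    (secondIntertwiner rho iota s).det ≠ 0 := by
  have : (secondIntertwiner rho iota s).det * (s * (4 + 3 * rho + iota - 3 * rho * iota)) = 2 := by
    simp [secondIntertwiner, det_fin_three]
    grind
  exact left_ne_zero_of_mul (this ▸ h20)

theorem swap_mul_commutingIntertwiner {rho iota s : F} (h20 : (2 : F) ≠ 0)
    (hrho : rho ^ 2 = -1 - rho) (hiota : iota ^ 2 = -1) (hs : s ^ 2 = 1) :
    !![0, s * iota * rho, -(s * iota * rho) * rho; s * iota * rho, rho, 1;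
        -(s * iota * rho) * rho, 1, rho ^ 2] * commutingIntertwiner rho iota s =
      commutingIntertwiner rho iota s * !![0, 0, -2⁻¹; 0, -1, 0; -2, 0, 0] := by
  ext i j
  fin_cases i <;> fin_cases j <;>
    simp [commutingIntertwiner, Matrix.mul_apply, Fin.sum_univ_three] <;> grind

theorem diagonal_mul_commutingIntertwiner {rho iota s : F} :
    diagonal ![(1 : F), -1, -1] * commutingIntertwiner rho iota s =
      commutingIntertwiner rho iota s * !![-1, -1, -1; 0, 1, 2; 0, 0, -1] := by
  ext i j
  fin_cases i <;> fin_cases j <;>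
    simp [commutingIntertwiner, Matrix.mul_apply, Fin.sum_univ_three] <;> grind

theorem involutionBlock_mul_commutingIntertwiner {rho iota s : F}
    (hrho : rho ^ 2 = -1 - rho) (hiota : iota ^ 2 = -1) (hs : s ^ 2 = 1) :
    involutionBlock rho iota s * commutingIntertwiner rho iota s =
      commutingIntertwiner rho iota s * !![-1, 0, 0; 0, 1, 0; 0, 0, -1] := by
  ext i j
  fin_cases i <;> fin_cases j <;>
    simp [commutingIntertwiner, involutionBlock, Matrix.mul_apply, Fin.sum_univ_three] <;> grind

theorem swap_mul_secondIntertwiner {rho iota s : F} (h20 : (2 : F) ≠ 0)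
    (hrho : rho ^ 2 = -1 - rho) :
    !![-rho, 0, 0; 0, 0, rho; 0, rho, -(1 - rho) * rho ^ 2] * secondIntertwiner rho iota s =
      firstIntertwiner rho iota s * !![0, 0, -2⁻¹; 0, -1, 0; -2, 0, 0] := by
  ext i j
  fin_cases i <;> fin_cases j <;>
    simp [firstIntertwiner, secondIntertwiner, Matrix.mul_apply, Fin.sum_univ_three] <;> grind

theorem swap_mul_firstIntertwiner {rho iota s : F} (h20 : (2 : F) ≠ 0)
    (hrho : rho ^ 2 = -1 - rho) :
    !![-rho ^ 2, 0, 0; 0, 1 - rho, rho ^ 2; 0, rho ^ 2, 0] * firstIntertwiner rho iota s =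
      secondIntertwiner rho iota s * !![0, 0, -2⁻¹; 0, -1, 0; -2, 0, 0] := by
  ext i j
  fin_cases i <;> fin_cases j <;>
    simp [firstIntertwiner, secondIntertwiner, Matrix.mul_apply, Fin.sum_univ_three] <;> grind

theorem diagonal_mul_firstIntertwiner {rho iota s : F} :
    diagonal ![(1 : F), -1, -1] * firstIntertwiner rho iota s =
      firstIntertwiner rho iota s * !![-1, 0, 0; 0, 1, 0; 0, 0, -1] := by
  ext i j
  fin_cases i <;> fin_cases j <;>
    simp [firstIntertwiner, Matrix.mul_apply, Fin.sum_univ_three]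

theorem involutionBlock_mul_firstIntertwiner {rho iota s : F}
    (hrho : rho ^ 2 = -1 - rho) (hiota : iota ^ 2 = -1) (hs : s ^ 2 = 1) :
    involutionBlock rho iota s * firstIntertwiner rho iota s =
      firstIntertwiner rho iota s * !![-1, -1, -1; 0, 1, 2; 0, 0, -1] := by
  ext i j
  fin_cases i <;> fin_cases j <;>
    simp [firstIntertwiner, involutionBlock, Matrix.mul_apply, Fin.sum_univ_three] <;> grind

theorem diagonal_mul_secondIntertwiner {rho iota s : F} :
    diagonal ![(1 : F), -1, -1] * secondIntertwiner rho iota s =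
      secondIntertwiner rho iota s * !![-1, 0, 0; 0, 1, 0; 0, 0, -1] := by
  ext i j
  fin_cases i <;> fin_cases j <;>
    simp [secondIntertwiner, Matrix.mul_apply, Fin.sum_univ_three]

theorem involutionBlock_mul_secondIntertwiner {rho iota s : F}
    (hrho : rho ^ 2 = -1 - rho) (hiota : iota ^ 2 = -1) (hs : s ^ 2 = 1) :
    involutionBlock rho iota s * secondIntertwiner rho iota s =
      secondIntertwiner rho iota s * !![-1, -1, -1; 0, 1, 2; 0, 0, -1] := by
  ext i j
  fin_cases i <;> fin_cases j <;>
    simp [secondIntertwiner, involutionBlock, Matrix.mul_apply, Fin.sum_univ_three] <;> grind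

end Intertwiners

theorem stmt_18 (p : ℕ) [Fact p.Prime] (hp3 : p % 3 = 1) (hp8 : p % 8 = 5)
    (rho iota alpha lam eps beta gamma delta mu : ZMod p)
    (hrho : orderOf rho = 3)
    (hiota : iota ^ 2 = -1)
    (halpha : alpha ^ 2 = (1 + rho ^ 2)⁻¹)
    (hlam : lam = alpha * (iota + 1) * (-1 + rho - iota * rho ^ 2))
    (heps : eps = -iota * lam)
    (hbeta : beta = -2⁻¹ * lam ^ 2 * iota)
    (hgamma : gamma = 2⁻¹ * lam ^ 2 - 1)
    (hdelta : delta = -1 - 2⁻¹ * lam ^ 2)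
    (hmu : mu = 1 - rho)
    (u1 u2 u3 u4 : GL (Fin 3 ⊕ Fin 3) (ZMod p))
    (hu1 : (u1 : Matrix (Fin 3 ⊕ Fin 3) (Fin 3 ⊕ Fin 3) (ZMod p)) =
      fromBlocks 0 !![0, alpha, -alpha * rho; alpha, rho, 1; -alpha * rho, 1, rho ^ 2]
        !![0, alpha, -alpha * rho; alpha, rho, 1; -alpha * rho, 1, rho ^ 2] 0)
    (hu2 : (u2 : Matrix (Fin 3 ⊕ Fin 3) (Fin 3 ⊕ Fin 3) (ZMod p)) =
      fromBlocks (diagonal ![(1 : ZMod p), -1, -1]) 0 0 (diagonal ![(1 : ZMod p), -1, -1]))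
    (hu3 : (u3 : Matrix (Fin 3 ⊕ Fin 3) (Fin 3 ⊕ Fin 3) (ZMod p)) =
      fromBlocks !![1, lam, eps; lam, gamma, beta; eps, beta, delta] 0 0
        !![1, lam, eps; lam, gamma, beta; eps, beta, delta])
    (hu4 : (u4 : Matrix (Fin 3 ⊕ Fin 3) (Fin 3 ⊕ Fin 3) (ZMod p)) =
      fromBlocks 0 !![-rho, 0, 0; 0, 0, rho; 0, rho, -mu * rho ^ 2]
        !![-rho ^ 2, 0, 0; 0, mu, rho ^ 2; 0, rho ^ 2, 0] 0) :
    Nonempty (↥(Subgroup.closure {u1, u2, u3}) ≃*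
      (GL (Fin 2) (ZMod p) ⧸ Subgroup.center (GL (Fin 2) (ZMod p)))) ∧
    Nonempty (↥(Subgroup.closure {u2, u3, u4}) ≃*
      (GL (Fin 2) (ZMod p) ⧸ Subgroup.center (GL (Fin 2) (ZMod p)))) := by
  have h2 : ¬ IsSquare (2 : ZMod p) := by
    rw [ZMod.exists_sq_eq_two_iff (by omega)]
    omega
  have hneg : IsSquare (-1 : ZMod p) := ⟨iota, by rw [← hiota, sq]⟩
  have h20 : (2 : ZMod p) ≠ 0 := fun h ↦ h2 (by simp [h])
  have hrho3 : rho ^ 3 = 1 := hrho ▸ pow_orderOf_eq_one rho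
  have hrho1 : rho - 1 ≠ 0 := by
    rw [sub_ne_zero]
    rintro rfl
    simp at hrho
  have hrho2 : rho ^ 2 = -1 - rho := by
    have : (rho - 1) * (rho ^ 2 + rho + 1) = 0 := by linear_combination hrho3
    linear_combination (mul_eq_zero.1 this).resolve_left hrho1
  have halpha2 : alpha ^ 2 = -rho ^ 2 := by
    rw [halpha]
    exact inv_eq_of_mul_eq_one_right (by linear_combination (-rho ^ 2) * hrho2 + hrho3)
  obtain ⟨s, hs, rfl⟩ : ∃ s : ZMod p, s ^ 2 = 1 ∧ alpha = s * iota * rho :=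
    ⟨-alpha * iota * rho ^ 2, by grind, by grind⟩
  have hB : !![1, lam, eps; lam, gamma, beta; eps, beta, delta] = involutionBlock rho iota s := by
    obtain rfl : lam = s * (2 + 2 * rho - 2 * rho * iota) := by grind
    obtain rfl : eps = s * (-2 * rho - 2 * iota - 2 * rho * iota) := by grind
    obtain rfl : gamma = 1 + 4 * rho + 4 * iota := by grind
    obtain rfl : delta = -3 - 4 * rho - 4 * iota := by grind
    obtain rfl : beta = 4 - 2 * iota - 4 * rho * iota := by grind
    rfl
  rw [hB] at hu3
  subst hmu
  constructor
  · rw [Set.pair_comm u2]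
    exact nonempty_closure_mulEquiv_of_intertwining h2 hneg
      (det_commutingIntertwiner_ne_zero h20 hrho2 hiota hs)
      (det_commutingIntertwiner_ne_zero h20 hrho2 hiota hs) hu1 hu3 hu2
      (swap_mul_commutingIntertwiner h20 hrho2 hiota hs)
      (swap_mul_commutingIntertwiner h20 hrho2 hiota hs)
      (involutionBlock_mul_commutingIntertwiner hrho2 hiota hs)
      (involutionBlock_mul_commutingIntertwiner hrho2 hiota hs)
      diagonal_mul_commutingIntertwiner diagonal_mul_commutingIntertwiner
  · rw [Set.pair_comm u3, Set.insert_comm u2]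
    exact nonempty_closure_mulEquiv_of_intertwining h2 hneg
      (det_firstIntertwiner_ne_zero h20 hrho2 hiota hs)
      (det_secondIntertwiner_ne_zero h20 hrho2 hiota hs) hu4 hu2 hu3
      (swap_mul_secondIntertwiner h20 hrho2)
      (swap_mul_firstIntertwiner h20 hrho2)
      diagonal_mul_firstIntertwiner diagonal_mul_secondIntertwiner
      (involutionBlock_mul_firstIntertwiner hrho2 hiota hs)
      (involutionBlock_mul_secondIntertwiner hrho2 hiota hs)
end
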